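/- Let (a_n)_{n≥1} be a sequence of distinct positive real numbers such that inf_{1≤m≠n≤N} |a_m − a_n| ≥ 1 for all N ∈ ℕ. Then for almost all α ∈ [0,1], the inequality ⌊δ_min^α⌋(N) ≤ 1 / H_N holds for infinitely many N. -/

import Mathlib

open MeasureTheory Filter

/-- Distance from a real number to the nearest integer. -/
noncomputable def nint (x : ℝ) : ℝ := |x - round x|

/-- `floorDeltaMin a α N = min { ‖α ⌊|a_m − a_n|⌋‖ : 1 ≤ m ≠ n ≤ N }`. -/
noncomputable def floorDeltaMin (a : ℕ → ℝ) (α : ℝ) (N : ℕ) : ℝ :=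
  sInf {d : ℝ | ∃ m n : ℕ, 1 ≤ m ∧ m ≤ N ∧ 1 ≤ n ∧ n ≤ N ∧ m ≠ n ∧
    d = nint (α * (⌊|a m - a n|⌋ : ℝ))}

/-- `Hcard a N` is the number of distinct floored positive differences
`#{ ⌊|a_m − a_n|⌋ : 1 ≤ m ≠ n ≤ N }`. -/
noncomputable def Hcard (a : ℕ → ℝ) (N : ℕ) : ℕ :=
  Set.ncard {k : ℤ | ∃ m n : ℕ, 1 ≤ m ∧ m ≤ N ∧ 1 ≤ n ∧ n ≤ N ∧ m ≠ n ∧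
    k = ⌊|a m - a n|⌋}

/-- `Log x = max (1, log x)`. -/
noncomputable def Log (x : ℝ) : ℝ := max 1 (Real.log x)

/-- Iterated logarithm `log₂ x = Log (Log x)`. -/
noncomputable def Log2 (x : ℝ) : ℝ := Log (Log x)

theorem rpow_three_quarters {x : ℝ} (hx : 0 ≤ x) :
    x ^ (3/4:ℝ) = x ^ (1/4:ℝ) * Real.sqrt x := by
  rw [Real.sqrt_eq_rpow, ← Real.rpow_add_of_nonneg hx (by norm_num) (by norm_num)]
  norm_num

/-- Schur test adapted to the exponent `3/4`. -/
theorem sum_rpow_le_of_row_col {I : Finset ℕ} {c : ℕ → ℕ → ℝ} {α β : ℕ → ℝ} {M m : ℝ}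
    (hc : ∀ i j, 0 ≤ c i j) (hα : ∀ i, 0 ≤ α i) (hβ : ∀ i, 0 ≤ β i) (hM : 0 ≤ M)
    (hrow : ∀ i ∈ I, ∑ j ∈ I, c i j ≤ M) (hcol : ∀ j ∈ I, ∑ i ∈ I, c i j ≤ M)
    (hm : ∀ i ∈ I, ∀ j ∈ I, c i j ≠ 0 → α i * β j ≤ m) :
    ∑ i ∈ I, ∑ j ∈ I, c i j * (α i * β j) ^ (3/4:ℝ) ≤
      M * m ^ (1/4:ℝ) * Real.sqrt ((∑ i ∈ I, α i) * ∑ j ∈ I, β j) := by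
  rcases le_or_gt 0 m with hm0 | hm0
  swap
  · have : ∑ i ∈ I, ∑ j ∈ I, c i j * (α i * β j) ^ (3/4:ℝ) = 0 := by
      refine Finset.sum_eq_zero fun i hi => Finset.sum_eq_zero fun j hj => ?_
      by_cases h : c i j = 0
      · simp [h]
      · exact absurd (hm i hi j hj h) (not_le.2 (hm0.trans_le (mul_nonneg (hα i) (hβ j))))
    rw [this]
    by_cases hI : ∃ i ∈ I, ∃ j ∈ I, c i j ≠ 0
    · obtain ⟨i, hi, j, hj, h⟩ := hI
      exact absurd (hm i hi j hj h) (not_le.2 (hm0.trans_le (mul_nonneg (hα i) (hβ j))))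
    · have : (0:ℝ) ≤ m ^ (1/4:ℝ) := by
        rw [Real.rpow_def_of_neg hm0]
        refine mul_nonneg (Real.exp_pos _).le (Real.cos_nonneg_of_mem_Icc ⟨?_, ?_⟩) <;>
          nlinarith [Real.pi_pos]
      positivity
  have h1 : ∀ i ∈ I, ∀ j ∈ I, c i j * (α i * β j) ^ (3/4:ℝ) ≤
      m ^ (1/4:ℝ) * (Real.sqrt (c i j * α i) * Real.sqrt (c i j * β j)) := by
    intro i hi j hj
    by_cases h : c i j = 0
    · simp [h]
    have hab := mul_nonneg (hα i) (hβ j)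
    have h2 : Real.sqrt (c i j * α i) * Real.sqrt (c i j * β j) =
        c i j * Real.sqrt (α i * β j) := by
      rw [← Real.sqrt_mul (mul_nonneg (hc i j) (hα i)),
        show c i j * α i * (c i j * β j) = c i j ^ 2 * (α i * β j) by ring,
        Real.sqrt_mul (sq_nonneg _), Real.sqrt_sq (hc i j)]
    rw [h2, rpow_three_quarters hab]
    have := Real.rpow_le_rpow hab (hm i hi j hj h) (by norm_num : (0:ℝ) ≤ 1/4)
    calc _ = (α i * β j) ^ (1/4:ℝ) * (c i j * Real.sqrt (α i * β j)) := by ring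
      _ ≤ _ := mul_le_mul_of_nonneg_right this (mul_nonneg (hc i j) (Real.sqrt_nonneg _))
  have h3 : ∑ i ∈ I, ∑ j ∈ I, Real.sqrt (c i j * α i) * Real.sqrt (c i j * β j) ≤
      M * Real.sqrt ((∑ i ∈ I, α i) * ∑ j ∈ I, β j) := by
    rw [← Finset.sum_product']
    refine (Real.sum_sqrt_mul_sqrt_le (I ×ˢ I) (f := fun x : ℕ × ℕ => c x.1 x.2 * α x.1)
      (g := fun x : ℕ × ℕ => c x.1 x.2 * β x.2) (fun x => mul_nonneg (hc _ _) (hα _))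
      (fun x => mul_nonneg (hc _ _) (hβ _))).trans ?_
    have e1 : ∑ x ∈ I ×ˢ I, c x.1 x.2 * α x.1 ≤ M * ∑ i ∈ I, α i := by
      rw [Finset.sum_product' (f := fun i j => c i j * α i), Finset.mul_sum]
      refine Finset.sum_le_sum fun i hi => ?_
      rw [← Finset.sum_mul]
      exact mul_le_mul_of_nonneg_right (hrow i hi) (hα i)
    have e2 : ∑ x ∈ I ×ˢ I, c x.1 x.2 * β x.2 ≤ M * ∑ i ∈ I, β i := by
      rw [Finset.sum_product_right' (f := fun i j => c i j * β j), Finset.mul_sum]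
      refine Finset.sum_le_sum fun i hi => ?_
      rw [← Finset.sum_mul]
      exact mul_le_mul_of_nonneg_right (hcol i hi) (hβ i)
    have hA : 0 ≤ ∑ i ∈ I, α i := Finset.sum_nonneg fun i _ => hα i
    calc _ ≤ Real.sqrt (M * ∑ i ∈ I, α i) * Real.sqrt (M * ∑ i ∈ I, β i) := by gcongr
      _ = _ := by
        rw [← Real.sqrt_mul (mul_nonneg hM hA),
          show M * ∑ i ∈ I, α i = M * ∑ i ∈ I, α i from rfl,
          show (M * ∑ i ∈ I, α i) * (M * ∑ i ∈ I, β i) =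
            M ^ 2 * ((∑ i ∈ I, α i) * ∑ i ∈ I, β i) by ring,
          Real.sqrt_mul (sq_nonneg _), Real.sqrt_sq hM]
  calc _ ≤ ∑ i ∈ I, ∑ j ∈ I,
        m ^ (1/4:ℝ) * (Real.sqrt (c i j * α i) * Real.sqrt (c i j * β j)) :=
        Finset.sum_le_sum fun i hi => Finset.sum_le_sum fun j hj => h1 i hi j hj
    _ = m ^ (1/4:ℝ) * ∑ i ∈ I, ∑ j ∈ I, Real.sqrt (c i j * α i) * Real.sqrt (c i j * β j) := by
        simp_rw [Finset.mul_sum]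
    _ ≤ m ^ (1/4:ℝ) * (M * Real.sqrt ((∑ i ∈ I, α i) * ∑ j ∈ I, β j)) :=
        mul_le_mul_of_nonneg_left h3 (Real.rpow_nonneg hm0 _)
    _ = _ := by ring

/-- Version of the Schur test with the trivial bound for the entries. -/
theorem sum_rpow_le_rpow_sum {I : Finset ℕ} {c : ℕ → ℕ → ℝ} {α β : ℕ → ℝ} {M : ℝ}
    (hc : ∀ i j, 0 ≤ c i j) (hα : ∀ i, 0 ≤ α i) (hβ : ∀ i, 0 ≤ β i) (hM : 0 ≤ M)
    (hrow : ∀ i ∈ I, ∑ j ∈ I, c i j ≤ M) (hcol : ∀ j ∈ I, ∑ i ∈ I, c i j ≤ M) :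
    ∑ i ∈ I, ∑ j ∈ I, c i j * (α i * β j) ^ (3/4:ℝ) ≤
      M * ((∑ i ∈ I, α i) * ∑ j ∈ I, β j) ^ (3/4:ℝ) := by
  have hA : 0 ≤ ∑ i ∈ I, α i := Finset.sum_nonneg fun i _ => hα i
  have hB : 0 ≤ ∑ i ∈ I, β i := Finset.sum_nonneg fun i _ => hβ i
  rw [rpow_three_quarters (mul_nonneg hA hB), ← mul_assoc]
  refine sum_rpow_le_of_row_col hc hα hβ hM hrow hcol fun i hi j hj _ => ?_
  exact mul_le_mul (Finset.single_le_sum (fun i _ => hα i) hi)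
    (Finset.single_le_sum (fun i _ => hβ i) hj) (hβ j) hA

theorem sum_pow_dist_le {q : ℝ} (h0 : 0 ≤ q) (h1 : q < 1) (I : Finset ℕ) (i : ℕ) :
    ∑ j ∈ I, (if i = j then 0 else q ^ ((i - j) + (j - i))) ≤ 2 * q / (1 - q) := by
  have key : ∀ J : Finset ℕ, ∑ k ∈ J, q ^ (k + 1) ≤ q / (1 - q) := by
    intro J
    have : HasSum (fun k => q ^ (k + 1)) (q / (1 - q)) := by
      have := (hasSum_geometric_of_lt_one h0 h1).mul_left q
      simpa [pow_succ', div_eq_mul_inv] using this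
    exact sum_le_hasSum J (fun _ _ => by positivity) this
  have h2 : ∑ j ∈ I, (if i = j then 0 else q ^ ((i - j) + (j - i))) ≤
      ∑ j ∈ I.filter (fun j => i < j), q ^ (j - i - 1 + 1) +
      ∑ j ∈ I.filter (fun j => j < i), q ^ (i - j - 1 + 1) := by
    rw [Finset.sum_filter, Finset.sum_filter, ← Finset.sum_add_distrib]
    refine Finset.sum_le_sum fun j _ => ?_
    rcases lt_trichotomy i j with h | h | h
    · rw [if_neg h.ne, if_pos h, if_neg (by omega),
        show (i - j) + (j - i) = j - i - 1 + 1 by omega]; simp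
    · simp [h]
    · rw [if_neg h.ne', if_neg (by omega), if_pos h,
        show (i - j) + (j - i) = i - j - 1 + 1 by omega]; simp
  have h3 : ∑ j ∈ I.filter (fun j => i < j), q ^ (j - i - 1 + 1) ≤ q / (1 - q) := by
    refine le_trans (le_of_eq ?_) (key ((I.filter (fun j => i < j)).image fun j => j - i - 1))
    rw [Finset.sum_image]
    intro x hx y hy h
    simp at hx hy h
    omega
  have h4 : ∑ j ∈ I.filter (fun j => j < i), q ^ (i - j - 1 + 1) ≤ q / (1 - q) := by
    refine le_trans (le_of_eq ?_) (key ((I.filter (fun j => j < i)).image fun j => i - j - 1))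
    rw [Finset.sum_image]
    intro x hx y hy h
    simp at hx hy h
    omega
  calc _ ≤ _ := h2
    _ ≤ q / (1 - q) + q / (1 - q) := add_le_add h3 h4
    _ = _ := by ring

theorem le_twelve_mul_of_lt {q t : ℝ} (ht : 0 < t) (hq : q ≤ 1 / 768) (h4 : t ^ 4 ≤ 12 * q)
    (h : 1 < 1 - 3/4 * t ^ 4 + 3 * q * t ^ 3 + 3 * q * t ^ 3 + 2 * t ^ 6) : t ≤ 12 * q := by
  have hineq : 0 < t ^ 3 * (6 * q + 2 * t ^ 3 - 3/4 * t) := by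
    rw [show t ^ 3 * (6 * q + 2 * t ^ 3 - 3/4 * t) =
      3 * q * t ^ 3 + 3 * q * t ^ 3 + 2 * t ^ 6 - 3/4 * t ^ 4 by ring]
    linarith
  have hineq' : 0 < 6 * q + 2 * t ^ 3 - 3/4 * t := pos_of_mul_pos_right hineq (by positivity)
  have ht2 : t ^ 2 ≤ 1 / 8 := by
    by_contra h
    push Not at h
    nlinarith
  nlinarith

theorem rpow_dichotomy_of_sum_eq_one {I : Finset ℕ} {α β : ℕ → ℝ} {q : ℝ} (hq0 : 0 ≤ q)
    (hq : q ≤ 1 / 768) (hα : ∀ i, 0 ≤ α i) (hβ : ∀ i, 0 ≤ β i)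
    (hA : ∑ i ∈ I, α i = 1) (hB : ∑ i ∈ I, β i = 1) :
    (∑ i ∈ I, ∑ j ∈ I, q ^ ((i - j) + (j - i)) * (α i * β j) ^ (3/4:ℝ) ≤ 1) ∨
      ∃ i₀, ∑ i ∈ I.erase i₀, α i ≤ 20736 * q ^ 4 ∧ ∑ i ∈ I.erase i₀, β i ≤ 20736 * q ^ 4 := by
  have hI : I.Nonempty := by
    by_contra h
    rw [Finset.not_nonempty_iff_eq_empty] at h
    simp [h] at hA
  have hq1 : q < 1 := by linarith
  have hM3 : 2 * q / (1 - q) ≤ 3 * q := by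
    rw [div_le_iff₀ (by linarith)]; nlinarith
  have hoff : ∀ J : Finset ℕ, ∀ i, ∑ j ∈ J, (if i = j then 0 else q ^ ((i - j) + (j - i))) ≤ 3 * q :=
    fun J i => (sum_pow_dist_le hq0 hq1 J i).trans hM3
  have hoff' : ∀ J : Finset ℕ, ∀ j, ∑ i ∈ J, (if i = j then 0 else q ^ ((i - j) + (j - i))) ≤ 3 * q := by
    intro J j
    refine le_trans (le_of_eq (Finset.sum_congr rfl fun i _ => ?_)) (hoff J j)
    simp only [eq_comm, add_comm]
  obtain ⟨i₀, hi₀, hmax⟩ := Finset.exists_max_image I (fun i => α i * β i) hI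
  set m := α i₀ * β i₀ with hm
  have hm0 : 0 ≤ m := mul_nonneg (hα _) (hβ _)
  have hle1 : ∀ i ∈ I, α i ≤ 1 := fun i hi => hA ▸ Finset.single_le_sum (fun i _ => hα i) hi
  have hle1' : ∀ i ∈ I, β i ≤ 1 := fun i hi => hB ▸ Finset.single_le_sum (fun i _ => hβ i) hi
  have hsplit : ∀ J : Finset ℕ, ∑ i ∈ J, ∑ j ∈ J, q ^ ((i - j) + (j - i)) * (α i * β j) ^ (3/4:ℝ) =
      ∑ i ∈ J, ∑ j ∈ J, (if i = j then (1:ℝ) else 0) * (α i * β j) ^ (3/4:ℝ) +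
      ∑ i ∈ J, ∑ j ∈ J, (if i = j then 0 else q ^ ((i - j) + (j - i))) *
        (α i * β j) ^ (3/4:ℝ) := by
    intro J
    simp_rw [← Finset.sum_add_distrib]
    refine Finset.sum_congr rfl fun i _ => Finset.sum_congr rfl fun j _ => ?_
    by_cases h : i = j <;> simp [h]
  have hcoff : ∀ i j : ℕ, 0 ≤ (if i = j then 0 else q ^ ((i - j) + (j - i))) := by
    intro i j; split_ifs <;> positivity
  have hcd : ∀ i j : ℕ, 0 ≤ (if i = j then (1:ℝ) else 0) := by
    intro i j; split_ifs <;> positivity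
  have hrd : ∀ J : Finset ℕ, ∀ i ∈ J, ∑ j ∈ J, (if i = j then (1:ℝ) else 0) ≤ 1 := by
    intro J i hi; simp [hi]
  have hrd' : ∀ J : Finset ℕ, ∀ j ∈ J, ∑ i ∈ J, (if i = j then (1:ℝ) else 0) ≤ 1 := by
    intro J i hi; simp [hi]
  by_cases hcase : m ^ (1/4:ℝ) + 3 * q ≤ 1
  · left
    rw [hsplit I]
    have h1 := sum_rpow_le_of_row_col (I := I) (m := m) hcd hα hβ zero_le_one (hrd I) (hrd' I)
      (by
        intro i hi j hj h
        have : i = j := by by_contra h'; simp [h'] at h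
        subst this; exact hmax i hi)
    have h2 := sum_rpow_le_rpow_sum (I := I) hcoff hα hβ (by positivity) (fun i _ => hoff I i)
      (fun i _ => hoff' I i)
    rw [hA, hB] at h1 h2
    simp only [mul_one, Real.sqrt_one, Real.one_rpow, one_mul] at h1 h2
    linarith
  push Not at hcase
  have hm12 : 1 - 12 * q ≤ m := by
    have h4 : (m ^ (1/4:ℝ)) ^ 4 = m := by
      rw [← Real.rpow_natCast, ← Real.rpow_mul hm0]; norm_num
    rw [← h4]
    have h5 : (1 - 3 * q) ^ 4 ≤ (m ^ (1/4:ℝ)) ^ 4 :=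
      pow_le_pow_left₀ (by linarith) (by linarith) 4
    have h6 : 1 - 12 * q ≤ (1 - 3 * q) ^ 4 := by
      have h7 := one_add_mul_le_pow (a := -(3 * q)) (by linarith) 4
      rw [show (1 - 3 * q) = 1 + -(3 * q) by ring]
      push_cast at h7
      linarith
    linarith
  set x := ∑ i ∈ I.erase i₀, α i with hx
  set y := ∑ i ∈ I.erase i₀, β i with hy
  have hx0 : 0 ≤ x := Finset.sum_nonneg fun i _ => hα i
  have hy0 : 0 ≤ y := Finset.sum_nonneg fun i _ => hβ i
  have hxe : α i₀ + x = 1 := by rw [hx, Finset.add_sum_erase I α hi₀, hA]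
  have hye : β i₀ + y = 1 := by rw [hy, Finset.add_sum_erase I β hi₀, hB]
  have hx12 : x ≤ 12 * q := by nlinarith [hα i₀, hβ i₀, hle1' i₀ hi₀]
  have hy12 : y ≤ 12 * q := by nlinarith [hα i₀, hβ i₀, hle1 i₀ hi₀]
  by_contra hcon
  push Not at hcon
  obtain ⟨hgt, hcon⟩ := hcon
  set u := max x y with hu
  have hu0 : 0 ≤ u := hx0.trans (le_max_left _ _)
  have hu12 : u ≤ 12 * q := max_le hx12 hy12
  set t := u ^ (1/4:ℝ) with ht
  have ht0 : 0 ≤ t := Real.rpow_nonneg hu0 _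
  have ht4 : t ^ 4 = u := by
    rw [ht, ← Real.rpow_natCast, ← Real.rpow_mul hu0]; norm_num
  have ht3 : u ^ (3/4:ℝ) = t ^ 3 := by
    rw [ht, ← Real.rpow_natCast, ← Real.rpow_mul hu0]; norm_num
  have hex : ∑ i ∈ I, ∑ j ∈ I, q ^ ((i - j) + (j - i)) * (α i * β j) ^ (3/4:ℝ) =
      (α i₀ * β i₀) ^ (3/4:ℝ) +
      ∑ j ∈ I.erase i₀, q ^ ((i₀ - j) + (j - i₀)) * (α i₀ * β j) ^ (3/4:ℝ) +
      ∑ i ∈ I.erase i₀, q ^ ((i - i₀) + (i₀ - i)) * (α i * β i₀) ^ (3/4:ℝ) +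
      ∑ i ∈ I.erase i₀, ∑ j ∈ I.erase i₀, q ^ ((i - j) + (j - i)) * (α i * β j) ^ (3/4:ℝ) := by
    rw [← Finset.add_sum_erase I _ hi₀, ← Finset.add_sum_erase I _ hi₀]
    have : ∀ i ∈ I.erase i₀, ∑ j ∈ I, q ^ ((i - j) + (j - i)) * (α i * β j) ^ (3/4:ℝ) =
      q ^ ((i - i₀) + (i₀ - i)) * (α i * β i₀) ^ (3/4:ℝ) +
      ∑ j ∈ I.erase i₀, q ^ ((i - j) + (j - i)) * (α i * β j) ^ (3/4:ℝ) :=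
      fun i _ => (Finset.add_sum_erase I _ hi₀).symm
    rw [Finset.sum_congr rfl this, Finset.sum_add_distrib]
    simp only [Nat.sub_self, add_zero, pow_zero, one_mul]
    ring
  have hp1 : (α i₀ * β i₀) ^ (3/4:ℝ) ≤ 1 - 3/4 * t ^ 4 := by
    have h1 : α i₀ * β i₀ ≤ 1 + (-u) := by
      rcases max_cases x y with ⟨h, _⟩ | ⟨h, _⟩ <;> rw [hu, h] <;>
        nlinarith [hα i₀, hβ i₀, hle1 i₀ hi₀, hle1' i₀ hi₀]
    refine (Real.rpow_le_rpow hm0 h1 (by norm_num)).trans ?_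
    refine (rpow_one_add_le_one_add_mul_self (by linarith) (by norm_num) (by norm_num)).trans ?_
    rw [ht4]; linarith
  have hp2 : ∑ j ∈ I.erase i₀, q ^ ((i₀ - j) + (j - i₀)) * (α i₀ * β j) ^ (3/4:ℝ) ≤
      3 * q * t ^ 3 := by
    calc _ ≤ ∑ j ∈ I.erase i₀, (if i₀ = j then 0 else q ^ ((i₀ - j) + (j - i₀))) * t ^ 3 := by
          refine Finset.sum_le_sum fun j hj => ?_
          rw [if_neg (Finset.ne_of_mem_erase hj).symm, ← ht3]
          have : β j ≤ y := Finset.single_le_sum (fun i _ => hβ i) hj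
          have h2 : α i₀ * β j ≤ u := by
            nlinarith [hle1 i₀ hi₀, hβ j, le_max_right x y]
          have := Real.rpow_le_rpow (mul_nonneg (hα _) (hβ _)) h2 (by norm_num : (0:ℝ) ≤ 3/4)
          gcongr
      _ ≤ _ := by
          rw [← Finset.sum_mul]
          exact mul_le_mul_of_nonneg_right (hoff _ _) (by positivity)
  have hp3 : ∑ i ∈ I.erase i₀, q ^ ((i - i₀) + (i₀ - i)) * (α i * β i₀) ^ (3/4:ℝ) ≤
      3 * q * t ^ 3 := by
    calc _ ≤ ∑ i ∈ I.erase i₀, (if i = i₀ then 0 else q ^ ((i - i₀) + (i₀ - i))) * t ^ 3 := by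
          refine Finset.sum_le_sum fun j hj => ?_
          rw [if_neg (Finset.ne_of_mem_erase hj), ← ht3]
          have : α j ≤ x := Finset.single_le_sum (fun i _ => hα i) hj
          have h2 : α j * β i₀ ≤ u := by
            nlinarith [hle1' i₀ hi₀, hα j, hβ i₀, le_max_left x y]
          have := Real.rpow_le_rpow (mul_nonneg (hα _) (hβ _)) h2 (by norm_num : (0:ℝ) ≤ 3/4)
          gcongr
      _ ≤ _ := by
          rw [← Finset.sum_mul]
          exact mul_le_mul_of_nonneg_right (hoff' _ _) (by positivity)
  have hp4 : ∑ i ∈ I.erase i₀, ∑ j ∈ I.erase i₀,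
      q ^ ((i - j) + (j - i)) * (α i * β j) ^ (3/4:ℝ) ≤ 2 * t ^ 6 := by
    have h1 := sum_rpow_le_rpow_sum (I := I.erase i₀) hcd hα hβ zero_le_one (hrd _) (hrd' _)
    have h2 := sum_rpow_le_rpow_sum (I := I.erase i₀) hcoff hα hβ (by positivity)
      (fun i _ => hoff _ i) (fun i _ => hoff' _ i)
    rw [hsplit]
    have h3 : (x * y) ^ (3/4:ℝ) ≤ t ^ 6 := by
      have : t ^ 6 = (u * u) ^ (3/4:ℝ) := by
        rw [Real.mul_rpow hu0 hu0, ht3]; ring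
      rw [this]
      refine Real.rpow_le_rpow (mul_nonneg hx0 hy0) ?_ (by norm_num)
      exact mul_le_mul (le_max_left _ _) (le_max_right _ _) hy0 hu0
    have h4 : 0 ≤ (x * y) ^ (3/4:ℝ) := Real.rpow_nonneg (mul_nonneg hx0 hy0) _
    have h5 : 3 * q * (x * y) ^ (3/4:ℝ) ≤ 1 * (x * y) ^ (3/4:ℝ) :=
      mul_le_mul_of_nonneg_right (by linarith) h4
    linarith
  rw [hex] at hgt
  have htpos : 0 < t := by
    rcases ht0.lt_or_eq with h | h
    · exact h
    · rw [← h] at hp1 hp2 hp3 hp4; norm_num at hp1 hp2 hp3 hp4; linarith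
  have ht12 : t ≤ 12 * q :=
    le_twelve_mul_of_lt htpos hq (ht4.le.trans hu12) (by linarith)
  have hfin : u ≤ 20736 * q ^ 4 := by
    rw [← ht4]
    calc t ^ 4 ≤ (12 * q) ^ 4 := pow_le_pow_left₀ ht0 ht12 4
      _ = _ := by ring
  exact absurd ((le_max_right x y).trans hfin) (not_le.2 (hcon i₀ ((le_max_left x y).trans hfin)))

/-- Either the local factor is at most `1`, or both distributions concentrate at one exponent. -/
theorem rpow_dichotomy {I : Finset ℕ} {α β : ℕ → ℝ} {q : ℝ} (hq0 : 0 ≤ q)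
    (hq : q ≤ 1 / 768) (hα : ∀ i, 0 ≤ α i) (hβ : ∀ i, 0 ≤ β i) :
    (∑ i ∈ I, ∑ j ∈ I, q ^ ((i - j) + (j - i)) * (α i * β j) ^ (3/4:ℝ) ≤
        ((∑ i ∈ I, α i) * ∑ j ∈ I, β j) ^ (3/4:ℝ)) ∨
      ∃ i₀, ∑ i ∈ I.erase i₀, α i ≤ 20736 * q ^ 4 * ∑ i ∈ I, α i ∧
        ∑ i ∈ I.erase i₀, β i ≤ 20736 * q ^ 4 * ∑ i ∈ I, β i := by
  set A := ∑ i ∈ I, α i with hA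
  set B := ∑ i ∈ I, β i with hB
  have hA0 : 0 ≤ A := Finset.sum_nonneg fun i _ => hα i
  have hB0 : 0 ≤ B := Finset.sum_nonneg fun i _ => hβ i
  rcases hA0.eq_or_lt with h | hApos
  · left
    have : ∀ i ∈ I, α i = 0 := (Finset.sum_eq_zero_iff_of_nonneg fun i _ => hα i).1 h.symm
    rw [Finset.sum_eq_zero fun i hi => Finset.sum_eq_zero fun j _ => by
      rw [this i hi, zero_mul, Real.zero_rpow (by norm_num), mul_zero]]
    positivity
  rcases hB0.eq_or_lt with h | hBpos
  · left
    have : ∀ i ∈ I, β i = 0 := (Finset.sum_eq_zero_iff_of_nonneg fun i _ => hβ i).1 h.symm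
    rw [Finset.sum_eq_zero fun i _ => Finset.sum_eq_zero fun j hj => by
      rw [this j hj, mul_zero, Real.zero_rpow (by norm_num), mul_zero]]
    positivity
  have key := rpow_dichotomy_of_sum_eq_one (I := I) (α := fun i => α i / A)
    (β := fun i => β i / B) hq0 hq (fun i => div_nonneg (hα i) hA0)
    (fun i => div_nonneg (hβ i) hB0)
    (by rw [← Finset.sum_div, ← hA, div_self hApos.ne'])
    (by rw [← Finset.sum_div, ← hB, div_self hBpos.ne'])
  rcases key with h | ⟨i₀, h1, h2⟩
  · left
    have e : ∑ i ∈ I, ∑ j ∈ I, q ^ ((i - j) + (j - i)) * (α i * β j) ^ (3/4:ℝ) =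
        (∑ i ∈ I, ∑ j ∈ I, q ^ ((i - j) + (j - i)) * (α i / A * (β j / B)) ^ (3/4:ℝ)) *
          (A * B) ^ (3/4:ℝ) := by
      simp_rw [Finset.sum_mul]
      refine Finset.sum_congr rfl fun i _ => Finset.sum_congr rfl fun j _ => ?_
      rw [mul_assoc, ← Real.mul_rpow (mul_nonneg (div_nonneg (hα i) hA0)
        (div_nonneg (hβ j) hB0)) (by positivity)]
      congr 2
      field_simp
    rw [e]
    exact mul_le_of_le_one_left (by positivity) h
  · right
    rw [← Finset.sum_div, div_le_iff₀ hApos] at h1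
    rw [← Finset.sum_div, div_le_iff₀ hBpos] at h2
    exact ⟨i₀, h1, h2⟩

section Bilinear

variable {ι : Type*}

/-- The part of `v / gcd (v, w)` supported on `S`, in terms of exponents. -/
noncomputable def ratioProd (e : ι → ℕ → ℕ) (S : Finset ℕ) (v w : ι) : ℝ :=
  ∏ p ∈ S, (p : ℝ) ^ (e v p - e w p)

/-- The part of `φ(v) / v` supported on `S`, in terms of exponents. -/
noncomputable def totientProd (e : ι → ℕ → ℕ) (S : Finset ℕ) (v : ι) : ℝ :=
  ∏ p ∈ S, if e v p = 0 then 1 else 1 - 1 / (p : ℝ)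

/-- Total mass of the weight `ψ` on `V`, weighted by `totientProd`. -/
noncomputable def totientMass (e : ι → ℕ → ℕ) (S : Finset ℕ) (V : Finset ι) (ψ : ι → ℝ) : ℝ :=
  ∑ v ∈ V, totientProd e S v * ψ v

open Classical in
/-- Mass of the pairs in relation `R` which are close to each other on both sides. -/
noncomputable def edgeSum (e : ι → ℕ → ℕ) (S : Finset ℕ) (R : ι → ι → Prop) (V W : Finset ι)
    (ψ θ : ι → ℝ) : ℝ :=
  ∑ v ∈ V, ∑ w ∈ W, if R v w ∧ ψ v * ratioProd e S w v ≤ 1 ∧ θ w * ratioProd e S v w ≤ 1 then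
    totientProd e S v * ψ v * (totientProd e S w * θ w) else 0

/-- Elements of `V` are determined by their exponents at `S`. -/
def InjExp (e : ι → ℕ → ℕ) (S : Finset ℕ) (V : Finset ι) : Prop :=
  ∀ v ∈ V, ∀ v' ∈ V, (∀ p ∈ S, e v p = e v' p) → v = v'

/-- The bilinear estimate with constant `K`. -/
def BilinearBound (e : ι → ℕ → ℕ) (S : Finset ℕ) (R : ι → ι → Prop) (K : ℝ) : Prop :=
  ∀ (V W : Finset ι) (ψ θ : ι → ℝ), (∀ v, 0 ≤ ψ v) → (∀ w, 0 ≤ θ w) →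
    InjExp e S V → InjExp e S W →
    edgeSum e S R V W ψ θ ≤ K * (totientMass e S V ψ * totientMass e S W θ) ^ (3/4:ℝ)

variable {e : ι → ℕ → ℕ} {S : Finset ℕ} {R : ι → ι → Prop} {V W : Finset ι} {ψ θ : ι → ℝ}

theorem totientProd_nonneg (hS : ∀ p ∈ S, p.Prime) (v : ι) : 0 ≤ totientProd e S v := by
  refine Finset.prod_nonneg fun p hp => ?_
  split_ifs
  · exact zero_le_one
  · have : (1:ℝ) ≤ p := by exact_mod_cast (hS p hp).one_lt.le
    rw [sub_nonneg, div_le_one (by linarith)]; exact this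

theorem totientMass_nonneg (hS : ∀ p ∈ S, p.Prime) (hψ : ∀ v, 0 ≤ ψ v) :
    0 ≤ totientMass e S V ψ :=
  Finset.sum_nonneg fun v _ => mul_nonneg (totientProd_nonneg hS v) (hψ v)

theorem edgeSum_mono (hS : ∀ p ∈ S, p.Prime) (hψ : ∀ v, 0 ≤ ψ v) (hθ : ∀ v, 0 ≤ θ v)
    {R' : ι → ι → Prop} (h : ∀ v ∈ V, ∀ w ∈ W, R v w → R' v w) :
    edgeSum e S R V W ψ θ ≤ edgeSum e S R' V W ψ θ := by
  refine Finset.sum_le_sum fun v hv => Finset.sum_le_sum fun w hw => ?_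
  have h0 : 0 ≤ totientProd e S v * ψ v * (totientProd e S w * θ w) :=
    mul_nonneg (mul_nonneg (totientProd_nonneg hS v) (hψ v))
      (mul_nonneg (totientProd_nonneg hS w) (hθ w))
  split_ifs with h1 h2 h2
  · exact le_rfl
  · exact absurd ⟨h v hv w hw h1.1, h1.2⟩ h2
  · exact h0
  · exact le_rfl

theorem edgeSum_block (hS : ∀ p ∈ S, p.Prime) {p : ℕ} (hp : p ∈ S) {K : ℝ} (hK : 0 ≤ K)
    (hbd : BilinearBound e (S.erase p) R K) (hψ : ∀ v, 0 ≤ ψ v) (hθ : ∀ v, 0 ≤ θ v)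
    (hV : InjExp e S V) (hW : InjExp e S W) {i j : ℕ} (hVi : ∀ v ∈ V, e v p = i)
    (hWj : ∀ w ∈ W, e w p = j) :
    edgeSum e S R V W ψ θ ≤ K * (((p:ℝ) ^ (-(1/4):ℝ)) ^ ((i - j) + (j - i)) *
      (totientMass e S V ψ * totientMass e S W θ) ^ (3/4:ℝ)) := by
  have hpp := hS p hp
  have hp0 : (0:ℝ) < p := by exact_mod_cast hpp.pos
  have hp2 : (2:ℝ) ≤ p := by exact_mod_cast hpp.two_le
  have hS' : ∀ l ∈ S.erase p, l.Prime := fun l hl => hS l (Finset.mem_of_mem_erase hl)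
  set ρ : ℕ → ℝ := fun i => if i = 0 then 1 else 1 - 1 / (p:ℝ) with hρ
  have hρ0 : ∀ i, 0 < ρ i := by
    intro i
    simp only [hρ]
    split_ifs
    · exact one_pos
    · rw [sub_pos, div_lt_one hp0]; linarith
  have hρ1 : ∀ i, ρ i ≤ 1 := by
    intro i
    simp only [hρ]
    split_ifs
    · exact le_rfl
    · have : 0 < 1 / (p:ℝ) := by positivity
      linarith
  have htV : ∀ v ∈ V, totientProd e S v = ρ i * totientProd e (S.erase p) v := by
    intro v hv
    rw [totientProd, ← Finset.mul_prod_erase S _ hp, hVi v hv]; rfl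
  have htW : ∀ v ∈ W, totientProd e S v = ρ j * totientProd e (S.erase p) v := by
    intro v hv
    rw [totientProd, ← Finset.mul_prod_erase S _ hp, hWj v hv]; rfl
  have hVinj : InjExp e (S.erase p) V := by
    intro v hv v' hv' h
    refine hV v hv v' hv' fun l hl => ?_
    by_cases hlp : l = p
    · rw [hlp, hVi v hv, hVi v' hv']
    · exact h l (Finset.mem_erase.2 ⟨hlp, hl⟩)
  have hWinj : InjExp e (S.erase p) W := by
    intro v hv v' hv' h
    refine hW v hv v' hv' fun l hl => ?_
    by_cases hlp : l = p
    · rw [hlp, hWj v hv, hWj v' hv']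
    · exact h l (Finset.mem_erase.2 ⟨hlp, hl⟩)
  set a : ℝ := (p:ℝ) ^ (j - i) with ha
  set b : ℝ := (p:ℝ) ^ (i - j) with hb
  have ha0 : 0 < a := by positivity
  have hb0 : 0 < b := by positivity
  have key := hbd V W (fun v => a * ψ v) (fun w => b * θ w)
    (fun v => mul_nonneg ha0.le (hψ v)) (fun v => mul_nonneg hb0.le (hθ v)) hVinj hWinj
  have hmV : totientMass e S V ψ =
      ρ i * a⁻¹ * totientMass e (S.erase p) V (fun v => a * ψ v) := by
    rw [totientMass, totientMass, Finset.mul_sum]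
    refine Finset.sum_congr rfl fun v hv => ?_
    rw [htV v hv]; field_simp
  have hmW : totientMass e S W θ =
      ρ j * b⁻¹ * totientMass e (S.erase p) W (fun v => b * θ v) := by
    rw [totientMass, totientMass, Finset.mul_sum]
    refine Finset.sum_congr rfl fun v hv => ?_
    rw [htW v hv]; field_simp
  have hE : edgeSum e S R V W ψ θ = ρ i * a⁻¹ * (ρ j * b⁻¹) *
      edgeSum e (S.erase p) R V W (fun v => a * ψ v) (fun w => b * θ w) := by
    rw [edgeSum, edgeSum, Finset.mul_sum]
    refine Finset.sum_congr rfl fun v hv => ?_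
    rw [Finset.mul_sum]
    refine Finset.sum_congr rfl fun w hw => ?_
    have r1 : ψ v * ratioProd e S w v = a * ψ v * ratioProd e (S.erase p) w v := by
      rw [ratioProd, ← Finset.mul_prod_erase S _ hp, hVi v hv, hWj w hw, ratioProd]; ring
    have r2 : θ w * ratioProd e S v w = b * θ w * ratioProd e (S.erase p) v w := by
      rw [ratioProd, ← Finset.mul_prod_erase S _ hp, hVi v hv, hWj w hw, ratioProd]; ring
    rw [r1, r2, mul_ite, mul_zero, htV v hv, htW w hw]
    congr 1
    field_simp
  set X := totientMass e (S.erase p) V (fun v => a * ψ v) *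
    totientMass e (S.erase p) W (fun w => b * θ w) with hX
  have hX0 : 0 ≤ X := mul_nonneg (totientMass_nonneg hS' fun v => mul_nonneg ha0.le (hψ v))
    (totientMass_nonneg hS' fun v => mul_nonneg hb0.le (hθ v))
  set c := ρ i * a⁻¹ * (ρ j * b⁻¹) with hc
  have hc0 : 0 < c := by have := hρ0 i; have := hρ0 j; positivity
  have hmm : totientMass e S V ψ * totientMass e S W θ = c * X := by
    rw [hmV, hmW, hc, hX]; ring
  rw [hE, hmm, Real.mul_rpow hc0.le hX0]
  have hcq : c ≤ ((p:ℝ) ^ (-(1/4):ℝ)) ^ ((i - j) + (j - i)) * c ^ (3/4:ℝ) := by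
    have h1 : c = c ^ (1/4:ℝ) * c ^ (3/4:ℝ) := by
      rw [← Real.rpow_add hc0]; norm_num
    have h2 : c ≤ ((p:ℝ) ^ ((i - j) + (j - i)))⁻¹ := by
      rw [hc, pow_add, mul_inv, ← ha, ← hb]
      calc ρ i * a⁻¹ * (ρ j * b⁻¹) = ρ i * ρ j * (b⁻¹ * a⁻¹) := by ring
        _ ≤ 1 * (b⁻¹ * a⁻¹) := by
          refine mul_le_mul_of_nonneg_right ?_ (by positivity)
          exact mul_le_one₀ (hρ1 i) (hρ0 j).le (hρ1 j)
        _ = _ := one_mul _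
    have h3 : c ^ (1/4:ℝ) ≤ ((p:ℝ) ^ (-(1/4):ℝ)) ^ ((i - j) + (j - i)) := by
      refine (Real.rpow_le_rpow hc0.le h2 (by norm_num)).trans (le_of_eq ?_)
      rw [← Real.rpow_natCast, ← Real.rpow_natCast, ← Real.rpow_neg hp0.le,
        ← Real.rpow_mul hp0.le, ← Real.rpow_mul hp0.le]
      congr 1; ring
    calc c = c ^ (1/4:ℝ) * c ^ (3/4:ℝ) := h1
      _ ≤ _ := mul_le_mul_of_nonneg_right h3 (Real.rpow_nonneg hc0.le _)
  have hXr : 0 ≤ X ^ (3/4:ℝ) := Real.rpow_nonneg hX0 _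
  calc _ ≤ c * (K * X ^ (3/4:ℝ)) := mul_le_mul_of_nonneg_left key hc0.le
    _ ≤ (((p:ℝ) ^ (-(1/4):ℝ)) ^ ((i - j) + (j - i)) * c ^ (3/4:ℝ)) * (K * X ^ (3/4:ℝ)) :=
      mul_le_mul_of_nonneg_right hcq (by positivity)
    _ = _ := by ring

theorem InjExp.subset {V' : Finset ι} (hV : InjExp e S V) (h : V' ⊆ V) : InjExp e S V' :=
  fun v hv v' hv' => hV v (h hv) v' (h hv')

theorem sum_totientMass_fiber {I : Finset ℕ} {p : ℕ} (hVI : ∀ v ∈ V, e v p ∈ I) :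
    ∑ i ∈ I, totientMass e S (V.filter fun v => e v p = i) ψ = totientMass e S V ψ :=
  Finset.sum_fiberwise_of_maps_to hVI _

open Classical in
/-- Peeling off a prime: the bilinear form is controlled by a form in the exponents at `p`. -/
theorem edgeSum_le_peel (hS : ∀ p ∈ S, p.Prime) {p : ℕ} (hp : p ∈ S) {K : ℝ} (hK : 0 ≤ K)
    (hbd : BilinearBound e (S.erase p) R K) (hψ : ∀ v, 0 ≤ ψ v) (hθ : ∀ v, 0 ≤ θ v)
    (hV : InjExp e S V) (hW : InjExp e S W) {I : Finset ℕ} (hVI : ∀ v ∈ V, e v p ∈ I)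
    (hWI : ∀ w ∈ W, e w p ∈ I) (J : ℕ → ℕ → Prop) :
    edgeSum e S (fun v w => R v w ∧ J (e v p) (e w p)) V W ψ θ ≤
      K * ∑ i ∈ I, ∑ j ∈ I,
        (if J i j then ((p:ℝ) ^ (-(1/4):ℝ)) ^ ((i - j) + (j - i)) else 0) *
        (totientMass e S (V.filter fun v => e v p = i) ψ *
          totientMass e S (W.filter fun w => e w p = j) θ) ^ (3/4:ℝ) := by
  have hdec : edgeSum e S (fun v w => R v w ∧ J (e v p) (e w p)) V W ψ θ =
      ∑ i ∈ I, ∑ j ∈ I, edgeSum e S (fun v w => R v w ∧ J (e v p) (e w p))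
        (V.filter fun v => e v p = i) (W.filter fun w => e w p = j) ψ θ := by
    simp only [edgeSum]
    rw [← Finset.sum_fiberwise_of_maps_to hVI]
    refine Finset.sum_congr rfl fun i _ => ?_
    rw [Finset.sum_comm (s := I)]
    refine Finset.sum_congr rfl fun v _ => ?_
    rw [← Finset.sum_fiberwise_of_maps_to hWI]
  rw [hdec, Finset.mul_sum]
  refine Finset.sum_le_sum fun i _ => ?_
  rw [Finset.mul_sum]
  refine Finset.sum_le_sum fun j _ => ?_
  by_cases h : J i j
  · rw [if_pos h]
    refine (edgeSum_mono hS hψ hθ (R' := R) fun v _ w _ h => h.1).trans ?_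
    exact edgeSum_block hS hp hK hbd hψ hθ (hV.subset (Finset.filter_subset _ _))
      (hW.subset (Finset.filter_subset _ _)) (fun v hv => (Finset.mem_filter.1 hv).2)
      (fun v hv => (Finset.mem_filter.1 hv).2)
  · rw [if_neg h, zero_mul, mul_zero]
    refine le_of_eq (Finset.sum_eq_zero fun v hv => Finset.sum_eq_zero fun w hw => ?_)
    rw [if_neg]
    rintro ⟨⟨_, h'⟩, _⟩
    rw [(Finset.mem_filter.1 hv).2, (Finset.mem_filter.1 hw).2] at h'
    exact h h'

end Bilinear

section Bilinear

variable {ι : Type*}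
variable {e : ι → ℕ → ℕ} {S : Finset ℕ} {R : ι → ι → Prop} {V W : Finset ι} {ψ θ : ι → ℝ}

theorem factorization_prod_pow_of_prime (hS : ∀ p ∈ S, p.Prime) (f : ℕ → ℕ) {p : ℕ} (hp : p ∈ S) :
    (∏ l ∈ S, l ^ f l).factorization p = f p := by
  rw [Nat.factorization_prod fun l hl => pow_ne_zero _ (hS l hl).ne_zero, Finsupp.finsetSum_apply,
    Finset.sum_eq_single p]
  · simp [(hS p hp).factorization]
  · intro l hl hlp
    simp [(hS l hl).factorization, hlp]
  · exact fun h => absurd hp h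

theorem totientProd_le_totient_div (hS : ∀ p ∈ S, p.Prime) (n : ℕ → ℕ) (w : ι) :
    totientProd e S w ≤ ((∏ p ∈ S, p ^ min (e w p) (n p)).totient : ℝ) /
      (∏ p ∈ S, p ^ min (e w p) (n p) : ℕ) := by
  set d := ∏ p ∈ S, p ^ min (e w p) (n p) with hd
  have hd0 : d ≠ 0 := Finset.prod_ne_zero_iff.2 fun p hp => pow_ne_zero _ (hS p hp).ne_zero
  have hd0' : (d:ℝ) ≠ 0 := by exact_mod_cast hd0
  have h := Nat.totient_eq_mul_prod_factors d
  have h' : (d.totient : ℝ) = d * ∏ p ∈ d.primeFactors, (1 - (p:ℝ)⁻¹) := by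
    have := congrArg (fun q : ℚ => (q:ℝ)) h
    push_cast at this
    exact this
  rw [h', mul_div_cancel_left₀ _ hd0']
  have hsub : d.primeFactors ⊆ S := by
    intro p hp
    have hpp := Nat.prime_of_mem_primeFactors hp
    obtain ⟨l, hl, hdvd⟩ := (hpp.prime.dvd_finsetProd_iff _).1 (Nat.dvd_of_mem_primeFactors hp)
    have := (Nat.prime_dvd_prime_iff_eq hpp (hS l hl)).1 (hpp.dvd_of_dvd_pow hdvd)
    exact this ▸ hl
  have h2 : ∏ p ∈ d.primeFactors, (1 - (p:ℝ)⁻¹) =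
      ∏ p ∈ S, if p ∈ d.primeFactors then (1 - (p:ℝ)⁻¹) else 1 := by
    rw [Finset.prod_ite_mem, Finset.inter_eq_right.2 hsub]
  rw [h2, totientProd]
  have hp1 : ∀ p ∈ S, (0:ℝ) ≤ 1 - (p:ℝ)⁻¹ ∧ 1 - (p:ℝ)⁻¹ ≤ 1 := by
    intro p hp
    have h1 : (1:ℝ) ≤ p := by exact_mod_cast (hS p hp).one_lt.le
    have h2 := inv_le_one_of_one_le₀ h1
    have h3 : (0:ℝ) ≤ (p:ℝ)⁻¹ := by positivity
    constructor <;> linarith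
  refine Finset.prod_le_prod (fun p hp => ?_) fun p hp => ?_
  · rw [one_div]; split_ifs <;> [exact zero_le_one; exact (hp1 p hp).1]
  · rw [one_div]
    split_ifs with h3 h4 h4
    · exfalso
      have := factorization_prod_pow_of_prime hS (fun p => min (e w p) (n p)) hp
      rw [← hd] at this
      have h5 := (hS p hp).factorization_pos_of_dvd hd0 (Nat.dvd_of_mem_primeFactors h4)
      simp only [h3] at this
      omega
    · exact le_rfl
    · exact le_rfl
    · exact (hp1 p hp).2

theorem sum_totientProd_div_le_one (hS : ∀ p ∈ S, p.Prime) (hW : InjExp e S W) (n : ℕ → ℕ)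
    (hconst : ∀ w ∈ W, ∀ w' ∈ W, ∀ p ∈ S, e w p - n p = e w' p - n p) :
    ∑ w ∈ W, totientProd e S w / ∏ p ∈ S, (p:ℝ) ^ (n p - e w p) ≤ 1 := by
  set N := ∏ p ∈ S, p ^ n p with hN
  have hN0 : 0 < N := Finset.prod_pos fun p hp => pow_pos (hS p hp).pos _
  have hN0' : (0:ℝ) < N := by exact_mod_cast hN0
  set d : ι → ℕ := fun w => ∏ p ∈ S, p ^ min (e w p) (n p) with hd
  have hd0 : ∀ w, (0:ℝ) < d w := fun w => by
    exact_mod_cast Finset.prod_pos fun p hp => pow_pos (hS p hp).pos _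
  have hdinj : Set.InjOn d W := by
    intro w hw w' hw' h
    refine hW w hw w' hw' fun p hp => ?_
    have h1 := factorization_prod_pow_of_prime hS (fun p => min (e w p) (n p)) hp
    have h2 := factorization_prod_pow_of_prime hS (fun p => min (e w' p) (n p)) hp
    have h3 := hconst w hw w' hw' p hp
    have h4 : min (e w p) (n p) = min (e w' p) (n p) := by
      rw [← h1, ← h2]
      exact congrArg (fun m : ℕ => m.factorization p) h
    omega
  have hterm : ∀ w ∈ W, totientProd e S w / ∏ p ∈ S, (p:ℝ) ^ (n p - e w p) ≤
      ((d w).totient : ℝ) / N := by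
    intro w _
    have hb : (∏ p ∈ S, (p:ℝ) ^ (n p - e w p)) * d w = N := by
      rw [hd, hN]
      push_cast
      rw [← Finset.prod_mul_distrib]
      refine Finset.prod_congr rfl fun p _ => ?_
      rw [← pow_add]
      congr 1
      omega
    have hb0 : (0:ℝ) < ∏ p ∈ S, (p:ℝ) ^ (n p - e w p) :=
      Finset.prod_pos fun p hp => pow_pos (by exact_mod_cast (hS p hp).pos) _
    calc _ ≤ ((d w).totient / d w : ℝ) / ∏ p ∈ S, (p:ℝ) ^ (n p - e w p) :=
          div_le_div_of_nonneg_right (totientProd_le_totient_div hS n w) hb0.le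
      _ = _ := by rw [div_div, mul_comm, hb]
  refine (Finset.sum_le_sum hterm).trans ?_
  rw [← Finset.sum_div, div_le_one hN0', ← Finset.sum_image (f := fun m => ((m.totient : ℕ) : ℝ)) hdinj]
  have hsub : W.image d ⊆ N.divisors := by
    intro m hm
    obtain ⟨w, _, rfl⟩ := Finset.mem_image.1 hm
    exact Nat.mem_divisors.2 ⟨Finset.prod_dvd_prod_of_dvd _ _ fun p _ =>
      pow_dvd_pow _ (min_le_right _ _), hN0.ne'⟩
  calc _ ≤ ∑ m ∈ N.divisors, ((m.totient : ℕ) : ℝ) :=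
        Finset.sum_le_sum_of_subset_of_nonneg hsub fun _ _ _ => Nat.cast_nonneg _
    _ = N := by exact_mod_cast Nat.sum_totient N

theorem sum_filter_totientProd_div_le (hS : ∀ p ∈ S, p.Prime) (hW : InjExp e S W) (n : ℕ → ℕ)
    {Y : ℝ} (hY : 0 ≤ Y) :
    ∑ w ∈ W with ∏ p ∈ S, (p:ℝ) ^ (e w p - n p) ≤ Y,
      totientProd e S w / ∏ p ∈ S, (p:ℝ) ^ (n p - e w p) ≤ Y := by
  set aN : ι → ℕ := fun w => ∏ p ∈ S, p ^ (e w p - n p) with haN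
  have hmap : ∀ w ∈ W.filter (fun w => ∏ p ∈ S, (p:ℝ) ^ (e w p - n p) ≤ Y),
      aN w ∈ Finset.Icc 1 ⌊Y⌋₊ := by
    intro w hw
    rw [Finset.mem_Icc]
    refine ⟨Nat.one_le_iff_ne_zero.2 (Finset.prod_ne_zero_iff.2 fun p hp =>
      pow_ne_zero _ (hS p hp).ne_zero), Nat.le_floor ?_⟩
    have := (Finset.mem_filter.1 hw).2
    simpa [haN] using this
  rw [← Finset.sum_fiberwise_of_maps_to hmap]
  calc _ ≤ ∑ a ∈ Finset.Icc 1 ⌊Y⌋₊, (1:ℝ) := by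
        refine Finset.sum_le_sum fun a _ => ?_
        refine sum_totientProd_div_le_one hS (hW.subset fun w hw => ?_) n ?_
        · exact (Finset.mem_filter.1 (Finset.mem_filter.1 hw).1).1
        · intro w hw w' hw' p hp
          have h1 := (Finset.mem_filter.1 hw).2.trans (Finset.mem_filter.1 hw').2.symm
          rw [← factorization_prod_pow_of_prime hS (fun p => e w p - n p) hp,
            ← factorization_prod_pow_of_prime hS (fun p => e w' p - n p) hp]
          exact congrArg (fun m : ℕ => m.factorization p) h1
    _ = (⌊Y⌋₊ : ℝ) := by simp
    _ ≤ Y := Nat.floor_le hY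

theorem ratioProd_eq_of_good {n : ℕ → ℕ} {v w : ι} (h : ∀ p ∈ S, e v p = n p ∨ e w p = n p) :
    ratioProd e S w v =
      (∏ p ∈ S, (p:ℝ) ^ (e w p - n p)) * ∏ p ∈ S, (p:ℝ) ^ (n p - e v p) := by
  rw [ratioProd, ← Finset.prod_mul_distrib]
  refine Finset.prod_congr rfl fun p hp => ?_
  rw [← pow_add]
  congr 1
  rcases h p hp with h | h <;> omega

theorem edgeSum_le_mul (hS : ∀ p ∈ S, p.Prime) (hψ : ∀ v, 0 ≤ ψ v) (hθ : ∀ v, 0 ≤ θ v) :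
    edgeSum e S R V W ψ θ ≤ totientMass e S V ψ * totientMass e S W θ := by
  rw [totientMass, totientMass, Finset.sum_mul_sum]
  refine Finset.sum_le_sum fun v _ => Finset.sum_le_sum fun w _ => ?_
  split_ifs
  · exact le_rfl
  · exact mul_nonneg (mul_nonneg (totientProd_nonneg hS v) (hψ v))
      (mul_nonneg (totientProd_nonneg hS w) (hθ w))

/-- One half of the Cauchy–Schwarz estimate for pairs close to a common exponent vector. -/
theorem sum_weighted_good_le (hS : ∀ p ∈ S, p.Prime) (hψ : ∀ v, 0 ≤ ψ v)
    (hW : InjExp e S W) (n : ℕ → ℕ) :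
    ∑ v ∈ V, ∑ w ∈ W with ψ v * ((∏ p ∈ S, (p:ℝ) ^ (e w p - n p)) *
        ∏ p ∈ S, (p:ℝ) ^ (n p - e v p)) ≤ 1,
      totientProd e S v * ψ v ^ 2 * (∏ p ∈ S, (p:ℝ) ^ (n p - e v p)) *
        (totientProd e S w / ∏ p ∈ S, (p:ℝ) ^ (n p - e w p)) ≤ totientMass e S V ψ := by
  refine Finset.sum_le_sum fun v _ => ?_
  rw [← Finset.mul_sum]
  set b := ∏ p ∈ S, (p:ℝ) ^ (n p - e v p) with hb
  have hb0 : 0 < b := Finset.prod_pos fun p hp => pow_pos (by exact_mod_cast (hS p hp).pos) _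
  rcases (hψ v).eq_or_lt with h0 | h0
  · simp [← h0]
  have h1 := sum_filter_totientProd_div_le hS hW n (Y := 1 / (ψ v * b)) (by positivity)
  have h2 : W.filter (fun w => ψ v * ((∏ p ∈ S, (p:ℝ) ^ (e w p - n p)) * b) ≤ 1) =
      W.filter (fun w => ∏ p ∈ S, (p:ℝ) ^ (e w p - n p) ≤ 1 / (ψ v * b)) := by
    refine Finset.filter_congr fun w _ => ?_
    rw [le_div_iff₀ (by positivity)]
    constructor <;> intro h <;> linarith
  rw [h2]
  calc _ ≤ totientProd e S v * ψ v ^ 2 * b * (1 / (ψ v * b)) :=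
        mul_le_mul_of_nonneg_left h1 (by have := totientProd_nonneg (e := e) hS v; positivity)
    _ = _ := by field_simp

/-- Pairs which at every prime of `S` share a prescribed exponent on one of the two sides. -/
theorem edgeSum_good_le_sqrt (hS : ∀ p ∈ S, p.Prime) (hψ : ∀ v, 0 ≤ ψ v) (hθ : ∀ v, 0 ≤ θ v)
    (hV : InjExp e S V) (hW : InjExp e S W) (n : ℕ → ℕ) :
    edgeSum e S (fun v w => ∀ p ∈ S, e v p = n p ∨ e w p = n p) V W ψ θ ≤
      Real.sqrt (totientMass e S V ψ * totientMass e S W θ) := by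
  classical
  set a : ι → ℝ := fun v => ∏ p ∈ S, (p:ℝ) ^ (e v p - n p) with ha
  set b : ι → ℝ := fun v => ∏ p ∈ S, (p:ℝ) ^ (n p - e v p) with hb
  have hb0 : ∀ v, 0 < b v := fun v =>
    Finset.prod_pos fun p hp => pow_pos (by exact_mod_cast (hS p hp).pos) _
  set G := (V ×ˢ W).filter (fun x => ψ x.1 * (a x.2 * b x.1) ≤ 1 ∧ θ x.2 * (a x.1 * b x.2) ≤ 1)
    with hG
  have ht0 : ∀ v, 0 ≤ totientProd e S v := totientProd_nonneg hS
  have h1 : edgeSum e S (fun v w => ∀ p ∈ S, e v p = n p ∨ e w p = n p) V W ψ θ ≤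
      ∑ x ∈ G, totientProd e S x.1 * ψ x.1 * (totientProd e S x.2 * θ x.2) := by
    rw [hG, Finset.sum_filter, Finset.sum_product, edgeSum]
    refine Finset.sum_le_sum fun v _ => Finset.sum_le_sum fun w _ => ?_
    have hnn : 0 ≤ totientProd e S v * ψ v * (totientProd e S w * θ w) :=
      mul_nonneg (mul_nonneg (ht0 v) (hψ v)) (mul_nonneg (ht0 w) (hθ w))
    split_ifs with h h' h'
    · exact le_rfl
    · exfalso
      apply h'
      obtain ⟨hg, hl, hr⟩ := h
      rw [ratioProd_eq_of_good hg] at hl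
      rw [ratioProd_eq_of_good fun p hp => (hg p hp).symm] at hr
      exact ⟨hl, hr⟩
    · exact hnn
    · exact le_rfl
  set f : ι × ι → ℝ := fun x => totientProd e S x.1 * ψ x.1 ^ 2 * b x.1 *
    (totientProd e S x.2 / b x.2) with hf
  set g : ι × ι → ℝ := fun x => totientProd e S x.2 * θ x.2 ^ 2 * b x.2 *
    (totientProd e S x.1 / b x.1) with hg
  have hf0 : ∀ x, 0 ≤ f x := fun x => by
    have := ht0 x.1; have := ht0 x.2; have := hb0 x.1; have := hb0 x.2; positivity
  have hg0 : ∀ x, 0 ≤ g x := fun x => by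
    have := ht0 x.1; have := ht0 x.2; have := hb0 x.1; have := hb0 x.2; positivity
  have hfg : ∀ x, totientProd e S x.1 * ψ x.1 * (totientProd e S x.2 * θ x.2) =
      Real.sqrt (f x) * Real.sqrt (g x) := by
    intro x
    rw [← Real.sqrt_mul (hf0 x)]
    have : f x * g x = (totientProd e S x.1 * ψ x.1 * (totientProd e S x.2 * θ x.2)) ^ 2 := by
      have := hb0 x.1; have := hb0 x.2
      simp only [hf, hg]
      field_simp
    rw [this, Real.sqrt_sq]
    exact mul_nonneg (mul_nonneg (ht0 _) (hψ _)) (mul_nonneg (ht0 _) (hθ _))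
  have hsf : ∑ x ∈ G, f x ≤ totientMass e S V ψ := by
    refine le_trans ?_ (sum_weighted_good_le (V := V) hS hψ hW n)
    simp_rw [Finset.sum_filter]
    rw [hG, Finset.sum_filter, Finset.sum_product]
    refine Finset.sum_le_sum fun v _ => Finset.sum_le_sum fun w _ => ?_
    have := hf0 (v, w)
    split_ifs with h h' h'
    · exact le_rfl
    · exact absurd h.1 h'
    · exact this
    · exact le_rfl
  have hsg : ∑ x ∈ G, g x ≤ totientMass e S W θ := by
    refine le_trans ?_ (sum_weighted_good_le (V := W) hS hθ hV n)
    simp_rw [Finset.sum_filter]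
    rw [hG, Finset.sum_filter, Finset.sum_product_right]
    refine Finset.sum_le_sum fun v _ => Finset.sum_le_sum fun w _ => ?_
    have := hg0 (w, v)
    split_ifs with h h' h'
    · exact le_rfl
    · exact absurd h.2 h'
    · exact this
    · exact le_rfl
  refine h1.trans ?_
  simp_rw [hfg]
  refine (Real.sum_sqrt_mul_sqrt_le G hf0 hg0).trans ?_
  rw [← Real.sqrt_mul (Finset.sum_nonneg fun x _ => hf0 x)]
  exact Real.sqrt_le_sqrt (mul_le_mul hsf hsg (Finset.sum_nonneg fun x _ => hg0 x)
    (totientMass_nonneg hS hψ))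

theorem edgeSum_good_le (hS : ∀ p ∈ S, p.Prime) (hψ : ∀ v, 0 ≤ ψ v) (hθ : ∀ v, 0 ≤ θ v)
    (hV : InjExp e S V) (hW : InjExp e S W) (n : ℕ → ℕ) :
    edgeSum e S (fun v w => ∀ p ∈ S, e v p = n p ∨ e w p = n p) V W ψ θ ≤
      (totientMass e S V ψ * totientMass e S W θ) ^ (3/4:ℝ) := by
  set X := totientMass e S V ψ * totientMass e S W θ with hX
  have hX0 : 0 ≤ X := mul_nonneg (totientMass_nonneg hS hψ) (totientMass_nonneg hS hθ)
  rcases le_total X 1 with h | h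
  · refine (edgeSum_le_mul hS hψ hθ).trans ?_
    exact Real.self_le_rpow_of_le_one hX0 h (by norm_num)
  · refine (edgeSum_good_le_sqrt hS hψ hθ hV hW n).trans ?_
    rw [Real.sqrt_eq_rpow]
    exact Real.rpow_le_rpow_of_exponent_le h (by norm_num)

end Bilinear

section Bilinear

theorem rpow_neg_quarter_pow_four {p : ℕ} :
    ((p:ℝ) ^ (-(1/4):ℝ)) ^ 4 = 1 / p := by
  rw [← Real.rpow_natCast, ← Real.rpow_mul (Nat.cast_nonneg p)]
  norm_num
  rw [Real.rpow_neg_one]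

theorem rpow_neg_quarter_le {p : ℕ} (hp : p.Prime) : (p:ℝ) ^ (-(1/4):ℝ) ≤ 11 / 13 := by
  refine le_of_pow_le_pow_left₀ (n := 4) (by norm_num) (by norm_num) ?_
  rw [rpow_neg_quarter_pow_four]
  have : (2:ℝ) ≤ p := by exact_mod_cast hp.two_le
  rw [div_le_iff₀ (by linarith)]
  norm_num
  linarith

theorem sum_pow_dist_prime_le {p : ℕ} (hp : p.Prime) (I : Finset ℕ) (i : ℕ) :
    ∑ j ∈ I, (if i = j then 0 else ((p:ℝ) ^ (-(1/4):ℝ)) ^ ((i - j) + (j - i))) ≤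
      13 * (p:ℝ) ^ (-(1/4):ℝ) := by
  have h := rpow_neg_quarter_le hp
  have h0 : 0 ≤ (p:ℝ) ^ (-(1/4):ℝ) := Real.rpow_nonneg (Nat.cast_nonneg p) _
  refine (sum_pow_dist_le h0 (by linarith) I i).trans ?_
  rw [div_le_iff₀ (by linarith)]
  nlinarith

theorem sum_ite_eq_comm_pow {q : ℝ} (I : Finset ℕ) (j : ℕ) :
    ∑ i ∈ I, (if i = j then 0 else q ^ ((i - j) + (j - i))) =
    ∑ i ∈ I, (if j = i then 0 else q ^ ((j - i) + (i - j))) :=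
  Finset.sum_congr rfl fun i _ => by simp only [eq_comm, add_comm]

theorem sum_pow_dist_all_le {q : ℝ} (I : Finset ℕ) (i : ℕ) :
    ∑ j ∈ I, q ^ ((i - j) + (j - i)) ≤
      1 + ∑ j ∈ I, (if i = j then 0 else q ^ ((i - j) + (j - i))) := by
  have : ∀ j ∈ I, q ^ ((i - j) + (j - i)) = (if i = j then 1 else 0) +
      (if i = j then 0 else q ^ ((i - j) + (j - i))) := by
    intro j _; by_cases h : i = j <;> simp [h]
  rw [Finset.sum_congr rfl this, Finset.sum_add_distrib]
  gcongr
  rw [Finset.sum_ite_eq]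
  split_ifs <;> norm_num

theorem exists_prime_threshold : ∃ P : ℕ, 768 ^ 4 ≤ P ∧ ∀ S : Finset ℕ, (∀ p ∈ S, P ≤ p) →
    ∑ p ∈ S, 2 * (20736 / (p:ℝ)) ^ (3/2:ℝ) ≤ 1 / 2 := by
  have hs : Summable fun p : ℕ => 2 * (20736 / (p:ℝ)) ^ (3/2:ℝ) := by
    have h1 : Summable fun p : ℕ => 1 / (p:ℝ) ^ (3/2:ℝ) :=
      Real.summable_one_div_nat_rpow.2 (by norm_num)
    refine (h1.mul_left (2 * 20736 ^ (3/2:ℝ))).congr fun p => ?_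
    rw [Real.div_rpow (by norm_num) (Nat.cast_nonneg p)]
    ring
  obtain ⟨s, hs⟩ := summable_iff_vanishing_norm.1 hs (1/2) (by norm_num)
  refine ⟨max (768 ^ 4) (s.sup id + 1), le_max_left _ _, fun S hS => ?_⟩
  have := hs S (Finset.disjoint_left.2 fun p hp hps => by
    have h1 := hS p hp
    have h2 : p ≤ s.sup id := Finset.le_sup (f := id) hps
    have h3 := le_max_right (768 ^ 4) (s.sup id + 1)
    omega)
  exact (le_abs_self _).trans this.le

variable {ι : Type*}
variable {e : ι → ℕ → ℕ} {S : Finset ℕ} {R : ι → ι → Prop} {V W : Finset ι} {ψ θ : ι → ℝ}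

theorem edgeSum_le_sum_add (hS : ∀ p ∈ S, p.Prime) (hψ : ∀ v, 0 ≤ ψ v) (hθ : ∀ v, 0 ≤ θ v)
    {R₀ : ι → ι → Prop} {R' : ℕ → ι → ι → Prop} {T : Finset ℕ}
    (h : ∀ v w, R v w → R₀ v w ∨ ∃ p ∈ T, R' p v w) :
    edgeSum e S R V W ψ θ ≤
      ∑ p ∈ T, edgeSum e S (R' p) V W ψ θ + edgeSum e S R₀ V W ψ θ := by
  classical
  simp only [edgeSum]
  rw [Finset.sum_comm (s := T), ← Finset.sum_add_distrib]
  refine Finset.sum_le_sum fun v _ => ?_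
  rw [Finset.sum_comm (s := T), ← Finset.sum_add_distrib]
  refine Finset.sum_le_sum fun w _ => ?_
  have h0 : 0 ≤ totientProd e S v * ψ v * (totientProd e S w * θ w) :=
    mul_nonneg (mul_nonneg (totientProd_nonneg hS v) (hψ v))
      (mul_nonneg (totientProd_nonneg hS w) (hθ w))
  have hnn : ∀ p ∈ T, 0 ≤ (if R' p v w ∧ ψ v * ratioProd e S w v ≤ 1 ∧
      θ w * ratioProd e S v w ≤ 1 then
      totientProd e S v * ψ v * (totientProd e S w * θ w) else 0) := by
    intro p _; split_ifs; exacts [h0, le_rfl]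
  by_cases hR : R v w ∧ ψ v * ratioProd e S w v ≤ 1 ∧ θ w * ratioProd e S v w ≤ 1
  · rw [if_pos hR]
    rcases h v w hR.1 with hg | ⟨p, hp, hne⟩
    · rw [if_pos ⟨hg, hR.2⟩]
      exact le_add_of_nonneg_left (Finset.sum_nonneg hnn)
    · refine le_add_of_le_of_nonneg ?_ (by split_ifs; exacts [h0, le_rfl])
      refine le_trans ?_ (Finset.single_le_sum hnn hp)
      rw [if_pos ⟨hne, hR.2⟩]
  · rw [if_neg hR]
    refine add_nonneg (Finset.sum_nonneg hnn) ?_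
    split_ifs; exacts [h0, le_rfl]

/-- Peeling off a prime where both sides avoid the exponent `i₀` of most of the mass. -/
theorem edgeSum_ne_le (hS : ∀ p ∈ S, p.Prime) {p : ℕ} (hp : p ∈ S) (hp768 : 768 ^ 4 ≤ p)
    {K : ℝ} (hK : 0 ≤ K) (hbd : BilinearBound e (S.erase p) (fun _ _ => True) K)
    (hψ : ∀ v, 0 ≤ ψ v) (hθ : ∀ v, 0 ≤ θ v)
    (hV : InjExp e S V) (hW : InjExp e S W) {I : Finset ℕ} (hVI : ∀ v ∈ V, e v p ∈ I)
    (hWI : ∀ w ∈ W, e w p ∈ I) {i₀ : ℕ}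
    (h1 : ∑ i ∈ I.erase i₀, totientMass e S (V.filter fun v => e v p = i) ψ ≤
      20736 / p * totientMass e S V ψ)
    (h2 : ∑ i ∈ I.erase i₀, totientMass e S (W.filter fun v => e v p = i) θ ≤
      20736 / p * totientMass e S W θ) :
    edgeSum e S (fun v w => e v p ≠ i₀ ∧ e w p ≠ i₀) V W ψ θ ≤
      K * (2 * (20736 / (p:ℝ)) ^ (3/2:ℝ) *
        (totientMass e S V ψ * totientMass e S W θ) ^ (3/4:ℝ)) := by
  classical
  have hpp := hS p hp
  set q := (p:ℝ) ^ (-(1/4):ℝ) with hq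
  have hq0 : 0 ≤ q := Real.rpow_nonneg (Nat.cast_nonneg p) _
  have hq768 : q ≤ 1 / 768 := by
    refine le_of_pow_le_pow_left₀ (n := 4) (by norm_num) (by norm_num) ?_
    rw [rpow_neg_quarter_pow_four]
    have : ((768 ^ 4 : ℕ) : ℝ) ≤ p := by exact_mod_cast hp768
    rw [div_pow, one_pow]
    exact one_div_le_one_div_of_le (by norm_num) (by exact_mod_cast hp768)
  refine (edgeSum_mono hS hψ hθ (R' := fun v w => True ∧ (e v p ≠ i₀ ∧ e w p ≠ i₀))
    fun v _ w _ h => ⟨trivial, h⟩).trans ?_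
  refine (edgeSum_le_peel hS hp hK hbd hψ hθ hV hW hVI hWI
    (fun i j => i ≠ i₀ ∧ j ≠ i₀)).trans ?_
  refine mul_le_mul_of_nonneg_left ?_ hK
  set α := fun i => totientMass e S (V.filter fun v => e v p = i) ψ with hα
  set β := fun i => totientMass e S (W.filter fun v => e v p = i) θ with hβ
  have hα0 : ∀ i, 0 ≤ α i := fun i => totientMass_nonneg hS hψ
  have hβ0 : ∀ i, 0 ≤ β i := fun i => totientMass_nonneg hS hθ
  have hrow : ∀ i, ∑ j ∈ I.erase i₀, q ^ ((i - j) + (j - i)) ≤ 2 := by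
    intro i
    have := sum_pow_dist_prime_le hpp (I.erase i₀) i
    have h2 := sum_pow_dist_all_le (q := q) (I.erase i₀) i
    rw [← hq] at this
    linarith
  have hcol : ∀ j, ∑ i ∈ I.erase i₀, q ^ ((i - j) + (j - i)) ≤ 2 := by
    intro j
    simpa only [add_comm] using hrow j
  have key := sum_rpow_le_rpow_sum (I := I.erase i₀) (c := fun i j => q ^ ((i - j) + (j - i)))
    (fun i j => by positivity) hα0 hβ0 (by norm_num) (fun i _ => hrow i) (fun j _ => hcol j)
  have hA0 : 0 ≤ totientMass e S V ψ := totientMass_nonneg hS hψ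
  have hB0 : 0 ≤ totientMass e S W θ := totientMass_nonneg hS hθ
  have hc0 : (0:ℝ) ≤ 20736 / p := by positivity
  calc _ = ∑ i ∈ I.erase i₀, ∑ j ∈ I.erase i₀, q ^ ((i - j) + (j - i)) *
        (α i * β j) ^ (3/4:ℝ) := by
        rw [← Finset.filter_ne', Finset.sum_filter]
        refine Finset.sum_congr rfl fun i _ => ?_
        rw [Finset.sum_filter]
        by_cases h : i = i₀
        · simp [h]
        · rw [if_pos h]
          refine Finset.sum_congr rfl fun j _ => ?_
          by_cases h' : j = i₀
          · simp [h']
          · rw [if_pos h', if_pos ⟨h, h'⟩]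
    _ ≤ _ := key
    _ ≤ 2 * ((20736 / p * totientMass e S V ψ) * (20736 / p * totientMass e S W θ)) ^ (3/4:ℝ) := by
        refine mul_le_mul_of_nonneg_left (Real.rpow_le_rpow ?_ ?_ (by norm_num)) (by norm_num)
        · exact mul_nonneg (Finset.sum_nonneg fun i _ => hα0 i)
            (Finset.sum_nonneg fun i _ => hβ0 i)
        · exact mul_le_mul h1 h2 (Finset.sum_nonneg fun i _ => hβ0 i) (mul_nonneg hc0 hA0)
    _ = _ := by
        rw [show (20736 / p * totientMass e S V ψ) * (20736 / p * totientMass e S W θ) =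
          (20736 / (p:ℝ)) ^ (2:ℝ) * (totientMass e S V ψ * totientMass e S W θ) by
            rw [Real.rpow_two]; ring,
          Real.mul_rpow (by positivity) (by positivity), ← Real.rpow_mul hc0]
        norm_num
        ring

theorem bilinearBound_of_threshold {P : ℕ} (hP : 768 ^ 4 ≤ P)
    (hP' : ∀ S : Finset ℕ, (∀ p ∈ S, P ≤ p) → ∑ p ∈ S, 2 * (20736 / (p:ℝ)) ^ (3/2:ℝ) ≤ 1 / 2)
    (e : ι → ℕ → ℕ) (S : Finset ℕ) (hS : ∀ p ∈ S, p.Prime) :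
    BilinearBound e S (fun _ _ => True) (2 * 14 ^ (S.filter fun p => p < P).card) := by
  classical
  induction S using Finset.strongInduction with
  | H S ih =>
    intro V W ψ θ hψ hθ hV hW
    have herase : ∀ p ∈ S, BilinearBound e (S.erase p) (fun _ _ => True)
        (2 * 14 ^ ((S.erase p).filter fun p => p < P).card) := fun p hp =>
      ih _ (Finset.erase_ssubset hp) fun l hl => hS l (Finset.mem_of_mem_erase hl)
    set X := totientMass e S V ψ * totientMass e S W θ with hX
    have hX0 : 0 ≤ X := mul_nonneg (totientMass_nonneg hS hψ) (totientMass_nonneg hS hθ)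
    set I : ℕ → Finset ℕ := fun p => V.image (fun v => e v p) ∪ W.image (fun v => e v p) with hI
    have hVI : ∀ p, ∀ v ∈ V, e v p ∈ I p := fun p v hv =>
      Finset.mem_union_left _ (Finset.mem_image_of_mem _ hv)
    have hWI : ∀ p, ∀ v ∈ W, e v p ∈ I p := fun p v hv =>
      Finset.mem_union_right _ (Finset.mem_image_of_mem _ hv)
    have hpeel : ∀ p ∈ S, edgeSum e S (fun _ _ => True) V W ψ θ ≤
        (2 * 14 ^ ((S.erase p).filter fun p => p < P).card) *
        ∑ i ∈ I p, ∑ j ∈ I p, ((p:ℝ) ^ (-(1/4):ℝ)) ^ ((i - j) + (j - i)) *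
        (totientMass e S (V.filter fun v => e v p = i) ψ *
          totientMass e S (W.filter fun w => e w p = j) θ) ^ (3/4:ℝ) := by
      intro p hp
      have := edgeSum_le_peel hS hp (by positivity) (herase p hp) hψ hθ hV hW (hVI p) (hWI p)
        (fun _ _ => True)
      simpa using this
    by_cases hsmall : ∃ p ∈ S, p < P
    · obtain ⟨p, hp, hpP⟩ := hsmall
      refine (hpeel p hp).trans ?_
      have hcard : (S.filter fun p => p < P).card =
          ((S.erase p).filter fun p => p < P).card + 1 := by
        rw [Finset.filter_erase, Finset.card_erase_add_one]
        exact Finset.mem_filter.2 ⟨hp, hpP⟩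
      rw [hcard, pow_succ, ← mul_assoc, mul_assoc (2 * 14 ^ _ : ℝ)]
      refine mul_le_mul_of_nonneg_left ?_ (by positivity)
      have h11 := rpow_neg_quarter_le (hS p hp)
      have hq0 : 0 ≤ (p:ℝ) ^ (-(1/4):ℝ) := Real.rpow_nonneg (Nat.cast_nonneg p) _
      have hrow : ∀ i, ∑ j ∈ I p, ((p:ℝ) ^ (-(1/4):ℝ)) ^ ((i - j) + (j - i)) ≤ 14 := by
        intro i
        have h1 := sum_pow_dist_prime_le (hS p hp) (I p) i
        have h2 := sum_pow_dist_all_le (q := (p:ℝ) ^ (-(1/4):ℝ)) (I p) i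
        linarith
      have := sum_rpow_le_rpow_sum (I := I p)
        (c := fun i j => ((p:ℝ) ^ (-(1/4):ℝ)) ^ ((i - j) + (j - i)))
        (α := fun i => totientMass e S (V.filter fun v => e v p = i) ψ)
        (β := fun i => totientMass e S (W.filter fun v => e v p = i) θ)
        (fun i j => by positivity) (fun i => totientMass_nonneg hS hψ)
        (fun i => totientMass_nonneg hS hθ) (by norm_num) (fun i _ => hrow i)
        (fun j _ => by simpa only [add_comm] using hrow j)
      rwa [sum_totientMass_fiber (hVI p), sum_totientMass_fiber (hWI p)] at this
    · push Not at hsmall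
      have hzero : ∀ S' ⊆ S, (S'.filter fun p => p < P).card = 0 := by
        intro S' hS'
        rw [Finset.card_eq_zero, Finset.filter_eq_empty_iff]
        exact fun p hp => not_lt.2 (hsmall p (hS' hp))
      rw [hzero S subset_rfl, pow_zero, mul_one]
      have hpeel' : ∀ p ∈ S, edgeSum e S (fun _ _ => True) V W ψ θ ≤ 2 *
        ∑ i ∈ I p, ∑ j ∈ I p, ((p:ℝ) ^ (-(1/4):ℝ)) ^ ((i - j) + (j - i)) *
        (totientMass e S (V.filter fun v => e v p = i) ψ *
          totientMass e S (W.filter fun w => e w p = j) θ) ^ (3/4:ℝ) := by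
        intro p hp
        have := hpeel p hp
        rwa [hzero _ (Finset.erase_subset _ _), pow_zero, mul_one] at this
      have herase' : ∀ p ∈ S, BilinearBound e (S.erase p) (fun _ _ => True) 2 := by
        intro p hp
        have := herase p hp
        rwa [hzero _ (Finset.erase_subset _ _), pow_zero, mul_one] at this
      by_contra hcon
      have hstr : ∀ p ∈ S, ∃ i₀,
          ∑ i ∈ (I p).erase i₀, totientMass e S (V.filter fun v => e v p = i) ψ ≤
            20736 / p * totientMass e S V ψ ∧
          ∑ i ∈ (I p).erase i₀, totientMass e S (W.filter fun v => e v p = i) θ ≤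
            20736 / p * totientMass e S W θ := by
        intro p hp
        have hpp := hS p hp
        have hq768 : (p:ℝ) ^ (-(1/4):ℝ) ≤ 1 / 768 := by
          refine le_of_pow_le_pow_left₀ (n := 4) (by norm_num) (by norm_num) ?_
          rw [rpow_neg_quarter_pow_four, div_pow, one_pow]
          exact one_div_le_one_div_of_le (by norm_num)
            (by exact_mod_cast hP.trans (hsmall p hp))
        rcases rpow_dichotomy (I := I p)
          (α := fun i => totientMass e S (V.filter fun v => e v p = i) ψ)
          (β := fun i => totientMass e S (W.filter fun v => e v p = i) θ)
          (Real.rpow_nonneg (Nat.cast_nonneg p) _) hq768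
          (fun i => totientMass_nonneg hS hψ) (fun i => totientMass_nonneg hS hθ) with h | h
        · exfalso
          apply hcon
          refine (hpeel' p hp).trans (mul_le_mul_of_nonneg_left ?_ (by norm_num))
          rwa [sum_totientMass_fiber (hVI p), sum_totientMass_fiber (hWI p)] at h
        · obtain ⟨i₀, h1, h2⟩ := h
          rw [sum_totientMass_fiber (hVI p), rpow_neg_quarter_pow_four, mul_one_div] at h1
          rw [sum_totientMass_fiber (hWI p), rpow_neg_quarter_pow_four, mul_one_div] at h2
          exact ⟨i₀, h1, h2⟩
      choose! n hn1 hn2 using hstr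
      apply hcon
      have hbad : ∀ p ∈ S, edgeSum e S (fun v w => e v p ≠ n p ∧ e w p ≠ n p) V W ψ θ ≤
          2 * (2 * (20736 / (p:ℝ)) ^ (3/2:ℝ) * X ^ (3/4:ℝ)) := fun p hp =>
        edgeSum_ne_le hS hp (hP.trans (hsmall p hp)) (by norm_num) (herase' p hp) hψ hθ hV hW
          (hVI p) (hWI p) (hn1 p hp) (hn2 p hp)
      have hgood := edgeSum_good_le hS hψ hθ hV hW n
      have hcover : edgeSum e S (fun _ _ => True) V W ψ θ ≤
          ∑ p ∈ S, edgeSum e S (fun v w => e v p ≠ n p ∧ e w p ≠ n p) V W ψ θ +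
          edgeSum e S (fun v w => ∀ p ∈ S, e v p = n p ∨ e w p = n p) V W ψ θ := by
        refine edgeSum_le_sum_add hS hψ hθ fun v w _ => ?_
        by_contra h
        push Not at h
        obtain ⟨⟨p, hp, h1⟩, h2⟩ := h
        exact h1.2 (h2 p hp h1.1)
      have hXr : 0 ≤ X ^ (3/4:ℝ) := Real.rpow_nonneg hX0 _
      calc _ ≤ _ := hcover
        _ ≤ ∑ p ∈ S, 2 * (2 * (20736 / (p:ℝ)) ^ (3/2:ℝ) * X ^ (3/4:ℝ)) + X ^ (3/4:ℝ) :=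
            add_le_add (Finset.sum_le_sum hbad) hgood
        _ = 2 * ((∑ p ∈ S, 2 * (20736 / (p:ℝ)) ^ (3/2:ℝ)) * X ^ (3/4:ℝ)) + X ^ (3/4:ℝ) := by
            rw [← Finset.mul_sum, ← Finset.sum_mul]
        _ ≤ 2 * (1 / 2 * X ^ (3/4:ℝ)) + X ^ (3/4:ℝ) := by
            gcongr
            exact hP' S hsmall
        _ = _ := by ring

theorem bilinearBound_ne {K : ℝ} (hK : 0 ≤ K) {e : ι → ℕ → ℕ}
    (hbd : ∀ S : Finset ℕ, (∀ p ∈ S, p.Prime) → BilinearBound e S (fun _ _ => True) K)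
    (T : Finset ℕ) : ∀ S : Finset ℕ, (∀ p ∈ S, p.Prime) → T ⊆ S →
    BilinearBound e S (fun v w => ∀ p ∈ T, e v p ≠ e w p)
      (K * ∏ p ∈ T, 13 * (p:ℝ) ^ (-(1/4):ℝ)) := by
  classical
  induction T using Finset.induction_on with
  | empty => intro S hS _; simpa using hbd S hS
  | insert p T hpT ih =>
    intro S hS hTS V W ψ θ hψ hθ hV hW
    have hp : p ∈ S := hTS (Finset.mem_insert_self _ _)
    have hpp := hS p hp
    have hbd' := ih (S.erase p) (fun l hl => hS l (Finset.mem_of_mem_erase hl)) fun l hl =>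
      Finset.mem_erase.2 ⟨fun h => hpT (h ▸ hl), hTS (Finset.mem_insert_of_mem hl)⟩
    set I : Finset ℕ := V.image (fun v => e v p) ∪ W.image (fun v => e v p) with hI
    have hVI : ∀ v ∈ V, e v p ∈ I := fun v hv =>
      Finset.mem_union_left _ (Finset.mem_image_of_mem _ hv)
    have hWI : ∀ v ∈ W, e v p ∈ I := fun v hv =>
      Finset.mem_union_right _ (Finset.mem_image_of_mem _ hv)
    have hK' : 0 ≤ K * ∏ p ∈ T, 13 * (p:ℝ) ^ (-(1/4):ℝ) := by positivity
    have h1 := edgeSum_le_peel hS hp hK' hbd' hψ hθ hV hW hVI hWI (fun i j => i ≠ j)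
    refine (edgeSum_mono hS hψ hθ
      (R' := fun v w => (∀ l ∈ T, e v l ≠ e w l) ∧ e v p ≠ e w p) fun v _ w _ h =>
      ⟨fun l hl => h l (Finset.mem_insert_of_mem hl), h p (Finset.mem_insert_self _ _)⟩).trans ?_
    refine h1.trans ?_
    rw [Finset.prod_insert hpT, mul_comm (13 * (p:ℝ) ^ (-(1/4):ℝ)), ← mul_assoc, mul_assoc (K * _)]
    refine mul_le_mul_of_nonneg_left ?_ hK'
    have := sum_rpow_le_rpow_sum (I := I)
      (c := fun i j => (if i = j then 0 else ((p:ℝ) ^ (-(1/4):ℝ)) ^ ((i - j) + (j - i))))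
      (α := fun i => totientMass e S (V.filter fun v => e v p = i) ψ)
      (β := fun i => totientMass e S (W.filter fun v => e v p = i) θ)
      (M := 13 * (p:ℝ) ^ (-(1/4):ℝ))
      (fun i j => by split_ifs <;> positivity) (fun i => totientMass_nonneg hS hψ)
      (fun i => totientMass_nonneg hS hθ) (by positivity)
      (fun i _ => sum_pow_dist_prime_le hpp I i)
      (fun j _ => (sum_ite_eq_comm_pow I j).trans_le (sum_pow_dist_prime_le hpp I j))
    rw [sum_totientMass_fiber hVI, sum_totientMass_fiber hWI] at this
    refine le_trans (le_of_eq ?_) this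
    refine Finset.sum_congr rfl fun i _ => Finset.sum_congr rfl fun j _ => ?_
    by_cases h : i = j <;> simp [h]

/-- The bilinear estimate, with savings at primes where the exponents are required to differ. -/
theorem exists_bilinearBound : ∃ K : ℝ, 0 < K ∧ ∀ (e : ι → ℕ → ℕ) (S T : Finset ℕ),
    (∀ p ∈ S, p.Prime) → T ⊆ S → BilinearBound e S (fun v w => ∀ p ∈ T, e v p ≠ e w p)
      (K * ∏ p ∈ T, 13 * (p:ℝ) ^ (-(1/4):ℝ)) := by
  obtain ⟨P, hP, hP'⟩ := exists_prime_threshold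
  refine ⟨2 * 14 ^ P, by positivity, fun e S T hS hTS => ?_⟩
  refine bilinearBound_ne (by positivity) (fun S hS V W ψ θ hψ hθ hV hW => ?_) T S hS hTS
  refine (bilinearBound_of_threshold hP hP' e S hS V W ψ θ hψ hθ hV hW).trans ?_
  have hX0 := mul_nonneg (totientMass_nonneg (e := e) (V := V) hS hψ)
    (totientMass_nonneg (e := e) (V := W) hS hθ)
  have hcard : (S.filter fun p => p < P).card ≤ P := by
    refine (Finset.card_le_card fun p hp => ?_).trans (Finset.card_range P).le
    exact Finset.mem_range.2 (Finset.mem_filter.1 hp).2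
  have := Real.rpow_nonneg hX0 (3/4)
  gcongr
  norm_num

end Bilinear

theorem prod_pow_factorization_of_subset {S : Finset ℕ} {n : ℕ} (hn : n ≠ 0)
    (h : n.primeFactors ⊆ S) : ∏ p ∈ S, p ^ n.factorization p = n := by
  conv_rhs => rw [← Nat.prod_factorization_pow_eq_self hn]
  rw [Finsupp.prod_of_support_subset _ (by simpa using h) _ (by simp)]

theorem mul_ratioProd_factorization {S : Finset ℕ} {v w : ℕ} (hv : v ≠ 0) (hw : w ≠ 0)
    (hvS : v.primeFactors ⊆ S) (hwS : w.primeFactors ⊆ S) :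
    (v:ℝ) * ratioProd (fun n p => n.factorization p) S w v = (v.lcm w : ℕ) := by
  have hl : (v.lcm w).primeFactors ⊆ S := by
    intro p hp
    have hpp := Nat.prime_of_mem_primeFactors hp
    have hd := (Nat.dvd_of_mem_primeFactors hp).trans (Nat.lcm_dvd_mul v w)
    rcases hpp.dvd_mul.1 hd with h | h
    · exact hvS (Nat.mem_primeFactors.2 ⟨hpp, h, hv⟩)
    · exact hwS (Nat.mem_primeFactors.2 ⟨hpp, h, hw⟩)
  rw [← prod_pow_factorization_of_subset (Nat.lcm_ne_zero hv hw) hl]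
  conv_lhs => rw [← prod_pow_factorization_of_subset hv hvS]
  rw [ratioProd]
  push_cast
  rw [← Finset.prod_mul_distrib]
  refine Finset.prod_congr rfl fun p _ => ?_
  rw [prod_pow_factorization_of_subset hv hvS, ← pow_add, Nat.factorization_lcm hv hw,
    Finsupp.sup_apply]
  congr 1
  simp only [max_def]
  split_ifs <;> omega

theorem totientProd_factorization {S : Finset ℕ} {v : ℕ} (hvS : v.primeFactors ⊆ S) :
    (v:ℝ) * totientProd (fun n p => n.factorization p) S v = v.totient := by
  have h := Nat.totient_eq_mul_prod_factors v
  have h' : (v.totient : ℝ) = v * ∏ p ∈ v.primeFactors, (1 - (p:ℝ)⁻¹) := by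
    have := congrArg (fun q : ℚ => (q:ℝ)) h
    push_cast at this
    exact this
  rw [h', totientProd]
  congr 1
  rw [← Finset.inter_eq_right.2 hvS, ← Finset.prod_ite_mem]
  refine Finset.prod_congr rfl fun p hp => ?_
  rw [one_div]
  have : v.factorization p = 0 ↔ p ∉ v.primeFactors := by
    rw [← Nat.support_factorization, Finsupp.notMem_support_iff]
  by_cases h0 : p ∈ v.primeFactors
  · rw [if_pos h0, if_neg fun h => (this.1 h) h0]
  · rw [if_neg h0, if_pos (this.2 h0)]

open Classical in
/-- The bilinear estimate for pairs of integers with small least common multiple. -/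
theorem exists_sum_lcm_le : ∃ K : ℝ, 0 < K ∧ ∀ (Q T : Finset ℕ) (δ : ℕ → ℝ) (z : ℝ),
    (∀ q ∈ Q, 0 < q) → (∀ p ∈ T, p.Prime) → (∀ q, 0 ≤ δ q) → 0 < z →
    ∑ v ∈ Q, ∑ w ∈ Q, (if (∀ p ∈ T, v.factorization p ≠ w.factorization p) ∧
        (v.lcm w : ℕ) * δ v ≤ z ∧ (v.lcm w : ℕ) * δ w ≤ z then
        (v.totient * δ v) * (w.totient * δ w) else 0) ≤
      K * (∏ p ∈ T, 13 * (p:ℝ) ^ (-(1/4):ℝ)) * Real.sqrt z *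
        (∑ q ∈ Q, q.totient * δ q) ^ (3/2:ℝ) := by
  obtain ⟨K, hK, hbd⟩ := exists_bilinearBound (ι := ℕ)
  refine ⟨K, hK, fun Q T δ z hQ hT hδ hz => ?_⟩
  set S := T ∪ Q.biUnion Nat.primeFactors with hSdef
  have hS : ∀ p ∈ S, p.Prime := by
    intro p hp
    rcases Finset.mem_union.1 hp with h | h
    · exact hT p h
    · obtain ⟨q, _, h⟩ := Finset.mem_biUnion.1 h
      exact Nat.prime_of_mem_primeFactors h
  have hQS : ∀ q ∈ Q, q.primeFactors ⊆ S := fun q hq =>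
    (Finset.subset_biUnion_of_mem Nat.primeFactors hq).trans Finset.subset_union_right
  have hinj : InjExp (fun n p => n.factorization p) S Q := by
    intro v hv w hw h
    rw [← prod_pow_factorization_of_subset (hQ v hv).ne' (hQS v hv),
      ← prod_pow_factorization_of_subset (hQ w hw).ne' (hQS w hw)]
    exact Finset.prod_congr rfl fun p hp => congrArg (p ^ ·) (h p hp)
  have hψ : ∀ v : ℕ, 0 ≤ v * δ v / z := fun v =>
    div_nonneg (mul_nonneg (Nat.cast_nonneg v) (hδ v)) hz.le
  have key := hbd (fun n p => n.factorization p) S T hS Finset.subset_union_left Q Q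
    (fun v => v * δ v / z) (fun v => v * δ v / z) hψ hψ hinj hinj
  have htot : ∀ v ∈ Q, totientProd (fun n p => n.factorization p) S v * (v * δ v / z) =
      v.totient * δ v / z := by
    intro v hv
    rw [← totientProd_factorization (hQS v hv)]; ring
  have hmass : totientMass (fun n p => n.factorization p) S Q (fun v => v * δ v / z) =
      (∑ q ∈ Q, q.totient * δ q) / z := by
    rw [totientMass, Finset.sum_div]
    exact Finset.sum_congr rfl htot
  set Ψ := ∑ q ∈ Q, q.totient * δ q with hΨ
  have hΨ0 : 0 ≤ Ψ := Finset.sum_nonneg fun q _ => mul_nonneg (Nat.cast_nonneg _) (hδ q)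
  have hE : edgeSum (fun n p => n.factorization p) S
      (fun v w => ∀ p ∈ T, v.factorization p ≠ w.factorization p) Q Q
      (fun v => v * δ v / z) (fun v => v * δ v / z) = z⁻¹ ^ 2 *
      ∑ v ∈ Q, ∑ w ∈ Q, (if (∀ p ∈ T, v.factorization p ≠ w.factorization p) ∧
        (v.lcm w : ℕ) * δ v ≤ z ∧ (v.lcm w : ℕ) * δ w ≤ z then
        (v.totient * δ v) * (w.totient * δ w) else 0) := by
    rw [edgeSum, Finset.mul_sum]
    refine Finset.sum_congr rfl fun v hv => ?_
    rw [Finset.mul_sum]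
    refine Finset.sum_congr rfl fun w hw => ?_
    have h1 : v * δ v / z * ratioProd (fun n p => n.factorization p) S w v =
        (v.lcm w : ℕ) * δ v / z := by
      rw [← mul_ratioProd_factorization (hQ v hv).ne' (hQ w hw).ne' (hQS v hv) (hQS w hw)]; ring
    have h2 : w * δ w / z * ratioProd (fun n p => n.factorization p) S v w =
        (v.lcm w : ℕ) * δ w / z := by
      rw [Nat.lcm_comm,
        ← mul_ratioProd_factorization (hQ w hw).ne' (hQ v hv).ne' (hQS w hw) (hQS v hv)]; ring
    rw [h1, h2, htot v hv, htot w hw, mul_ite, mul_zero]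
    split_ifs with hA hB hB
    · field_simp
    · rw [div_le_one hz, div_le_one hz] at hA
      exact absurd hA hB
    · rw [div_le_one hz, div_le_one hz] at hA
      exact absurd hB hA
    · rfl
  rw [hE, hmass] at key
  have h3 : (Ψ / z * (Ψ / z)) ^ (3/4:ℝ) = Ψ ^ (3/2:ℝ) * (z ^ (3/2:ℝ))⁻¹ := by
    rw [← sq, ← Real.rpow_two, ← Real.rpow_mul (div_nonneg hΨ0 hz.le), Real.div_rpow hΨ0 hz.le]
    norm_num
    rfl
  have h4 : z ^ 2 = z ^ (3/2:ℝ) * Real.sqrt z := by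
    rw [Real.sqrt_eq_rpow, ← Real.rpow_add hz, ← Real.rpow_two]; norm_num
  have hz32 : 0 < z ^ (3/2:ℝ) := Real.rpow_pos_of_pos hz _
  rw [h3, inv_pow, inv_mul_le_iff₀ (by positivity), h4] at key
  refine key.trans (le_of_eq ?_)
  field_simp

theorem sum_log_primeFactors_le {k : ℕ} (hk : k ≠ 0) :
    ∑ p ∈ k.primeFactors, Real.log p ≤ Real.log k := by
  rw [← Real.log_prod (fun p hp => by
    exact_mod_cast (Nat.prime_of_mem_primeFactors hp).ne_zero)]
  have hpos : 0 < ∏ p ∈ k.primeFactors, p :=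
    Finset.prod_pos fun p hp => (Nat.prime_of_mem_primeFactors hp).pos
  have := Nat.le_of_dvd (Nat.pos_of_ne_zero hk) (Nat.prod_primeFactors_dvd k)
  rw [← Nat.cast_prod]
  exact Real.log_le_log (by exact_mod_cast hpos) (by exact_mod_cast this)

theorem sum_log_div_le {n : ℕ} (hn : 1 ≤ n) :
    ∑ p ∈ Nat.primesLE n, Real.log p / p ≤ Real.log n + Real.log 4 := by
  have h1 : ∑ k ∈ Finset.Ioc 0 n, Real.log k ≤ n * Real.log n := by
    calc ∑ k ∈ Finset.Ioc 0 n, Real.log k ≤ ∑ k ∈ Finset.Ioc 0 n, Real.log n := by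
          refine Finset.sum_le_sum fun k hk => ?_
          rw [Finset.mem_Ioc] at hk
          exact Real.log_le_log (by exact_mod_cast hk.1) (by exact_mod_cast hk.2)
      _ = _ := by simp
  have h2 : ∑ p ∈ Nat.primesLE n, Real.log p * ((n / p : ℕ) : ℝ) ≤
      ∑ k ∈ Finset.Ioc 0 n, Real.log k := by
    calc ∑ p ∈ Nat.primesLE n, Real.log p * ((n / p : ℕ) : ℝ)
        = ∑ p ∈ Nat.primesLE n, ∑ k ∈ Finset.Ioc 0 n, if p ∣ k then Real.log p else 0 := by
          refine Finset.sum_congr rfl fun p _ => ?_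
          rw [← Finset.sum_filter, Finset.sum_const, Nat.Ioc_filter_dvd_card_eq_div,
            nsmul_eq_mul, mul_comm]
      _ = ∑ k ∈ Finset.Ioc 0 n, ∑ p ∈ Nat.primesLE n, if p ∣ k then Real.log p else 0 :=
          Finset.sum_comm
      _ ≤ _ := by
          refine Finset.sum_le_sum fun k hk => ?_
          rw [Finset.mem_Ioc] at hk
          refine le_trans (le_of_eq ?_) (sum_log_primeFactors_le hk.1.ne')
          rw [← Finset.sum_filter]
          refine Finset.sum_congr ?_ fun _ _ => rfl
          ext p
          simp only [Finset.mem_filter, Nat.mem_primesLE, Nat.mem_primeFactors]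
          constructor
          · rintro ⟨⟨_, h⟩, h'⟩; exact ⟨h, h', hk.1.ne'⟩
          · rintro ⟨h, h', _⟩; exact ⟨⟨(Nat.le_of_dvd hk.1 h').trans hk.2, h⟩, h'⟩
  have h3 : n * ∑ p ∈ Nat.primesLE n, Real.log p / p - Chebyshev.theta n ≤
      ∑ p ∈ Nat.primesLE n, Real.log p * ((n / p : ℕ) : ℝ) := by
    rw [Chebyshev.theta_eq_sum_primesLE_log, Finset.mul_sum, ← Finset.sum_sub_distrib]
    refine Finset.sum_le_sum fun p hp => ?_
    have hp0 : (0:ℝ) < p := by exact_mod_cast (Nat.mem_primesLE.1 hp).2.pos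
    have hlog : 0 ≤ Real.log p := Real.log_nonneg (by
      exact_mod_cast (Nat.mem_primesLE.1 hp).2.one_le)
    have : (n:ℝ) / p - 1 ≤ ((n / p : ℕ) : ℝ) := by
      rw [← Nat.floor_div_eq_div (K := ℝ)]
      exact (Nat.sub_one_lt_floor _).le
    calc (n:ℝ) * (Real.log p / p) - Real.log p = Real.log p * (n / p - 1) := by ring
      _ ≤ _ := mul_le_mul_of_nonneg_left this hlog
  have h4 := Chebyshev.theta_le_log4_mul_x (Nat.cast_nonneg n : (0:ℝ) ≤ n)
  have hn0 : (0:ℝ) < n := by exact_mod_cast hn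
  have h5 : n * ∑ p ∈ Nat.primesLE n, Real.log p / p ≤ n * (Real.log n + Real.log 4) := by
    linarith
  exact le_of_mul_le_mul_left h5 hn0

theorem primesLE_succ_sum (f : ℕ → ℝ) (n : ℕ) : ∑ p ∈ Nat.primesLE (n+1), f p =
    ∑ p ∈ Nat.primesLE n, f p + if (n+1).Prime then f (n+1) else 0 := by
  rw [Nat.primesLE_eq_filter_range, Nat.primesLE_eq_filter_range, Finset.sum_filter,
    Finset.sum_filter, Finset.sum_range_succ]

theorem exists_sum_inv_primes_le : ∃ C : ℝ, 0 < C ∧ ∀ n : ℕ, 2 ≤ n →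
    ∑ p ∈ Nat.primesLE n, (1:ℝ) / p ≤ Real.log (Real.log n) + C := by
  set B := Real.log 4
  have hB : 0 ≤ B := Real.log_nonneg (by norm_num)
  have key : ∀ n : ℕ, 2 ≤ n → ∑ p ∈ Nat.primesLE n, (1:ℝ) / p -
      (∑ p ∈ Nat.primesLE n, Real.log p / p) / Real.log n ≤
      Real.log (Real.log n) - Real.log (Real.log 2) + B * (1 / Real.log 2 - 1 / Real.log n) := by
    intro n hn
    induction n, hn using Nat.le_induction with
    | base =>
      have h2 : Real.log 2 ≠ 0 := by positivity
      have : Nat.primesLE 2 = {2} := by decide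
      rw [this]
      simp
      field_simp
      simp
    | succ n hn ih =>
      have hn1 : (1:ℝ) < n := by exact_mod_cast hn
      have hl : 0 < Real.log n := Real.log_pos hn1
      have hl' : 0 < Real.log ((n+1 : ℕ):ℝ) := Real.log_pos (by push_cast; linarith)
      have hle : Real.log n ≤ Real.log ((n+1 : ℕ):ℝ) :=
        Real.log_le_log (by linarith) (by push_cast; linarith)
      rw [primesLE_succ_sum (fun p => (1:ℝ)/p), primesLE_succ_sum (fun p => Real.log p / p)]
      have hA := sum_log_div_le (show 1 ≤ n by omega)
      set A := ∑ p ∈ Nat.primesLE n, Real.log p / p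
      have e : (if (n+1).Prime then (1:ℝ) / ((n+1:ℕ):ℝ) else 0) -
          (if (n+1).Prime then Real.log ((n+1:ℕ):ℝ) / ((n+1:ℕ):ℝ) else 0) /
            Real.log ((n+1:ℕ):ℝ) = 0 := by
        split_ifs
        · field_simp; simp
        · simp
      set l := Real.log n
      set l' := Real.log ((n+1:ℕ):ℝ)
      have hlog : 1 - l / l' ≤ Real.log l' - Real.log l := by
        have := Real.one_sub_inv_le_log_of_pos (div_pos hl' hl)
        rwa [inv_div, Real.log_div hl'.ne' hl.ne'] at this
      have hd : 0 ≤ 1 / l - 1 / l' := sub_nonneg.2 (one_div_le_one_div_of_le hl hle)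
      have h1 : A * (1 / l - 1 / l') ≤ (l + B) * (1 / l - 1 / l') :=
        mul_le_mul_of_nonneg_right hA hd
      have h2 : l * (1 / l - 1 / l') = 1 - l / l' := by field_simp
      rw [add_div]
      have h3 : A / l' = A / l - A * (1 / l - 1 / l') := by ring
      rw [h3]
      nlinarith [ih]
  refine ⟨1 + B / Real.log 2 + (- Real.log (Real.log 2)) + B / Real.log 2 + 1, ?_, fun n hn => ?_⟩
  · have : Real.log (Real.log 2) ≤ 0 :=
      Real.log_nonpos (Real.log_nonneg (by norm_num)) (by linarith [Real.log_two_lt_d9])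
    have : 0 ≤ B / Real.log 2 := by positivity
    linarith
  · have h := key n hn
    have hl2 : 0 < Real.log 2 := Real.log_pos (by norm_num)
    have hle : Real.log 2 ≤ Real.log n := Real.log_le_log (by norm_num) (by exact_mod_cast hn)
    have hl : 0 < Real.log n := hl2.trans_le hle
    have hA := sum_log_div_le (show 1 ≤ n by omega)
    have h1 : (∑ p ∈ Nat.primesLE n, Real.log p / p) / Real.log n ≤ 1 + B / Real.log 2 := by
      calc _ ≤ (Real.log n + B) / Real.log n := by gcongr
        _ = 1 + B / Real.log n := by field_simp
        _ ≤ _ := by gcongr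
    have h2 : B * (1 / Real.log 2 - 1 / Real.log n) ≤ B / Real.log 2 := by
      have : 0 ≤ B / Real.log n := by positivity
      have e : B * (1 / Real.log 2 - 1 / Real.log n) = B / Real.log 2 - B / Real.log n := by ring
      linarith
    linarith

theorem sum_inv_mul_pred_le (S : Finset ℕ) (hS : ∀ p ∈ S, 2 ≤ p) :
    ∑ p ∈ S, (1:ℝ) / (p * (p - 1)) ≤ 1 := by
  have h : ∀ n : ℕ, ∑ p ∈ Finset.Ico 2 (n+2), (1:ℝ) / (p * (p - 1)) = 1 - 1 / (n+1) := by
    intro n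
    induction n with
    | zero => simp
    | succ n ih =>
      rw [Finset.sum_Ico_succ_top (by omega), ih]
      push_cast
      have : (n:ℝ) + 2 - 1 = n + 1 := by ring
      rw [this]
      field_simp
      ring
  have hsub : S ⊆ Finset.Ico 2 (S.sup id + 2) := fun p hp => by
    have := Finset.le_sup (f := id) hp
    simp only [id] at this
    exact Finset.mem_Ico.2 ⟨hS p hp, by omega⟩
  calc _ ≤ ∑ p ∈ Finset.Ico 2 (S.sup id + 2), (1:ℝ) / (p * (p - 1)) := by
        refine Finset.sum_le_sum_of_subset_of_nonneg hsub fun p hp _ => ?_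
        have : (2:ℝ) ≤ p := by exact_mod_cast (Finset.mem_Ico.1 hp).1
        exact div_nonneg zero_le_one (mul_nonneg (by linarith) (by linarith))
    _ ≤ 1 := by rw [h]; have : (0:ℝ) ≤ 1 / ((S.sup id : ℕ) + 1) := by positivity
                linarith

theorem prod_inv_one_sub_le (S : Finset ℕ) (hS : ∀ p ∈ S, p.Prime) :
    ∏ p ∈ S, (1 - (1:ℝ) / p)⁻¹ ≤ Real.exp (1 + ∑ p ∈ S, (1:ℝ) / p) := by
  have h := sum_inv_mul_pred_le S fun p hp => (hS p hp).two_le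
  calc ∏ p ∈ S, (1 - (1:ℝ) / p)⁻¹ ≤ ∏ p ∈ S, Real.exp (1 / (p * (p - 1)) + 1 / p) := by
        refine Finset.prod_le_prod (fun p hp => ?_) fun p hp => ?_
        all_goals have h2 : (2:ℝ) ≤ p := by exact_mod_cast (hS p hp).two_le
        · rw [inv_nonneg, sub_nonneg, div_le_one (by linarith)]; linarith
        · have : (1 - (1:ℝ) / p)⁻¹ = (1 / (p * (p - 1)) + 1 / p) + 1 := by
            have : (p:ℝ) - 1 ≠ 0 := by linarith
            have : (p:ℝ) ≠ 0 := by linarith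
            field_simp
            ring
          rw [this]
          exact Real.add_one_le_exp _
    _ = Real.exp (∑ p ∈ S, ((1:ℝ) / (p * (p - 1)) + 1 / p)) := (Real.exp_sum _ _).symm
    _ ≤ _ := by
        rw [Finset.sum_add_distrib]
        exact Real.exp_le_exp.2 (by linarith)

/-- Mertens' upper bound for the Euler product over primes. -/
theorem exists_mertens : ∃ C : ℝ, 0 < C ∧ ∀ n : ℕ, 2 ≤ n →
    ∏ p ∈ Nat.primesLE n, (1 - (1:ℝ) / p)⁻¹ ≤ C * Real.log n := by
  obtain ⟨C, hC, h⟩ := exists_sum_inv_primes_le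
  refine ⟨Real.exp (1 + C), Real.exp_pos _, fun n hn => ?_⟩
  have hl : 0 < Real.log n := Real.log_pos (by exact_mod_cast hn)
  refine (prod_inv_one_sub_le _ fun p hp => (Nat.mem_primesLE.1 hp).2).trans ?_
  calc _ ≤ Real.exp (1 + C + Real.log (Real.log n)) :=
        Real.exp_le_exp.2 (by linarith [h n hn])
    _ = _ := by rw [Real.exp_add, Real.exp_log hl]

/-- The arithmetic function `h ↦ h / φ(h)` restricted to integers coprime to `n`. -/
noncomputable def coprimeRatio (n : ℕ) : ArithmeticFunction ℝ :=
  ⟨fun h => if h.Coprime n then (h:ℝ) / h.totient else 0, by simp⟩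

theorem coprimeRatio_apply (n h : ℕ) :
    coprimeRatio n h = if h.Coprime n then (h:ℝ) / h.totient else 0 := rfl

theorem coprimeRatio_nonneg (n h : ℕ) : 0 ≤ coprimeRatio n h := by
  rw [coprimeRatio_apply]; split_ifs <;> positivity

theorem coprimeRatio_mul_le (n a b : ℕ) :
    coprimeRatio n (a * b) ≤ coprimeRatio n a * coprimeRatio n b := by
  by_cases h : (a * b).Coprime n
  · obtain ⟨ha, hb⟩ := Nat.coprime_mul_iff_left.1 h
    rw [coprimeRatio_apply, coprimeRatio_apply, coprimeRatio_apply, if_pos h, if_pos ha, if_pos hb,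
      div_mul_div_comm]
    push_cast
    rcases Nat.eq_zero_or_pos a with rfl | ha0
    · simp
    rcases Nat.eq_zero_or_pos b with rfl | hb0
    · simp
    have h1 := Nat.totient_pos.2 ha0
    have h2 := Nat.totient_pos.2 hb0
    refine div_le_div_of_nonneg_left (by positivity) (by positivity) ?_
    exact_mod_cast Nat.totient_super_multiplicative a b
  · rw [coprimeRatio_apply n (a * b), if_neg h]
    exact mul_nonneg (coprimeRatio_nonneg _ _) (coprimeRatio_nonneg _ _)

theorem coprimeRatio_le_two_of_isPrimePow {n d : ℕ} (h : IsPrimePow d) :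
    coprimeRatio n d ≤ 2 := by
  rw [coprimeRatio_apply]
  split_ifs
  · obtain ⟨p, k, hp, hk, rfl⟩ := h
    have hp := hp.nat_prime
    obtain ⟨j, rfl⟩ := Nat.exists_eq_succ_of_ne_zero hk.ne'
    have h2 := hp.two_le
    rw [div_le_iff₀ (by exact_mod_cast Nat.totient_pos.2 (pow_pos hp.pos _)), Nat.succ_eq_add_one,
      Nat.totient_prime_pow_succ hp]
    have : p ≤ 2 * (p - 1) := by omega
    have := Nat.mul_le_mul_left (p ^ j) this
    rw [pow_succ]
    exact_mod_cast (by linarith : p ^ j * p ≤ 2 * (p ^ j * (p - 1)))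
  · norm_num

theorem sum_coprimeRatio_mul_log_le (n X : ℕ) :
    (∑ m ∈ Finset.Ioc 0 X, coprimeRatio n m) * Real.log X ≤
      (1 + 2 * (Real.log 4 + 4)) * X * ∑ m ∈ Finset.Ioc 0 X, coprimeRatio n m / m := by
  set F := coprimeRatio n
  set B := Real.log 4 + 4
  have h1 : ∀ m ∈ Finset.Ioc 0 X, F m * Real.log X ≤ X * (F m / m) +
      (F * ((2:ℝ) • ArithmeticFunction.vonMangoldt)) m := by
    intro m hm
    rw [Finset.mem_Ioc] at hm
    have hm0 : (0:ℝ) < m := by exact_mod_cast hm.1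
    have hX0 : (0:ℝ) < X := by exact_mod_cast hm.1.trans_le hm.2
    have e1 : F m * Real.log m ≤ (F * ((2:ℝ) • ArithmeticFunction.vonMangoldt)) m := by
      rw [← ArithmeticFunction.vonMangoldt_sum, ArithmeticFunction.mul_apply, Finset.mul_sum,
        ← Nat.sum_divisorsAntidiagonal' (f := fun _ d => F m * ArithmeticFunction.vonMangoldt d)]
      refine Finset.sum_le_sum fun x hx => ?_
      obtain ⟨hx, _⟩ := Nat.mem_divisorsAntidiagonal.1 hx
      rw [ArithmeticFunction.smul_map, smul_eq_mul, ← mul_assoc]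
      by_cases h0 : ArithmeticFunction.vonMangoldt x.2 = 0
      · rw [h0]; simp
      · refine mul_le_mul_of_nonneg_right ?_ ArithmeticFunction.vonMangoldt_nonneg
        rw [← hx]
        refine (coprimeRatio_mul_le n _ _).trans ?_
        exact mul_le_mul_of_nonneg_left (coprimeRatio_le_two_of_isPrimePow
          (ArithmeticFunction.vonMangoldt_ne_zero_iff.1 h0)) (coprimeRatio_nonneg _ _)
    have e2 : Real.log X - Real.log m ≤ X / m := by
      rw [← Real.log_div hX0.ne' hm0.ne']
      exact Real.log_le_self (by positivity)
    have e3 := mul_le_mul_of_nonneg_left e2 (coprimeRatio_nonneg n m)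
    calc F m * Real.log X = F m * (Real.log X - Real.log m) + F m * Real.log m := by ring
      _ ≤ F m * (X / m) + (F * ((2:ℝ) • ArithmeticFunction.vonMangoldt)) m := add_le_add e3 e1
      _ = _ := by ring
  rw [Finset.sum_mul]
  refine (Finset.sum_le_sum h1).trans ?_
  rw [Finset.sum_add_distrib, ArithmeticFunction.sum_Ioc_mul_eq_sum_sum, ← Finset.mul_sum]
  have h2 : ∑ m ∈ Finset.Ioc 0 X, F m * ∑ d ∈ Finset.Ioc 0 (X / m),
      ((2:ℝ) • ArithmeticFunction.vonMangoldt) d ≤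
      2 * B * X * ∑ m ∈ Finset.Ioc 0 X, F m / m := by
    rw [Finset.mul_sum]
    refine Finset.sum_le_sum fun m hm => ?_
    rw [Finset.mem_Ioc] at hm
    have e : ∑ d ∈ Finset.Ioc 0 (X / m), ((2:ℝ) • ArithmeticFunction.vonMangoldt) d =
        2 * Chebyshev.psi ((X / m : ℕ) : ℝ) := by
      rw [Chebyshev.psi, Nat.floor_natCast, Finset.mul_sum]
      exact Finset.sum_congr rfl fun d _ => by rw [ArithmeticFunction.smul_map, smul_eq_mul]
    have e2 : Chebyshev.psi ((X / m : ℕ) : ℝ) ≤ B * (X / m) :=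
      (Chebyshev.psi_le_const_mul_self (Nat.cast_nonneg _)).trans
        (mul_le_mul_of_nonneg_left Nat.cast_div_le (by positivity))
    rw [e]
    calc F m * (2 * Chebyshev.psi ((X / m : ℕ) : ℝ)) ≤ F m * (2 * (B * (X / m))) := by
          have := coprimeRatio_nonneg n m
          gcongr
      _ = _ := by ring
  linarith

theorem hasSum_inv_totient_prime_pow {p : ℕ} (hp : p.Prime) :
    HasSum (fun k : ℕ => (1:ℝ) / (p ^ k).totient) (1 + p / ((p:ℝ) - 1) ^ 2) := by
  have h2 : (2:ℝ) ≤ p := by exact_mod_cast hp.two_le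
  have h1 : (p:ℝ) - 1 ≠ 0 := by linarith
  have h0 : (p:ℝ) ≠ 0 := by linarith
  have hg : HasSum (fun k : ℕ => ((p:ℝ)⁻¹) ^ k * (1 / (p - 1))) ((1 - (p:ℝ)⁻¹)⁻¹ * (1 / (p - 1))) :=
    (hasSum_geometric_of_lt_one (by positivity) (inv_lt_one_of_one_lt₀ (by linarith))).mul_right _
  have : HasSum (fun k : ℕ => (1:ℝ) / (p ^ (k+1)).totient) ((1 - (p:ℝ)⁻¹)⁻¹ * (1 / (p - 1))) := by
    convert hg using 2 with k
    rw [Nat.totient_prime_pow_succ hp]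
    push_cast [hp.one_le]
    rw [inv_pow]
    field_simp
  have h := (hasSum_nat_add_iff (f := fun k : ℕ => (1:ℝ) / (p ^ k).totient) 1).1 this
  have e : (1 - (p:ℝ)⁻¹)⁻¹ * (1 / (p - 1)) +
      ∑ k ∈ Finset.range 1, (1:ℝ) / (p ^ k).totient = 1 + p / ((p:ℝ) - 1) ^ 2 := by
    rw [Finset.sum_range_one, pow_zero, Nat.totient_one, Nat.cast_one]
    field_simp
    ring
  rwa [e] at h

theorem sum_coprimeRatio_div_le (n X : ℕ) :
    ∑ m ∈ Finset.Ioc 0 X, coprimeRatio n m / m ≤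
      Real.exp 1 * ∏ p ∈ Nat.primesLE X \ n.primeFactors, (1 - (1:ℝ) / p)⁻¹ := by
  set s := Nat.primesLE X \ n.primeFactors with hs
  have hsp : ∀ p ∈ s, p.Prime := fun p hp =>
    (Nat.mem_primesLE.1 (Finset.mem_sdiff.1 hp).1).2
  set f : ℕ → ℝ := fun m => 1 / m.totient with hf
  obtain ⟨hsum, hhas⟩ := EulerProduct.summable_and_hasSum_factoredNumbers_prod_filter_prime_tsum
    (f := f) (by simp [hf]) (fun h => by simp only [hf]; rw [Nat.totient_mul h]; push_cast; ring)
    (fun {p} hp => by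
      have := (hasSum_inv_totient_prime_pow hp).summable
      simpa [hf] using this) s
  have hprod : ∏ p ∈ s with p.Prime, ∑' k : ℕ, f (p ^ k) ≤
      Real.exp 1 * ∏ p ∈ s, (1 - (1:ℝ) / p)⁻¹ := by
    rw [Finset.filter_true_of_mem hsp]
    have h1 := sum_inv_mul_pred_le s fun p hp => (hsp p hp).two_le
    calc ∏ p ∈ s, ∑' k : ℕ, f (p ^ k)
        ≤ ∏ p ∈ s, Real.exp (1 / (p * (p - 1))) * (1 - (1:ℝ) / p)⁻¹ := by
          refine Finset.prod_le_prod (fun p _ => tsum_nonneg fun k => by positivity) fun p hp => ?_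
          have h2 : (2:ℝ) ≤ p := by exact_mod_cast (hsp p hp).two_le
          have hp1 : (p:ℝ) - 1 ≠ 0 := by linarith
          have hp0 : (p:ℝ) ≠ 0 := by linarith
          simp only [hf]
          rw [(hasSum_inv_totient_prime_pow (hsp p hp)).tsum_eq]
          have e : 1 + p / ((p:ℝ) - 1) ^ 2 = (1 / (p * (p - 1)) + 1) * (1 - (1:ℝ) / p)⁻¹ := by
            field_simp
            ring
          rw [e]
          refine mul_le_mul_of_nonneg_right (Real.add_one_le_exp _) ?_
          rw [inv_nonneg, sub_nonneg, div_le_one (by linarith)]; linarith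
      _ = Real.exp (∑ p ∈ s, (1:ℝ) / (p * (p - 1))) * ∏ p ∈ s, (1 - (1:ℝ) / p)⁻¹ := by
          rw [Finset.prod_mul_distrib, Real.exp_sum]
      _ ≤ _ := by
          refine mul_le_mul_of_nonneg_right (Real.exp_le_exp.2 h1) (Finset.prod_nonneg fun p hp => ?_)
          have h2 : (2:ℝ) ≤ p := by exact_mod_cast (hsp p hp).two_le
          rw [inv_nonneg, sub_nonneg, div_le_one (by linarith)]; linarith
  refine le_trans ?_ hprod
  have hhas' := (hasSum_subtype_iff_indicator (s := Nat.factoredNumbers s) (f := f)).1 hhas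
  refine le_trans ?_ (sum_le_hasSum (Finset.Ioc 0 X) (fun m _ =>
    Set.indicator_nonneg (fun m _ => by positivity) m) hhas')
  refine Finset.sum_le_sum fun m hm => ?_
  rw [Finset.mem_Ioc] at hm
  have hm0 : (0:ℝ) < m := by exact_mod_cast hm.1
  rw [coprimeRatio_apply]
  split_ifs with h
  · rw [Set.indicator_of_mem]
    · simp only [hf]
      rw [div_div, mul_comm, ← div_div, div_self hm0.ne']
    · refine Nat.mem_factoredNumbers_of_primeFactors_subset hm.1.ne' fun p hp => ?_
      rw [hs, Finset.mem_sdiff, Nat.mem_primesLE]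
      have hpp := Nat.prime_of_mem_primeFactors hp
      refine ⟨⟨(Nat.le_of_mem_primeFactors hp).trans hm.2, hpp⟩, fun hpn => ?_⟩
      exact Nat.Prime.not_coprime_iff_dvd.2 ⟨p, hpp, Nat.dvd_of_mem_primeFactors hp,
        Nat.dvd_of_mem_primeFactors hpn⟩ h
  · rw [zero_div]
    exact Set.indicator_nonneg (fun m _ => by positivity) m

/-- An upper-bound sieve for `h / φ(h)` summed over `h ≤ X` coprime to `n`. -/
theorem exists_sum_coprimeRatio_le : ∃ C : ℝ, 0 < C ∧ ∀ n X : ℕ, 1 ≤ X →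
    ∑ m ∈ Finset.Ioc 0 X, coprimeRatio n m ≤
      C * X * ∏ p ∈ n.primeFactors with p ≤ X, (1 - (1:ℝ) / p) := by
  obtain ⟨M, hM, hmert⟩ := exists_mertens
  set B := 1 + 2 * (Real.log 4 + 4) with hB
  have hB0 : 0 < B := by positivity
  refine ⟨1 + B * Real.exp 1 * M, by positivity, fun n X hX => ?_⟩
  have hpos : ∀ p : ℕ, p.Prime → 0 < 1 - (1:ℝ) / p := fun p hp => by
    have h2 : (2:ℝ) ≤ p := by exact_mod_cast hp.two_le
    rw [sub_pos, div_lt_one (by linarith)]; linarith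
  have hP : 0 ≤ ∏ p ∈ n.primeFactors with p ≤ X, (1 - (1:ℝ) / p) :=
    Finset.prod_nonneg fun p hp =>
      (hpos p (Nat.prime_of_mem_primeFactors (Finset.mem_filter.1 hp).1)).le
  rcases Nat.lt_or_ge X 2 with h | h
  · obtain rfl : X = 1 := by omega
    have h1 : n.primeFactors.filter (· ≤ 1) = ∅ := by
      rw [Finset.filter_eq_empty_iff]
      intro p hp
      have := (Nat.prime_of_mem_primeFactors hp).two_le
      omega
    rw [h1]
    have : (0:ℝ) ≤ B * Real.exp 1 * M := by positivity
    simp [coprimeRatio_apply]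
    linarith
  · have hl : 0 < Real.log X := Real.log_pos (by exact_mod_cast h)
    have hX0 : (0:ℝ) ≤ X := Nat.cast_nonneg X
    have e : ∏ p ∈ Nat.primesLE X \ n.primeFactors, (1 - (1:ℝ) / p)⁻¹ =
        (∏ p ∈ Nat.primesLE X, (1 - (1:ℝ) / p)⁻¹) *
          ∏ p ∈ n.primeFactors with p ≤ X, (1 - (1:ℝ) / p) := by
      have hi : Nat.primesLE X ∩ n.primeFactors = n.primeFactors.filter (· ≤ X) := by
        ext p
        simp only [Finset.mem_inter, Nat.mem_primesLE, Finset.mem_filter]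
        constructor
        · rintro ⟨⟨a, _⟩, c⟩; exact ⟨c, a⟩
        · rintro ⟨c, a⟩; exact ⟨⟨a, Nat.prime_of_mem_primeFactors c⟩, c⟩
      have hone : ∏ p ∈ n.primeFactors with p ≤ X, (1 - (1:ℝ) / p)⁻¹ * (1 - (1:ℝ) / p) = 1 :=
        Finset.prod_eq_one fun p hp => inv_mul_cancel₀
          (hpos p (Nat.prime_of_mem_primeFactors (Finset.mem_filter.1 hp).1)).ne'
      rw [← Finset.prod_inter_mul_prod_sdiff (Nat.primesLE X) n.primeFactors, hi,
        mul_right_comm, ← Finset.prod_mul_distrib, hone, one_mul]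
    have h1 := sum_coprimeRatio_mul_log_le n X
    have h2 := sum_coprimeRatio_div_le n X
    rw [e] at h2
    refine le_of_mul_le_mul_right ?_ hl
    set P := ∏ p ∈ n.primeFactors with p ≤ X, (1 - (1:ℝ) / p)
    calc _ ≤ B * X * ∑ m ∈ Finset.Ioc 0 X, coprimeRatio n m / m := h1
      _ ≤ B * X * (Real.exp 1 * ((M * Real.log X) * P)) := by
          refine mul_le_mul_of_nonneg_left (h2.trans ?_) (by positivity)
          exact mul_le_mul_of_nonneg_left (mul_le_mul_of_nonneg_right (hmert X h) hP) (by positivity)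
      _ = (B * Real.exp 1 * M) * X * P * Real.log X := by ring
      _ ≤ _ := by gcongr; linarith

theorem card_filter_residues_le (g : ℕ) (A : ℕ → Finset ℕ) :
    ((Finset.range g).filter fun t => ∀ p ∈ g.primeFactors, t % p ∈ A p).card ≤
      g / (∏ p ∈ g.primeFactors, p) * ∏ p ∈ g.primeFactors, (A p).card := by
  set r := ∏ p ∈ g.primeFactors, p with hr
  have hrpos : 0 < r := Finset.prod_pos fun p hp => (Nat.prime_of_mem_primeFactors hp).pos
  have hrg : r ∣ g := Nat.prod_primeFactors_dvd g
  rw [← Finset.card_pi, ← Finset.card_range (g / r), ← Finset.card_product]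
  refine Finset.card_le_card_of_injOn (fun t => (t / r, fun p _ => t % p)) ?_ ?_
  · intro t ht
    simp only [Finset.coe_filter, Finset.mem_range, Set.mem_ofPred_eq] at ht
    simp only [Finset.coe_product, Set.mem_prod, Finset.mem_coe, Finset.mem_range, Finset.mem_pi]
    exact ⟨Nat.div_lt_div_of_lt_of_dvd hrg ht.1, ht.2⟩
  · intro t _ u _ h
    simp only [Prod.mk.injEq] at h
    have hmod : t ≡ u [MOD r] := by
      refine (Nat.modEq_iff_dvd).2 ?_
      have : ∀ p ∈ g.primeFactors, (p:ℤ) ∣ (u:ℤ) - t := fun p hp =>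
        (Nat.modEq_iff_dvd).1 (congrFun (congrFun h.2 p) hp)
      rw [hr, Nat.cast_prod]
      exact Finset.prod_dvd_of_coprime (fun p hp q hq hpq => by
        exact ((Nat.coprime_primes (Nat.prime_of_mem_primeFactors hp)
          (Nat.prime_of_mem_primeFactors hq)).2 hpq).isCoprime) this
    rw [← Nat.div_add_mod t r, ← Nat.div_add_mod u r, h.1, hmod]

theorem exists_residue_dvd {p : ℕ} (hp : p.Prime) (a c : ℤ) (hc : ¬ (p:ℤ) ∣ c) :
    ∃ r ∈ Finset.range p, (p:ℤ) ∣ a + r * c := by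
  have := Fact.mk hp
  refine ⟨(-(a : ZMod p) * (c : ZMod p)⁻¹).val, Finset.mem_range.2 (ZMod.val_lt _), ?_⟩
  rw [← ZMod.intCast_zmod_eq_zero_iff_dvd]
  have hc' : (c : ZMod p) ≠ 0 := fun h => hc ((ZMod.intCast_zmod_eq_zero_iff_dvd _ _).1 h)
  push_cast
  rw [ZMod.natCast_zmod_val]
  field_simp
  ring

theorem card_avoid_le_pred {p : ℕ} (hp : p.Prime) (a c a' c' : ℤ)
    (h : ¬ (p:ℤ) ∣ c ∨ ¬ (p:ℤ) ∣ c') :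
    ((Finset.range p).filter fun r : ℕ => ¬ (p:ℤ) ∣ a + r * c ∧ ¬ (p:ℤ) ∣ a' + r * c').card ≤
      p - 1 := by
  obtain ⟨r, hr, h1⟩ : ∃ r ∈ Finset.range p, (p:ℤ) ∣ a + r * c ∨ (p:ℤ) ∣ a' + r * c' := by
    rcases h with h | h
    · obtain ⟨r, hr, h⟩ := exists_residue_dvd hp a c h
      exact ⟨r, hr, Or.inl h⟩
    · obtain ⟨r, hr, h⟩ := exists_residue_dvd hp a' c' h
      exact ⟨r, hr, Or.inr h⟩
  have h2 : ((Finset.range p).filter fun r : ℕ =>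
      ¬ (p:ℤ) ∣ a + r * c ∧ ¬ (p:ℤ) ∣ a' + r * c') ⊆ (Finset.range p).erase r := by
    intro s hs
    rw [Finset.mem_filter] at hs
    refine Finset.mem_erase.2 ⟨?_, hs.1⟩
    rintro rfl
    tauto
  refine (Finset.card_le_card h2).trans ?_
  rw [Finset.card_erase_of_mem hr, Finset.card_range]

theorem card_avoid_le_sub_two {p : ℕ} (hp : p.Prime) (a c a' c' : ℤ)
    (h : ¬ (p:ℤ) ∣ c) (h' : ¬ (p:ℤ) ∣ c') (hd : ¬ (p:ℤ) ∣ a * c' - a' * c) :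
    ((Finset.range p).filter fun r : ℕ => ¬ (p:ℤ) ∣ a + r * c ∧ ¬ (p:ℤ) ∣ a' + r * c').card ≤
      p - 2 := by
  obtain ⟨r, hr, h1⟩ := exists_residue_dvd hp a c h
  obtain ⟨r', hr', h1'⟩ := exists_residue_dvd hp a' c' h'
  have hne : r' ≠ r := by
    rintro rfl
    apply hd
    have := dvd_sub (h1.mul_right c') (h1'.mul_right c)
    have e : (a + r' * c) * c' - (a' + r' * c') * c = a * c' - a' * c := by ring
    rwa [e] at this
  have h2 : ((Finset.range p).filter fun r : ℕ =>
      ¬ (p:ℤ) ∣ a + r * c ∧ ¬ (p:ℤ) ∣ a' + r * c') ⊆ ((Finset.range p).erase r).erase r' := by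
    intro s hs
    rw [Finset.mem_filter] at hs
    refine Finset.mem_erase.2 ⟨?_, Finset.mem_erase.2 ⟨?_, hs.1⟩⟩
    · rintro rfl; tauto
    · rintro rfl; tauto
  refine (Finset.card_le_card h2).trans ?_
  rw [Finset.card_erase_of_mem (Finset.mem_erase.2 ⟨hne, hr'⟩), Finset.card_erase_of_mem hr,
    Finset.card_range]
  omega

theorem totient_eq_prod_real (n : ℕ) :
    (n.totient : ℝ) = n * ∏ p ∈ n.primeFactors, (1 - (1:ℝ) / p) := by
  have := congrArg (fun q : ℚ => (q:ℝ)) (Nat.totient_eq_mul_prod_factors n)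
  push_cast at this
  simpa only [one_div] using this

/-- Reduced pairs of numerators whose fractions differ by `h / lcm`, modulo one. -/
def fractionPairs (g v' w' : ℕ) (h : ℤ) : Finset (ℕ × ℕ) :=
  ((Finset.range (g * v')) ×ˢ (Finset.range (g * w'))).filter fun x =>
    x.1.Coprime (g * v') ∧ x.2.Coprime (g * w') ∧
      ((g * (v' * w') : ℕ) : ℤ) ∣ (x.1 * w' - x.2 * v' : ℤ) - h

theorem not_int_dvd_of_coprime {p b v : ℕ} (hp : p.Prime) (hb : b.Coprime v) (h : p ∣ v) :
    ¬ (p:ℤ) ∣ (b:ℤ) := fun h' => by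
  rw [Int.natCast_dvd_natCast] at h'
  exact Nat.Prime.not_coprime_iff_dvd.2 ⟨p, hp, h', h⟩ hb

theorem coprime_of_fractionPairs_nonempty {g v' w' : ℕ} {h : ℤ} (hco : v'.Coprime w')
    (hne : (fractionPairs g v' w' h).Nonempty) : h.natAbs.Coprime (v' * w') := by
  obtain ⟨x, hx⟩ := hne
  rw [fractionPairs, Finset.mem_filter] at hx
  obtain ⟨_, hx1, hx2, hd⟩ := hx
  by_contra hcon
  obtain ⟨p, hp, hph, hpn⟩ := Nat.Prime.not_coprime_iff_dvd.1 hcon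
  have hpi := Nat.prime_iff_prime_int.1 hp
  have hph' : (p:ℤ) ∣ h := Int.natCast_dvd.2 hph
  have hpd : (p:ℤ) ∣ (x.1 * w' - x.2 * v' : ℤ) := by
    have h1 : (p:ℤ) ∣ (x.1 * w' - x.2 * v' : ℤ) - h :=
      (Int.natCast_dvd_natCast.2 (hpn.mul_left g)).trans hd
    exact (dvd_sub_left hph').1 h1
  rcases (Nat.Prime.dvd_mul hp).1 hpn with hv | hw
  · have hw : ¬ p ∣ w' := fun hw => Nat.Prime.not_coprime_iff_dvd.2 ⟨p, hp, hv, hw⟩ hco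
    have h2 : (p:ℤ) ∣ (x.1 * w' : ℤ) := by
      have : (p:ℤ) ∣ (x.2 * v' : ℤ) := (Int.natCast_dvd_natCast.2 hv).mul_left _
      exact (dvd_sub_left this).1 hpd
    rcases hpi.dvd_mul.1 h2 with h3 | h3
    · exact not_int_dvd_of_coprime hp hx1 (hv.mul_left g) h3
    · exact hw (Int.natCast_dvd_natCast.1 h3)
  · have hv : ¬ p ∣ v' := fun hv => Nat.Prime.not_coprime_iff_dvd.2 ⟨p, hp, hv, hw⟩ hco
    have h2 : (p:ℤ) ∣ (x.2 * v' : ℤ) := by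
      have : (p:ℤ) ∣ (x.1 * w' : ℤ) := (Int.natCast_dvd_natCast.2 hw).mul_left _
      exact (dvd_sub_right this).1 hpd
    rcases hpi.dvd_mul.1 h2 with h3 | h3
    · exact not_int_dvd_of_coprime hp hx2 (hw.mul_left g) h3
    · exact hv (Int.natCast_dvd_natCast.1 h3)

theorem fractionPairs_diff {g v' w' : ℕ} {h : ℤ} (hv : 0 < v')
    (hco : v'.Coprime w') {x y : ℕ × ℕ} (hx : x ∈ fractionPairs g v' w' h)
    (hy : y ∈ fractionPairs g v' w' h) :
    ∃ s : ℤ, (x.1:ℤ) = y.1 + s * v' ∧ ((g * w' : ℕ):ℤ) ∣ x.2 - (y.2 + s * w') := by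
  rw [fractionPairs, Finset.mem_filter] at hx hy
  obtain ⟨k, hk⟩ := dvd_sub hx.2.2.2 hy.2.2.2
  have e : ((x.1:ℤ) - y.1) * w' = v' * ((x.2 - y.2) + g * w' * k) := by
    push_cast at hk
    linear_combination hk
  have h1 : (v':ℤ) ∣ (x.1:ℤ) - y.1 := by
    have : IsCoprime (v':ℤ) (w':ℤ) := hco.isCoprime
    exact this.dvd_of_dvd_mul_right ⟨_, e⟩
  obtain ⟨s, hs⟩ := h1
  refine ⟨s, by linarith, -k, ?_⟩
  have hv0 : (v':ℤ) ≠ 0 := by exact_mod_cast hv.ne'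
  refine mul_left_cancel₀ hv0 ?_
  rw [hs] at e
  push_cast
  linear_combination -e

theorem eq_of_dvd_sub_of_lt {a b m : ℕ} (ha : a < m) (hb : b < m) (h : (m:ℤ) ∣ (a:ℤ) - b) :
    a = b := by
  have := (Nat.modEq_iff_dvd.2 h : b ≡ a [MOD m])
  rw [Nat.ModEq, Nat.mod_eq_of_lt ha, Nat.mod_eq_of_lt hb] at this
  exact this.symm

theorem card_fractionPairs_le {g v' w' : ℕ} {h : ℤ} (hg : 0 < g) (hv : 0 < v')
    (hco : v'.Coprime w') :
    ((fractionPairs g v' w' h).card : ℝ) ≤ g.totient *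
      ∏ p ∈ g.primeFactors with ¬ p ∣ (v' * w') * h.natAbs, (1 - (1:ℝ) / p) := by
  have hpr : ∀ p ∈ g.primeFactors, 2 ≤ (p:ℝ) := fun p hp => by
    exact_mod_cast (Nat.prime_of_mem_primeFactors hp).two_le
  rcases Finset.eq_empty_or_nonempty (fractionPairs g v' w' h) with h0 | ⟨y, hy⟩
  · rw [h0, Finset.card_empty, Nat.cast_zero]
    refine mul_nonneg (Nat.cast_nonneg _) (Finset.prod_nonneg fun p hp => ?_)
    have := hpr p (Finset.mem_filter.1 hp).1
    rw [sub_nonneg, div_le_one (by linarith)]; linarith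
  set A : ℕ → Finset ℕ := fun p => (Finset.range p).filter fun r : ℕ =>
    ¬ (p:ℤ) ∣ (y.1:ℤ) + r * v' ∧ ¬ (p:ℤ) ∣ (y.2:ℤ) + r * w' with hA
  have hgi : (0:ℤ) < g := by exact_mod_cast hg
  have hcard : (fractionPairs g v' w' h).card ≤
      ((Finset.range g).filter fun t => ∀ p ∈ g.primeFactors, t % p ∈ A p).card := by
    have hch : ∀ x ∈ fractionPairs g v' w' h, ∃ s : ℤ, (x.1:ℤ) = y.1 + s * v' ∧
        ((g * w' : ℕ):ℤ) ∣ x.2 - (y.2 + s * w') := fun x hx => fractionPairs_diff hv hco hx hy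
    choose! s hs1 hs2 using hch
    refine Finset.card_le_card_of_injOn (fun x => (s x % g).toNat) ?_ ?_
    · intro x hx
      have hx' := hx
      rw [Finset.mem_coe] at hx
      rw [fractionPairs, Finset.mem_coe, Finset.mem_filter] at hx'
      obtain ⟨_, hx1, hx2, _⟩ := hx'
      have hnn := Int.emod_nonneg (s x) hgi.ne'
      have hlt := Int.emod_lt_of_pos (s x) hgi
      simp only [Finset.coe_filter, Finset.mem_range, Set.mem_ofPred_eq]
      refine ⟨by omega, fun p hp => ?_⟩
      have hpp := Nat.prime_of_mem_primeFactors hp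
      have hpg := Nat.dvd_of_mem_primeFactors hp
      have hpgi : (p:ℤ) ∣ g := Int.natCast_dvd_natCast.2 hpg
      have hr : (p:ℤ) ∣ (((s x % g).toNat % p : ℕ) : ℤ) - s x := by
        push_cast
        rw [Int.toNat_of_nonneg hnn]
        have h1 : (p:ℤ) ∣ s x % g % p - s x % g := by
          rw [← Int.neg_sub, dvd_neg]; exact Int.dvd_self_sub_emod
        have h2 : (p:ℤ) ∣ s x % g - s x := by
          rw [← Int.neg_sub, dvd_neg]; exact hpgi.trans Int.dvd_self_sub_emod
        have := dvd_add h1 h2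
        simpa using this
      obtain ⟨k, hk⟩ := hr
      rw [hA]
      simp only [Finset.mem_filter, Finset.mem_range]
      refine ⟨Nat.mod_lt _ hpp.pos, fun hd => ?_, fun hd => ?_⟩
      · refine not_int_dvd_of_coprime hpp hx1 (hpg.mul_right v') ?_
        rw [hs1 x hx]
        have : (y.1:ℤ) + s x * v' = (y.1 + (((s x % g).toNat % p : ℕ) : ℤ) * v') -
          p * (k * v') := by linear_combination (-(v':ℤ)) * hk
        rw [this]
        exact dvd_sub hd (dvd_mul_right _ _)
      · refine not_int_dvd_of_coprime hpp hx2 (hpg.mul_right w') ?_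
        obtain ⟨l, hl⟩ := (Int.natCast_dvd_natCast.2 (hpg.mul_right w')).trans (hs2 x hx)
        have : (x.2:ℤ) = (y.2 + (((s x % g).toNat % p : ℕ) : ℤ) * w') +
          p * (l - k * w') := by linear_combination (-(w':ℤ)) * hk + hl
        rw [this]
        exact dvd_add hd (dvd_mul_right _ _)
    · intro x hx z hz hxz
      rw [Finset.mem_coe] at hx hz
      have hx' := hx
      have hz' := hz
      rw [fractionPairs, Finset.mem_filter, Finset.mem_product, Finset.mem_range,
        Finset.mem_range] at hx' hz'
      have hmod : s x % g = s z % g := by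
        have h1 := Int.emod_nonneg (s x) hgi.ne'
        have h2 := Int.emod_nonneg (s z) hgi.ne'
        simp only at hxz
        omega
      obtain ⟨k, hk⟩ := Int.ModEq.dvd (hmod.symm : s z ≡ s x [ZMOD g])
      obtain ⟨l, hl⟩ := hs2 x hx
      obtain ⟨l', hl'⟩ := hs2 z hz
      refine Prod.ext ?_ ?_
      · refine eq_of_dvd_sub_of_lt hx'.1.1 hz'.1.1 ⟨k, ?_⟩
        rw [hs1 x hx, hs1 z hz]
        push_cast
        linear_combination (v':ℤ) * hk
      · refine eq_of_dvd_sub_of_lt hx'.1.2 hz'.1.2 ⟨k + l - l', ?_⟩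
        push_cast at hl hl' ⊢
        linear_combination (w':ℤ) * hk + hl - hl'
  have hAle : ∀ p ∈ g.primeFactors, ((A p).card : ℝ) ≤ p * ((1 - (1:ℝ) / p) *
      if ¬ p ∣ (v' * w') * h.natAbs then 1 - (1:ℝ) / p else 1) := by
    intro p hp
    have hpp := Nat.prime_of_mem_primeFactors hp
    have h2 := hpr p hp
    have hp0 : (p:ℝ) ≠ 0 := by linarith
    rw [fractionPairs, Finset.mem_filter] at hy
    by_cases hpn : ¬ p ∣ (v' * w') * h.natAbs
    · rw [if_pos hpn]
      have hv1 : ¬ (p:ℤ) ∣ v' := fun hd => hpn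
        (((Int.natCast_dvd_natCast.1 hd).mul_right w').mul_right _)
      have hw1 : ¬ (p:ℤ) ∣ w' := fun hd => hpn
        (((Int.natCast_dvd_natCast.1 hd).mul_left v').mul_right _)
      have hd1 : ¬ (p:ℤ) ∣ (y.1:ℤ) * w' - y.2 * v' := fun hd => by
        have hpg : (p:ℤ) ∣ (g * (v' * w') : ℕ) :=
          Int.natCast_dvd_natCast.2 ((Nat.dvd_of_mem_primeFactors hp).mul_right _)
        have := (dvd_sub_right hd).1 (hpg.trans hy.2.2.2)
        exact hpn ((Int.natCast_dvd.1 this).mul_left _)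
      have := card_avoid_le_sub_two hpp _ _ _ _ hv1 hw1 hd1
      have h3 : ((A p).card : ℝ) ≤ p - 2 := by
        have : (A p).card + 2 ≤ p := by
          have := hpp.two_le
          simp only [hA]
          omega
        have : (((A p).card + 2 : ℕ) : ℝ) ≤ p := by exact_mod_cast this
        push_cast at this
        linarith
      refine h3.trans ?_
      have e : (p:ℝ) * ((1 - (1:ℝ) / p) * (1 - (1:ℝ) / p)) = p - 2 + 1 / p := by
        field_simp
        ring
      rw [e]
      have : 0 ≤ (1:ℝ) / p := by positivity
      linarith
    · rw [if_neg hpn]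
      have hor : ¬ (p:ℤ) ∣ v' ∨ ¬ (p:ℤ) ∣ w' := by
        by_contra hcon
        push Not at hcon
        exact Nat.Prime.not_coprime_iff_dvd.2 ⟨p, hpp, Int.natCast_dvd_natCast.1 hcon.1,
          Int.natCast_dvd_natCast.1 hcon.2⟩ hco
      have := card_avoid_le_pred hpp (y.1:ℤ) v' (y.2:ℤ) w' hor
      have h3 : ((A p).card : ℝ) ≤ p - 1 := by
        have : (A p).card + 1 ≤ p := by
          have := hpp.two_le
          simp only [hA]
          omega
        have : (((A p).card + 1 : ℕ) : ℝ) ≤ p := by exact_mod_cast this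
        push_cast at this
        linarith
      refine h3.trans (le_of_eq ?_)
      field_simp
  have hr1 : ((∏ p ∈ g.primeFactors, p : ℕ) : ℝ) ≠ 0 := by
    rw [Nat.cast_prod]
    exact Finset.prod_ne_zero_iff.2 fun p hp => by have := hpr p hp; linarith
  have hfin := hcard.trans (card_filter_residues_le g A)
  have hrg : ∏ p ∈ g.primeFactors, p ∣ g := Nat.prod_primeFactors_dvd g
  have hr0 : (∏ p ∈ g.primeFactors, (p:ℝ)) ≠ 0 :=
    Finset.prod_ne_zero_iff.2 fun p hp => by have := hpr p hp; linarith
  calc ((fractionPairs g v' w' h).card : ℝ)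
      ≤ ((g / (∏ p ∈ g.primeFactors, p) * ∏ p ∈ g.primeFactors, (A p).card : ℕ) : ℝ) := by
        exact_mod_cast hfin
    _ = (g:ℝ) / (∏ p ∈ g.primeFactors, (p:ℝ)) * ∏ p ∈ g.primeFactors, ((A p).card : ℝ) := by
        rw [Nat.cast_mul, Nat.cast_div hrg hr1, Nat.cast_prod, Nat.cast_prod]
    _ ≤ (g:ℝ) / (∏ p ∈ g.primeFactors, (p:ℝ)) * ∏ p ∈ g.primeFactors, (p * ((1 - (1:ℝ) / p) *
          if ¬ p ∣ (v' * w') * h.natAbs then 1 - (1:ℝ) / p else 1)) := by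
        refine mul_le_mul_of_nonneg_left (Finset.prod_le_prod (fun p _ => Nat.cast_nonneg _) hAle) ?_
        exact div_nonneg (Nat.cast_nonneg _) (Finset.prod_nonneg fun p _ => Nat.cast_nonneg _)
    _ = _ := by
        rw [Finset.prod_mul_distrib, Finset.prod_mul_distrib, totient_eq_prod_real g,
          Finset.prod_filter]
        field_simp

theorem one_sub_inv_pos {p : ℕ} (hp : p.Prime) : 0 < 1 - (1:ℝ) / p := by
  have h2 : (2:ℝ) ≤ p := by exact_mod_cast hp.two_le
  rw [sub_pos, div_lt_one (by linarith)]; linarith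

theorem one_sub_inv_le (p : ℕ) : 1 - (1:ℝ) / p ≤ 1 := by
  have : 0 ≤ (1:ℝ) / p := by positivity
  linarith

theorem card_fractionPairs_le_coprimeRatio {g v' w' : ℕ} {h : ℤ} (hg : 0 < g) (hv : 0 < v')
    (hco : v'.Coprime w') (hh : h ≠ 0) :
    ((fractionPairs g v' w' h).card : ℝ) ≤ g.totient *
      (∏ p ∈ g.primeFactors \ (v' * w').primeFactors, (1 - (1:ℝ) / p)) *
        coprimeRatio (v' * w') h.natAbs := by
  have hpos : ∀ p ∈ g.primeFactors, 0 < 1 - (1:ℝ) / p := fun p hp =>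
    one_sub_inv_pos (Nat.prime_of_mem_primeFactors hp)
  have hnn : 0 ≤ (g.totient : ℝ) *
      (∏ p ∈ g.primeFactors \ (v' * w').primeFactors, (1 - (1:ℝ) / p)) :=
    mul_nonneg (Nat.cast_nonneg _) (Finset.prod_nonneg fun p hp =>
      (hpos p (Finset.mem_sdiff.1 hp).1).le)
  rcases Finset.eq_empty_or_nonempty (fractionPairs g v' w' h) with h0 | hne
  · rw [h0, Finset.card_empty, Nat.cast_zero]
    exact mul_nonneg hnn (coprimeRatio_nonneg _ _)
  have hc := coprime_of_fractionPairs_nonempty hco hne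
  refine (card_fractionPairs_le hg hv hco).trans ?_
  rw [mul_assoc (g.totient : ℝ)]
  refine mul_le_mul_of_nonneg_left ?_ (Nat.cast_nonneg (α := ℝ) g.totient)
  rw [coprimeRatio_apply, if_pos hc, totient_eq_prod_real h.natAbs]
  have hk : 0 < h.natAbs := Int.natAbs_pos.2 hh
  have hk0 : (0:ℝ) < h.natAbs := by exact_mod_cast hk
  have hP : 0 < ∏ p ∈ h.natAbs.primeFactors, (1 - (1:ℝ) / p) :=
    Finset.prod_pos fun p hp => one_sub_inv_pos (Nat.prime_of_mem_primeFactors hp)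
  rw [div_mul_cancel_left₀ hk0.ne', ← div_eq_mul_inv, le_div_iff₀ hP]
  set s := g.primeFactors \ (v' * w').primeFactors
  have h1 : ∏ p ∈ h.natAbs.primeFactors, (1 - (1:ℝ) / p) ≤
      ∏ p ∈ s with p ∣ h.natAbs, (1 - (1:ℝ) / p) := by
    refine Finset.prod_le_prod_of_subset_of_le_one ?_ (fun p hp => ?_) fun p _ _ =>
      one_sub_inv_le p
    · intro p hp
      obtain ⟨hp, hpd⟩ := Finset.mem_filter.1 hp
      exact Nat.mem_primeFactors.2
        ⟨Nat.prime_of_mem_primeFactors (Finset.mem_sdiff.1 hp).1, hpd, hk.ne'⟩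
    · exact (one_sub_inv_pos (Nat.prime_of_mem_primeFactors hp)).le
  have h2 : (g.primeFactors.filter fun p => ¬ p ∣ (v' * w') * h.natAbs) ⊆
      s.filter fun p => ¬ p ∣ h.natAbs := by
    intro p hp
    obtain ⟨hp, hpd⟩ := Finset.mem_filter.1 hp
    refine Finset.mem_filter.2 ⟨Finset.mem_sdiff.2 ⟨hp, fun hpn => hpd ?_⟩,
      fun hd => hpd (hd.mul_left _)⟩
    exact (Nat.dvd_of_mem_primeFactors hpn).mul_right _
  have h3 : (g.primeFactors.filter fun p => ¬ p ∣ (v' * w') * h.natAbs) =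
      s.filter fun p => ¬ p ∣ h.natAbs := by
    refine Finset.Subset.antisymm h2 fun p hp => ?_
    obtain ⟨hp, hpd⟩ := Finset.mem_filter.1 hp
    obtain ⟨hp, hpn⟩ := Finset.mem_sdiff.1 hp
    have hpp := Nat.prime_of_mem_primeFactors hp
    refine Finset.mem_filter.2 ⟨hp, fun hd => ?_⟩
    rcases hpp.dvd_mul.1 hd with h | h
    · refine hpn (Nat.mem_primeFactors.2 ⟨hpp, h, fun h0 => ?_⟩)
      rw [h0, Nat.coprime_zero_right] at hc
      rw [hc, Nat.primeFactors_one, Finset.prod_empty] at *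
      have hw : w' = 0 := by
        rcases Nat.mul_eq_zero.1 h0 with h | h
        · omega
        · exact h
      obtain ⟨x, hx⟩ := hne
      simp [fractionPairs, hw] at hx
    · exact hpd h
  rw [h3]
  rw [← Finset.prod_filter_mul_prod_filter_not s (fun p => p ∣ h.natAbs), mul_comm]
  refine mul_le_mul_of_nonneg_right h1 (Finset.prod_nonneg fun p hp => ?_)
  exact (hpos p (Finset.mem_sdiff.1 (Finset.mem_filter.1 hp).1).1).le

theorem totient_mul_totient_eq {g v' w' : ℕ} (hg : 0 < g) (hv : 0 < v') (hw : 0 < w')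
    (hco : v'.Coprime w') :
    ((g * v').totient : ℝ) * (g * w').totient = (g * (v' * w') : ℕ) * (g.totient *
      (∏ p ∈ g.primeFactors \ (v' * w').primeFactors, (1 - (1:ℝ) / p)) *
      ∏ p ∈ (v' * w').primeFactors, (1 - (1:ℝ) / p)) := by
  rw [totient_eq_prod_real (g * v'), totient_eq_prod_real (g * w'), totient_eq_prod_real g,
    Nat.primeFactors_mul hg.ne' hv.ne', Nat.primeFactors_mul hg.ne' hw.ne',
    Nat.primeFactors_mul hv.ne' hw.ne']
  set G := g.primeFactors
  set V := v'.primeFactors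
  set W := w'.primeFactors
  have hd : Disjoint V W := hco.disjoint_primeFactors
  have e := Finset.prod_union_inter (s₁ := G ∪ V) (s₂ := G ∪ W) (f := fun p : ℕ => 1 - (1:ℝ) / p)
  have hi : (G ∪ V) ∩ (G ∪ W) = G := by
    rw [← Finset.union_inter_distrib_left, Finset.disjoint_iff_inter_eq_empty.1 hd,
      Finset.union_empty]
  have hu : (G ∪ V) ∪ (G ∪ W) = (G \ (V ∪ W)) ∪ (V ∪ W) := by
    rw [Finset.sdiff_union_self_eq_union, ← Finset.union_union_distrib_left]
  rw [hi, hu, Finset.prod_union Finset.sdiff_disjoint] at e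
  push_cast
  linear_combination (-(g:ℝ) * v' * g * w') * e

theorem exists_sum_card_fractionPairs_le : ∃ C : ℝ, 0 < C ∧ ∀ g v' w' : ℕ, 0 < g → 0 < v' →
    0 < w' → v'.Coprime w' → ∀ X : ℕ, (∑ k ∈ Finset.Ioc 0 X,
      ((fractionPairs g v' w' k).card + (fractionPairs g v' w' (-k)).card : ℝ)) *
        (g * (v' * w') : ℕ) ≤ C * X * ((g * v').totient * (g * w').totient) *
        ∏ p ∈ (v' * w').primeFactors with X < p, (1 - (1:ℝ) / p)⁻¹ := by
  obtain ⟨C, hC, h⟩ := exists_sum_coprimeRatio_le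
  refine ⟨2 * C, by positivity, fun g v' w' hg hv hw hco X => ?_⟩
  rcases Nat.eq_zero_or_pos X with rfl | hX
  · simp
  set n := v' * w' with hn
  set G := (g.totient : ℝ) * (∏ p ∈ g.primeFactors \ n.primeFactors, (1 - (1:ℝ) / p)) with hG
  have hG0 : 0 ≤ G := mul_nonneg (Nat.cast_nonneg _) (Finset.prod_nonneg fun p hp =>
      (one_sub_inv_pos (Nat.prime_of_mem_primeFactors (Finset.mem_sdiff.1 hp).1)).le)
  have h1 : ∑ k ∈ Finset.Ioc 0 X,
      ((fractionPairs g v' w' k).card + (fractionPairs g v' w' (-k)).card : ℝ) ≤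
      2 * G * ∑ k ∈ Finset.Ioc 0 X, coprimeRatio n k := by
    rw [Finset.mul_sum]
    refine Finset.sum_le_sum fun k hk => ?_
    have hk0 : (k:ℤ) ≠ 0 := by exact_mod_cast (Finset.mem_Ioc.1 hk).1.ne'
    have a := card_fractionPairs_le_coprimeRatio hg hv hco hk0
    have b := card_fractionPairs_le_coprimeRatio hg hv hco (neg_ne_zero.2 hk0)
    rw [Int.natAbs_neg] at b
    rw [Int.natAbs_natCast] at a b
    linarith
  have h2 := h n X hX
  have e : ∏ p ∈ n.primeFactors with p ≤ X, (1 - (1:ℝ) / p) =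
      (∏ p ∈ n.primeFactors, (1 - (1:ℝ) / p)) *
        ∏ p ∈ n.primeFactors with X < p, (1 - (1:ℝ) / p)⁻¹ := by
    rw [← Finset.prod_filter_mul_prod_filter_not n.primeFactors (fun p => p ≤ X)]
    simp only [not_le]
    rw [mul_assoc, ← Finset.prod_mul_distrib, Finset.prod_congr rfl fun p hp =>
      mul_inv_cancel₀ (one_sub_inv_pos (Nat.prime_of_mem_primeFactors
        (Finset.mem_filter.1 hp).1)).ne', Finset.prod_const_one, mul_one]
  rw [totient_mul_totient_eq hg hv hw hco, ← hn, ← hG]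
  rw [e] at h2
  have h3 : (∑ k ∈ Finset.Ioc 0 X,
      ((fractionPairs g v' w' k).card + (fractionPairs g v' w' (-k)).card : ℝ)) ≤ 2 * G * _ :=
    h1.trans (mul_le_mul_of_nonneg_left h2 (by positivity))
  refine (mul_le_mul_of_nonneg_right h3 (Nat.cast_nonneg _)).trans (le_of_eq ?_)
  ring

/-- Points of exact order `q` on the circle. -/
noncomputable def orderPoints (q : ℕ) : Finset UnitAddCircle :=
  ((Finset.range q).filter fun b => b.Coprime q).image fun b : ℕ => (((b:ℝ) / q : ℝ) : UnitAddCircle)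

theorem mem_orderPoints {q : ℕ} (hq : 0 < q) (y : UnitAddCircle) :
    y ∈ orderPoints q ↔ addOrderOf y = q := by
  rw [AddCircle.addOrderOf_eq_pos_iff hq, orderPoints]
  simp only [Finset.mem_image, Finset.mem_filter, Finset.mem_range, mul_one]
  constructor
  · rintro ⟨b, ⟨h1, h2⟩, h3⟩; exact ⟨b, h1, h2, h3⟩
  · rintro ⟨b, h1, h2, h3⟩; exact ⟨b, ⟨h1, h2⟩, h3⟩

theorem card_orderPoints {q : ℕ} (hq : 0 < q) : (orderPoints q).card = q.totient := by
  rw [← Set.ncard_coe_finset]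
  have : ((orderPoints q : Finset UnitAddCircle) : Set UnitAddCircle) =
      {y | addOrderOf y = q} := by
    ext y; rw [Finset.mem_coe, mem_orderPoints hq]; rfl
  rw [this]
  rw [← Nat.card_coe_set_eq]
  exact AddCircle.card_addOrderOf_eq_totient (p := (1:ℝ))

theorem card_close_le_sum (g v' w' : ℕ) (hg : 0 < g) (hv : 0 < v') (hw : 0 < w') (Δ : ℝ) :
    ((((orderPoints (g * v')) ×ˢ (orderPoints (g * w'))).filter fun x : UnitAddCircle × UnitAddCircle =>
      x.1 ≠ x.2 ∧ ‖x.1 - x.2‖ < Δ).card : ℝ) ≤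
    ∑ k ∈ Finset.Ioc 0 ⌊Δ * (g * (v' * w') : ℕ)⌋₊,
      ((fractionPairs g v' w' k).card + (fractionPairs g v' w' (-k)).card : ℝ) := by
  set X := ⌊Δ * (g * (v' * w') : ℕ)⌋₊ with hX
  set U := (Finset.Ioc 0 X).biUnion fun k : ℕ =>
    fractionPairs g v' w' k ∪ fractionPairs g v' w' (-k) with hU
  have hsub : (((orderPoints (g * v')) ×ˢ (orderPoints (g * w'))).filter
      fun x : UnitAddCircle × UnitAddCircle => x.1 ≠ x.2 ∧ ‖x.1 - x.2‖ < Δ) ⊆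
      U.image fun b => ((((b.1:ℝ) / (g * v' : ℕ) : ℝ) : UnitAddCircle),
        (((b.2:ℝ) / (g * w' : ℕ) : ℝ) : UnitAddCircle)) := by
    rintro ⟨y, y'⟩ hy
    simp only [Finset.mem_filter, Finset.mem_product, orderPoints, Finset.mem_image,
      Finset.mem_range] at hy
    obtain ⟨⟨⟨b, ⟨hb1, hb2⟩, rfl⟩, ⟨b', ⟨hb1', hb2'⟩, rfl⟩⟩, hne, hlt⟩ := hy
    refine Finset.mem_image.2 ⟨(b, b'), ?_, rfl⟩
    rw [← AddCircle.coe_sub, UnitAddCircle.norm_eq] at hlt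
    set x : ℝ := (b:ℝ) / (g * v' : ℕ) - (b':ℝ) / (g * w' : ℕ) with hx
    have hg0 : (0:ℝ) < g := by exact_mod_cast hg
    have hv0 : (0:ℝ) < v' := by exact_mod_cast hv
    have hw0 : (0:ℝ) < w' := by exact_mod_cast hw
    set h : ℤ := b * w' - b' * v' - round x * (g * (v' * w') : ℕ) with hh
    have hxL : x * (g * (v' * w') : ℕ) = b * w' - b' * v' := by
      rw [hx]; push_cast; field_simp
    have hhr : (h:ℝ) = (x - round x) * (g * (v' * w') : ℕ) := by
      rw [sub_mul, hxL, hh]; push_cast; ring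
    have hL0 : (0:ℝ) < (g * (v' * w') : ℕ) := by exact_mod_cast (by positivity)
    have hmem : (b, b') ∈ fractionPairs g v' w' h := by
      rw [fractionPairs, Finset.mem_filter, Finset.mem_product, Finset.mem_range, Finset.mem_range]
      refine ⟨⟨hb1, hb1'⟩, hb2, hb2', round x, ?_⟩
      rw [hh]; ring
    have hne0 : h ≠ 0 := by
      intro h0
      rw [h0, Int.cast_zero, eq_comm, mul_eq_zero, or_iff_left hL0.ne'] at hhr
      apply hne
      rw [← sub_eq_zero, ← AddCircle.coe_sub, ← hx]
      have : x = (round x : ℤ) := by linarith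
      rw [this]
      have := AddCircle.coe_period (1:ℝ)
      rw [← zsmul_one, AddCircle.coe_zsmul, this, smul_zero]
    have habs : (h.natAbs : ℝ) < Δ * (g * (v' * w') : ℕ) := by
      rw [Nat.cast_natAbs, Int.cast_abs, hhr, abs_mul, abs_of_pos hL0]
      exact mul_lt_mul_of_pos_right hlt hL0
    refine Finset.mem_biUnion.2 ⟨h.natAbs, Finset.mem_Ioc.2 ⟨Int.natAbs_pos.2 hne0,
      Nat.le_floor habs.le⟩, Finset.mem_union.2 ?_⟩
    rcases Int.natAbs_eq h with h1 | h1
    · left; rwa [← h1]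
    · right
      have : -(h.natAbs : ℤ) = h := h1.symm
      rwa [this]
  have hc := (Finset.card_le_card hsub).trans (Finset.card_image_le.trans Finset.card_biUnion_le)
  calc _ ≤ ((∑ k ∈ Finset.Ioc 0 X,
        (fractionPairs g v' w' k ∪ fractionPairs g v' w' (-k)).card : ℕ) : ℝ) := by
        exact_mod_cast hc
    _ ≤ _ := by
        rw [Nat.cast_sum]
        refine Finset.sum_le_sum fun k _ => ?_
        exact_mod_cast Finset.card_union_le _ _

/-- The loss from large primes at which the valuations of `v` and `w` differ. -/
noncomputable def overlapLoss (v w : ℕ) (Δ : ℝ) : ℝ :=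
  if Δ * v.lcm w < 1 then 0 else
    ∏ p ∈ (v.lcm w).primeFactors with v.factorization p ≠ w.factorization p ∧ Δ * v.lcm w < p,
      (1 - (1:ℝ) / p)⁻¹

/-- Number of pairs of distinct close points of prescribed orders on the circle. -/
theorem exists_card_close_le : ∃ C : ℝ, 0 < C ∧ ∀ v w : ℕ, 0 < v → 0 < w → ∀ Δ : ℝ, 0 ≤ Δ →
    ((((orderPoints v) ×ˢ (orderPoints w)).filter fun x : UnitAddCircle × UnitAddCircle =>
      x.1 ≠ x.2 ∧ ‖x.1 - x.2‖ < Δ).card : ℝ) ≤ C * Δ * (v.totient * w.totient) *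
      overlapLoss v w Δ := by
  obtain ⟨C, hC, h⟩ := exists_sum_card_fractionPairs_le
  refine ⟨C, hC, fun v w hv hw Δ hΔ => ?_⟩
  obtain ⟨v', w', hco, hv', hw'⟩ := Nat.exists_coprime v w
  set g := v.gcd w with hgdef
  have hg : 0 < g := Nat.gcd_pos_of_pos_left _ hv
  rw [mul_comm] at hv' hw'
  have hv0 : 0 < v' := Nat.pos_of_ne_zero fun h0 => by rw [h0] at hv'; omega
  have hw0 : 0 < w' := Nat.pos_of_ne_zero fun h0 => by rw [h0] at hw'; omega
  have hl : v.lcm w = g * (v' * w') := by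
    have : g * v.lcm w = v * w := Nat.gcd_mul_lcm v w
    refine Nat.eq_of_mul_eq_mul_left hg ?_
    rw [this]
    conv_lhs => rw [hv', hw']
    ring
  have h1 := card_close_le_sum g v' w' hg hv0 hw0 Δ
  rw [← hv', ← hw', ← hl] at h1
  refine h1.trans ?_
  have hL0 : (0:ℝ) < v.lcm w := by
    exact_mod_cast Nat.lcm_pos hv hw
  rw [overlapLoss]
  split_ifs with hlt
  · rw [Nat.floor_eq_zero.2 hlt]
    simp
  · have h2 := h g v' w' hg hv0 hw0 hco ⌊Δ * v.lcm w⌋₊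
    rw [← hv', ← hw', ← hl] at h2
    refine le_of_mul_le_mul_right (h2.trans ?_) hL0
    have hfl := Nat.floor_le (show 0 ≤ Δ * v.lcm w by positivity)
    have hone : ∀ p : ℕ, p.Prime → 1 ≤ (1 - (1:ℝ) / p)⁻¹ := fun p hp =>
      (one_le_inv₀ (one_sub_inv_pos hp)).2 (one_sub_inv_le p)
    have hP : ∏ p ∈ (v' * w').primeFactors with ⌊Δ * v.lcm w⌋₊ < p, (1 - (1:ℝ) / p)⁻¹ ≤
        ∏ p ∈ (v.lcm w).primeFactors with v.factorization p ≠ w.factorization p ∧ Δ * v.lcm w < p,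
          (1 - (1:ℝ) / p)⁻¹ := by
      refine Finset.prod_le_prod_of_subset_of_one_le ?_ (fun p hp => ?_) fun p hp _ => ?_
      · intro p hp
        obtain ⟨hp, hpX⟩ := Finset.mem_filter.1 hp
        have hpp := Nat.prime_of_mem_primeFactors hp
        have hpd := Nat.dvd_of_mem_primeFactors hp
        refine Finset.mem_filter.2 ⟨Nat.mem_primeFactors.2 ⟨hpp, ?_, (Nat.lcm_pos hv hw).ne'⟩, ?_,
          (Nat.floor_lt (by positivity)).1 hpX⟩
        · rw [hl]; exact hpd.mul_left g
        · rw [hv', hw', Nat.factorization_mul hg.ne' hv0.ne', Nat.factorization_mul hg.ne' hw0.ne',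
            Finsupp.add_apply, Finsupp.add_apply]
          intro he
          have he : v'.factorization p = w'.factorization p := by omega
          rcases hpp.dvd_mul.1 hpd with hd | hd
          · have := hpp.factorization_pos_of_dvd hv0.ne' hd
            rw [he] at this
            exact Nat.Prime.not_coprime_iff_dvd.2 ⟨p, hpp, hd,
              Nat.dvd_of_factorization_pos this.ne'⟩ hco
          · have := hpp.factorization_pos_of_dvd hw0.ne' hd
            rw [← he] at this
            exact Nat.Prime.not_coprime_iff_dvd.2 ⟨p, hpp,
              Nat.dvd_of_factorization_pos this.ne', hd⟩ hco
      · exact zero_le_one.trans (hone p (Nat.prime_of_mem_primeFactors (Finset.mem_filter.1 hp).1))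
      · exact hone p (Nat.prime_of_mem_primeFactors (Finset.mem_filter.1 hp).1)
    calc _ ≤ C * (Δ * v.lcm w) * (v.totient * w.totient) * _ := by
          refine mul_le_mul ?_ hP (Finset.prod_nonneg fun p hp => zero_le_one.trans (hone p
            (Nat.prime_of_mem_primeFactors (Finset.mem_filter.1 hp).1))) (by positivity)
          gcongr
      _ = _ := by ring

theorem exp_le_exp_one_add (m : ℕ) (x : ℝ) :
    Real.exp x ≤ Real.exp 1 + Real.exp (-m) * Real.exp ((m + 1) * x) := by
  rcases le_total x 1 with h | h
  · have := Real.exp_le_exp.2 h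
    have := mul_pos (Real.exp_pos (-m)) (Real.exp_pos ((m + 1) * x))
    linarith
  · rw [← Real.exp_add]
    have : Real.exp x ≤ Real.exp (-m + (m + 1) * x) := by
      refine Real.exp_le_exp.2 ?_
      have : (m:ℝ) * 1 ≤ m * x := mul_le_mul_of_nonneg_left h (Nat.cast_nonneg m)
      linarith
    linarith [Real.exp_pos 1]

theorem exp_mul_sum_inv_le {m : ℕ} {s : Finset ℕ} (hs : ∀ p ∈ s, 2 ^ m < p) :
    Real.exp ((m + 1) * ∑ p ∈ s, (1:ℝ) / p) ≤ ∏ p ∈ s, (1 + 2 * ((m:ℝ) + 1) / p) := by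
  rw [Finset.mul_sum, Real.exp_sum]
  refine Finset.prod_le_prod (fun _ _ => (Real.exp_pos _).le) fun p hp => ?_
  have h1 : m + 1 ≤ p := by
    have := hs p hp
    have := Nat.lt_two_pow_self (n := m)
    omega
  have hp0 : (0:ℝ) < p := by exact_mod_cast (by omega : 0 < p)
  have h1' : ((m:ℝ) + 1) ≤ p := by exact_mod_cast h1
  set x : ℝ := (m + 1) * (1 / p)
  have hx0 : 0 ≤ x := by positivity
  have hx1 : x ≤ 1 := by
    have : x = (m + 1) / p := by simp only [x]; ring
    rw [this, div_le_one hp0]; exact h1'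
  have := Real.abs_exp_sub_one_le (x := x) (by rwa [abs_of_nonneg hx0])
  rw [abs_of_nonneg hx0] at this
  have h2 := (abs_le.1 this).2
  have e : (1:ℝ) + 2 * (m + 1) / p = 1 + 2 * x := by simp only [x]; ring
  rw [e]
  linarith

theorem exists_prod_one_add_le : ∃ C : ℝ, 0 < C ∧ ∀ (m : ℕ) (s : Finset ℕ), (∀ p ∈ s, 2 ^ m < p) →
    ∏ p ∈ s, (1 + 2 * ((m:ℝ) + 1) / p * (13 * (p:ℝ) ^ (-(1/4):ℝ))) ≤ C := by
  have hsum : Summable fun p : ℕ => (p:ℝ) ^ (-(9/8):ℝ) :=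
    Real.summable_nat_rpow.2 (by norm_num)
  set Z := ∑' p : ℕ, (p:ℝ) ^ (-(9/8):ℝ) with hZ
  refine ⟨Real.exp (26 * 16 * Z), Real.exp_pos _, fun m s hs => ?_⟩
  have hterm : ∀ p ∈ s, 2 * ((m:ℝ) + 1) / p * (13 * (p:ℝ) ^ (-(1/4):ℝ)) ≤
      26 * 16 * (p:ℝ) ^ (-(9/8):ℝ) := by
    intro p hp
    have hp1 : (2:ℝ) ^ m ≤ p := by exact_mod_cast (hs p hp).le
    have hp0 : (0:ℝ) < p := lt_of_lt_of_le (by positivity) hp1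
    have e1 : (1:ℝ) / p * (p:ℝ) ^ (-(1/4):ℝ) = (p:ℝ) ^ (-(1/8):ℝ) * (p:ℝ) ^ (-(9/8):ℝ) := by
      rw [one_div, ← Real.rpow_neg_one, ← Real.rpow_add hp0, ← Real.rpow_add hp0]
      norm_num
    have e2 : ((m:ℝ) + 1) * (p:ℝ) ^ (-(1/8):ℝ) ≤ 16 := by
      have h3 : ((m:ℝ) + 1) / 16 ≤ (p:ℝ) ^ ((1/8):ℝ) := by
        calc ((m:ℝ) + 1) / 16 ≤ m * (Real.log 2 / 8) + 1 := by
              have := Real.log_two_gt_d9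
              have : (m:ℝ) * (1/16) ≤ m * (Real.log 2 / 8) :=
                mul_le_mul_of_nonneg_left (by linarith) (Nat.cast_nonneg m)
              linarith
          _ ≤ Real.exp (m * (Real.log 2 / 8)) := Real.add_one_le_exp _
          _ = ((2:ℝ) ^ m) ^ ((1/8):ℝ) := by
              rw [← Real.rpow_natCast, ← Real.rpow_mul (by norm_num), Real.rpow_def_of_pos (by norm_num)]
              congr 1
              ring
          _ ≤ _ := Real.rpow_le_rpow (by positivity) hp1 (by norm_num)
      rw [Real.rpow_neg hp0.le, ← div_eq_mul_inv, div_le_iff₀ (Real.rpow_pos_of_pos hp0 _)]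
      linarith
    have h0 : 0 ≤ (p:ℝ) ^ (-(9/8):ℝ) := (Real.rpow_pos_of_pos hp0 _).le
    calc 2 * ((m:ℝ) + 1) / p * (13 * (p:ℝ) ^ (-(1/4):ℝ))
        = 26 * ((m:ℝ) + 1) * ((1:ℝ) / p * (p:ℝ) ^ (-(1/4):ℝ)) := by ring
      _ = 26 * (((m:ℝ) + 1) * (p:ℝ) ^ (-(1/8):ℝ)) * (p:ℝ) ^ (-(9/8):ℝ) := by rw [e1]; ring
      _ ≤ 26 * 16 * (p:ℝ) ^ (-(9/8):ℝ) := by gcongr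
  calc ∏ p ∈ s, (1 + 2 * ((m:ℝ) + 1) / p * (13 * (p:ℝ) ^ (-(1/4):ℝ)))
      ≤ ∏ p ∈ s, Real.exp (26 * 16 * (p:ℝ) ^ (-(9/8):ℝ)) := by
        refine Finset.prod_le_prod (fun p _ => by positivity) fun p hp => ?_
        exact (add_comm (1:ℝ) _).le.trans ((Real.add_one_le_exp _).trans
          (Real.exp_le_exp.2 (hterm p hp)))
    _ = Real.exp (26 * 16 * ∑ p ∈ s, (p:ℝ) ^ (-(9/8):ℝ)) := by
        rw [← Real.exp_sum, Finset.mul_sum]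
    _ ≤ _ := Real.exp_le_exp.2 (mul_le_mul_of_nonneg_left
        (hsum.sum_le_tsum s fun p _ => by positivity) (by norm_num))

open Classical in
theorem overlapLoss_le {v w : ℕ} {Δ : ℝ} (hv : 0 < v) (hw : 0 < w) (S : Finset ℕ)
    (hvS : v.primeFactors ⊆ S) (hwS : w.primeFactors ⊆ S) {M : ℕ}
    (hM : Δ * v.lcm w < 2 ^ M) :
    overlapLoss v w Δ ≤ Real.exp 2 + ∑ m ∈ Finset.range M, if Δ * v.lcm w ≤ 2 ^ (m + 1) then
      Real.exp (1 - m) * ∏ p ∈ S with 2 ^ m < p,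
        (1 + if v.factorization p ≠ w.factorization p then 2 * ((m:ℝ) + 1) / p else 0) else 0 := by
  have hnn : ∀ m : ℕ, 0 ≤ if Δ * v.lcm w ≤ 2 ^ (m + 1) then
      Real.exp (1 - m) * ∏ p ∈ S with 2 ^ m < p,
        (1 + if v.factorization p ≠ w.factorization p then 2 * ((m:ℝ) + 1) / p else 0) else 0 := by
    intro m
    split_ifs
    · refine mul_nonneg (Real.exp_pos _).le (Finset.prod_nonneg fun p _ => ?_)
      split_ifs <;> positivity
    · exact le_rfl
  have hsn := Finset.sum_nonneg fun m (_ : m ∈ Finset.range M) => hnn m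
  rw [overlapLoss]
  split_ifs with hlt
  · linarith [Real.exp_pos 2]
  push Not at hlt
  set y := Δ * v.lcm w with hy
  set m := Nat.log 2 ⌊y⌋₊ with hm
  have hfl0 : ⌊y⌋₊ ≠ 0 := (Nat.floor_pos.2 hlt).ne'
  have h1 : (2:ℝ) ^ m ≤ y := by
    have := Nat.pow_log_le_self 2 hfl0
    have h2 := (Nat.le_floor_iff (by linarith)).1 this
    exact_mod_cast h2
  have h2 : y < 2 ^ (m + 1) := by
    have := Nat.lt_pow_succ_log_self (b := 2) (by norm_num) ⌊y⌋₊
    have h2 := (Nat.floor_lt (by linarith)).1 this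
    exact_mod_cast h2
  have hmM : m ∈ Finset.range M := by
    rw [Finset.mem_range]
    exact (pow_lt_pow_iff_right₀ (by norm_num : (1:ℝ) < 2)).1 (h1.trans_lt hM)
  have hsingle := Finset.single_le_sum (fun m (_ : m ∈ Finset.range M) => hnn m) hmM
  refine le_trans ?_ (add_le_add le_rfl hsingle)
  rw [if_pos h2.le]
  set s := (v.lcm w).primeFactors.filter
    fun p => v.factorization p ≠ w.factorization p ∧ y < p with hs
  have hsp : ∀ p ∈ s, p.Prime := fun p hp =>
    Nat.prime_of_mem_primeFactors (Finset.mem_filter.1 hp).1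
  have hsm : ∀ p ∈ s, 2 ^ m < p := fun p hp => by
    have := h1.trans_lt (Finset.mem_filter.1 hp).2.2
    exact_mod_cast this
  have hprod : ∏ p ∈ s, (1 + 2 * ((m:ℝ) + 1) / p) ≤ ∏ p ∈ S with 2 ^ m < p,
      (1 + if v.factorization p ≠ w.factorization p then 2 * ((m:ℝ) + 1) / p else 0) := by
    calc _ = ∏ p ∈ s, (1 + if v.factorization p ≠ w.factorization p then
          2 * ((m:ℝ) + 1) / p else 0) :=
          Finset.prod_congr rfl fun p hp => by rw [if_pos (Finset.mem_filter.1 hp).2.1]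
      _ ≤ _ := by
          refine Finset.prod_le_prod_of_subset_of_one_le ?_ (fun p _ => ?_) fun p _ _ => ?_
          · intro p hp
            refine Finset.mem_filter.2 ⟨?_, hsm p hp⟩
            have hpp := hsp p hp
            have hd := (Nat.dvd_of_mem_primeFactors (Finset.mem_filter.1 hp).1).trans
              (Nat.lcm_dvd_mul v w)
            rcases hpp.dvd_mul.1 hd with h | h
            · exact hvS (Nat.mem_primeFactors.2 ⟨hpp, h, hv.ne'⟩)
            · exact hwS (Nat.mem_primeFactors.2 ⟨hpp, h, hw.ne'⟩)
          · split_ifs <;> positivity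
          · have : 0 ≤ if v.factorization p ≠ w.factorization p then
              2 * ((m:ℝ) + 1) / p else 0 := by split_ifs <;> positivity
            linarith
  calc ∏ p ∈ s, (1 - (1:ℝ) / p)⁻¹ ≤ Real.exp (1 + ∑ p ∈ s, (1:ℝ) / p) :=
        prod_inv_one_sub_le s hsp
    _ = Real.exp 1 * Real.exp (∑ p ∈ s, (1:ℝ) / p) := Real.exp_add _ _
    _ ≤ Real.exp 1 * (Real.exp 1 + Real.exp (-m) * Real.exp ((m + 1) * ∑ p ∈ s, (1:ℝ) / p)) :=
        mul_le_mul_of_nonneg_left (exp_le_exp_one_add m _) (Real.exp_pos _).le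
    _ = Real.exp 2 + Real.exp (1 - m) * Real.exp ((m + 1) * ∑ p ∈ s, (1:ℝ) / p) := by
        rw [mul_add, ← Real.exp_add, ← mul_assoc, ← Real.exp_add]
        norm_num
        rfl
    _ ≤ _ := by
        refine add_le_add le_rfl (mul_le_mul_of_nonneg_left ?_ (Real.exp_pos _).le)
        exact (exp_mul_sum_inv_le hsm).trans hprod

open Classical in
theorem exists_sum_dyadic_le : ∃ C : ℝ, 0 < C ∧ ∀ (Q S : Finset ℕ) (δ : ℕ → ℝ) (m : ℕ),
    (∀ q ∈ Q, 0 < q) → (∀ p ∈ S, p.Prime) → (∀ q, 0 ≤ δ q) →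
    ∑ v ∈ Q, ∑ w ∈ Q, (v.totient * δ v) * (w.totient * δ w) *
      (if (δ v + δ w) * v.lcm w ≤ 2 ^ (m + 1) then
        Real.exp (1 - m) * ∏ p ∈ S with 2 ^ m < p,
          (1 + if v.factorization p ≠ w.factorization p then 2 * ((m:ℝ) + 1) / p else 0) else 0)
      ≤ C * (Real.exp (1 - m) * Real.sqrt (2 ^ (m + 1))) *
        (∑ q ∈ Q, q.totient * δ q) ^ (3/2:ℝ) := by
  obtain ⟨K, hK, hlcm⟩ := exists_sum_lcm_le
  obtain ⟨C, hC, hprod⟩ := exists_prod_one_add_le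
  refine ⟨K * C, mul_pos hK hC, fun Q S δ m hQ hS hδ => ?_⟩
  set S' := S.filter (2 ^ m < ·) with hS'
  set z : ℝ := 2 ^ (m + 1) with hz
  set Ψ := ∑ q ∈ Q, (q.totient:ℝ) * δ q with hΨ
  have hΨ0 : 0 ≤ Ψ := Finset.sum_nonneg fun q _ => mul_nonneg (Nat.cast_nonneg _) (hδ q)
  set c : ℕ → ℝ := fun p => 2 * ((m:ℝ) + 1) / p with hc
  have hc0 : ∀ p, 0 ≤ c p := fun p => by simp only [hc]; positivity
  have hterm : ∀ v w : ℕ, (v.totient * δ v) * (w.totient * δ w) *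
      (if (δ v + δ w) * v.lcm w ≤ z then
        Real.exp (1 - m) * ∏ p ∈ S',
          (1 + if v.factorization p ≠ w.factorization p then c p else 0) else 0)
      ≤ ∑ T ∈ S'.powerset, Real.exp (1 - m) * (∏ p ∈ T, c p) *
        (if (∀ p ∈ T, v.factorization p ≠ w.factorization p) ∧ (v.lcm w:ℕ) * δ v ≤ z ∧
          (v.lcm w:ℕ) * δ w ≤ z then (v.totient * δ v) * (w.totient * δ w) else 0) := by
    intro v w
    have hA : 0 ≤ (v.totient * δ v) * (w.totient * δ w) :=
      mul_nonneg (mul_nonneg (Nat.cast_nonneg _) (hδ v)) (mul_nonneg (Nat.cast_nonneg _) (hδ w))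
    split_ifs with h
    · rw [Finset.prod_one_add, Finset.mul_sum, Finset.mul_sum]
      refine Finset.sum_le_sum fun T _ => ?_
      rw [Finset.prod_ite_zero]
      have hl : (0:ℝ) ≤ (v.lcm w : ℕ) := Nat.cast_nonneg _
      have h1 : (v.lcm w:ℕ) * δ v ≤ z := by nlinarith [hδ w, mul_nonneg hl (hδ w)]
      have h2 : (v.lcm w:ℕ) * δ w ≤ z := by nlinarith [hδ v, mul_nonneg hl (hδ v)]
      by_cases hT : ∀ p ∈ T, v.factorization p ≠ w.factorization p
      · rw [if_pos hT, if_pos ⟨hT, h1, h2⟩]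
        exact (by ring : _ = _).le
      · rw [if_neg hT, if_neg fun hh => hT hh.1]
        simp
    · rw [mul_zero]
      refine Finset.sum_nonneg fun T _ => mul_nonneg (mul_nonneg (Real.exp_pos _).le
        (Finset.prod_nonneg fun p _ => hc0 p)) ?_
      split_ifs
      · exact hA
      · exact le_rfl
  calc _ ≤ ∑ v ∈ Q, ∑ w ∈ Q, ∑ T ∈ S'.powerset, Real.exp (1 - m) * (∏ p ∈ T, c p) *
        (if (∀ p ∈ T, v.factorization p ≠ w.factorization p) ∧ (v.lcm w:ℕ) * δ v ≤ z ∧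
          (v.lcm w:ℕ) * δ w ≤ z then (v.totient * δ v) * (w.totient * δ w) else 0) :=
        Finset.sum_le_sum fun v _ => Finset.sum_le_sum fun w _ => hterm v w
    _ = ∑ T ∈ S'.powerset, Real.exp (1 - m) * (∏ p ∈ T, c p) * ∑ v ∈ Q, ∑ w ∈ Q,
        (if (∀ p ∈ T, v.factorization p ≠ w.factorization p) ∧ (v.lcm w:ℕ) * δ v ≤ z ∧
          (v.lcm w:ℕ) * δ w ≤ z then (v.totient * δ v) * (w.totient * δ w) else 0) := by
        simp_rw [Finset.mul_sum]
        rw [Finset.sum_comm (s := S'.powerset)]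
        refine Finset.sum_congr rfl fun v _ => ?_
        rw [Finset.sum_comm]
    _ ≤ ∑ T ∈ S'.powerset, Real.exp (1 - m) * (∏ p ∈ T, c p) *
        (K * (∏ p ∈ T, 13 * (p:ℝ) ^ (-(1/4):ℝ)) * Real.sqrt z * Ψ ^ (3/2:ℝ)) := by
        refine Finset.sum_le_sum fun T hT => mul_le_mul_of_nonneg_left ?_
          (mul_nonneg (Real.exp_pos _).le (Finset.prod_nonneg fun p _ => hc0 p))
        have hTp : ∀ p ∈ T, p.Prime := fun p hp =>
          hS p (Finset.mem_filter.1 (Finset.mem_powerset.1 hT hp)).1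
        refine le_trans (le_of_eq ?_) (hlcm Q T δ z hQ hTp hδ (by positivity))
        refine Finset.sum_congr rfl fun v _ => Finset.sum_congr rfl fun w _ => ?_
        congr
    _ = K * (Real.exp (1 - m) * Real.sqrt z) * Ψ ^ (3/2:ℝ) *
        ∏ p ∈ S', (1 + c p * (13 * (p:ℝ) ^ (-(1/4):ℝ))) := by
        rw [Finset.prod_one_add, Finset.mul_sum]
        refine Finset.sum_congr rfl fun T _ => ?_
        rw [Finset.prod_mul_distrib (f := c)]
        ring
    _ ≤ K * (Real.exp (1 - m) * Real.sqrt z) * Ψ ^ (3/2:ℝ) * C :=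
        mul_le_mul_of_nonneg_left (hprod m S' fun p hp => (Finset.mem_filter.1 hp).2)
          (by positivity)
    _ = _ := by ring

theorem sum_exp_mul_sqrt_le (M : ℕ) :
    ∑ m ∈ Finset.range M, Real.exp (1 - m) * Real.sqrt (2 ^ (m + 1)) ≤ 12 := by
  have he : (2.7:ℝ) < Real.exp 1 := by have := Real.exp_one_gt_d9; linarith
  have he' : Real.exp 1 < (2.72:ℝ) := by have := Real.exp_one_lt_d9; linarith
  have hs : Real.sqrt 2 ≤ 1.42 := by
    rw [Real.sqrt_le_left (by norm_num)]; norm_num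
  have hs0 := Real.sqrt_nonneg 2
  set r := Real.sqrt 2 * Real.exp (-1) with hr
  have hr0 : 0 ≤ r := mul_nonneg hs0 (Real.exp_pos _).le
  have hr1 : r ≤ 0.6 := by
    rw [hr, Real.exp_neg, ← div_eq_mul_inv, div_le_iff₀ (Real.exp_pos 1)]
    nlinarith
  have hterm : ∀ m : ℕ, Real.exp (1 - m) * Real.sqrt (2 ^ (m + 1)) =
      Real.exp 1 * Real.sqrt 2 * r ^ m := by
    intro m
    have h1 : Real.sqrt (2 ^ (m + 1)) = Real.sqrt 2 ^ (m + 1) := by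
      rw [Real.sqrt_eq_iff_mul_self_eq (by positivity) (by positivity), ← mul_pow,
        Real.mul_self_sqrt (by norm_num)]
    have h2 : Real.exp (1 - m) = Real.exp 1 * Real.exp (-1) ^ m := by
      rw [← Real.exp_nat_mul, ← Real.exp_add]; congr 1; ring
    rw [h1, h2, hr, mul_pow]; ring
  simp_rw [hterm]
  rw [← Finset.mul_sum]
  have hg : ∑ m ∈ Finset.range M, r ^ m ≤ 2.5 := by
    have h1 := geom_sum_mul_neg r M
    have h2 := pow_nonneg hr0 M
    have h3 : 0 ≤ ∑ m ∈ Finset.range M, r ^ m := Finset.sum_nonneg fun _ _ => pow_nonneg hr0 _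
    nlinarith
  have h4 : Real.exp 1 * Real.sqrt 2 ≤ 2.72 * 1.42 := mul_le_mul he'.le hs hs0 (by norm_num)
  calc _ ≤ (2.72 * 1.42) * 2.5 := mul_le_mul h4 hg
        (Finset.sum_nonneg fun _ _ => pow_nonneg hr0 _) (by norm_num)
    _ ≤ _ := by norm_num

theorem exists_sum_overlapLoss_le : ∃ C : ℝ, 0 < C ∧ ∀ (Q : Finset ℕ) (δ : ℕ → ℝ),
    (∀ q ∈ Q, 0 < q) → (∀ q, 0 ≤ δ q) →
    ∑ v ∈ Q, ∑ w ∈ Q, (v.totient * δ v) * (w.totient * δ w) * overlapLoss v w (δ v + δ w) ≤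
      C * ((∑ q ∈ Q, q.totient * δ q) ^ 2 + (∑ q ∈ Q, q.totient * δ q) ^ (3/2:ℝ)) := by
  classical
  obtain ⟨C, hC, hdy⟩ := exists_sum_dyadic_le
  refine ⟨Real.exp 2 + C * 12, by positivity, fun Q δ hQ hδ => ?_⟩
  set Ψ := ∑ q ∈ Q, (q.totient:ℝ) * δ q with hΨ
  have hΨ0 : 0 ≤ Ψ := Finset.sum_nonneg fun q _ => mul_nonneg (Nat.cast_nonneg _) (hδ q)
  set S := Q.biUnion Nat.primeFactors with hS
  have hSp : ∀ p ∈ S, p.Prime := fun p hp => by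
    obtain ⟨q, _, h⟩ := Finset.mem_biUnion.1 hp
    exact Nat.prime_of_mem_primeFactors h
  obtain ⟨M, hM⟩ : ∃ M : ℕ, ∀ v ∈ Q, ∀ w ∈ Q, (δ v + δ w) * v.lcm w < 2 ^ M := by
    obtain ⟨M, hM⟩ := pow_unbounded_of_one_lt
      (∑ v ∈ Q, ∑ w ∈ Q, (δ v + δ w) * v.lcm w) (by norm_num : (1:ℝ) < 2)
    refine ⟨M, fun v hv w hw => lt_of_le_of_lt ?_ hM⟩
    have hnn : ∀ v w : ℕ, 0 ≤ (δ v + δ w) * v.lcm w := fun v w =>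
      mul_nonneg (add_nonneg (hδ v) (hδ w)) (Nat.cast_nonneg _)
    exact (Finset.single_le_sum (f := fun w => (δ v + δ w) * (v.lcm w : ℕ))
      (fun w _ => hnn v w) hw).trans (Finset.single_le_sum
      (f := fun v => ∑ w ∈ Q, (δ v + δ w) * (v.lcm w : ℕ))
      (fun v _ => Finset.sum_nonneg fun w _ => hnn v w) hv)
  calc _ ≤ ∑ v ∈ Q, ∑ w ∈ Q, (v.totient * δ v) * (w.totient * δ w) *
        (Real.exp 2 + ∑ m ∈ Finset.range M, if (δ v + δ w) * v.lcm w ≤ 2 ^ (m + 1) then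
          Real.exp (1 - m) * ∏ p ∈ S with 2 ^ m < p, (1 + if v.factorization p ≠ w.factorization p
            then 2 * ((m:ℝ) + 1) / p else 0) else 0) := by
        refine Finset.sum_le_sum fun v hv => Finset.sum_le_sum fun w hw =>
          mul_le_mul_of_nonneg_left ?_ (mul_nonneg (mul_nonneg (Nat.cast_nonneg _) (hδ v))
            (mul_nonneg (Nat.cast_nonneg _) (hδ w)))
        refine (overlapLoss_le (hQ v hv) (hQ w hw) S
          (Finset.subset_biUnion_of_mem Nat.primeFactors hv)
          (Finset.subset_biUnion_of_mem Nat.primeFactors hw) (hM v hv w hw)).trans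
          (le_of_eq ?_)
        congr
    _ = Real.exp 2 * Ψ ^ 2 + ∑ m ∈ Finset.range M, ∑ v ∈ Q, ∑ w ∈ Q,
        (v.totient * δ v) * (w.totient * δ w) *
        (if (δ v + δ w) * v.lcm w ≤ 2 ^ (m + 1) then
          Real.exp (1 - m) * ∏ p ∈ S with 2 ^ m < p, (1 + if v.factorization p ≠ w.factorization p
            then 2 * ((m:ℝ) + 1) / p else 0) else 0) := by
        simp_rw [mul_add, Finset.sum_add_distrib]
        congr 1
        · rw [pow_two, hΨ, Finset.sum_mul_sum, Finset.mul_sum]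
          refine Finset.sum_congr rfl fun v _ => ?_
          rw [Finset.mul_sum]
          exact Finset.sum_congr rfl fun w _ => by ring
        · simp_rw [Finset.mul_sum]
          rw [Finset.sum_comm (s := Finset.range M)]
          refine Finset.sum_congr rfl fun v _ => ?_
          rw [Finset.sum_comm]
    _ ≤ Real.exp 2 * Ψ ^ 2 + ∑ m ∈ Finset.range M,
        C * (Real.exp (1 - m) * Real.sqrt (2 ^ (m + 1))) * Ψ ^ (3/2:ℝ) := by
        refine add_le_add le_rfl (Finset.sum_le_sum fun m _ => ?_)
        refine le_trans (le_of_eq ?_) (hdy Q S δ m hQ hSp hδ)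
        congr
    _ = Real.exp 2 * Ψ ^ 2 + C * Ψ ^ (3/2:ℝ) *
        ∑ m ∈ Finset.range M, Real.exp (1 - m) * Real.sqrt (2 ^ (m + 1)) := by
        rw [Finset.mul_sum]
        congr 1
        exact Finset.sum_congr rfl fun m _ => by ring
    _ ≤ Real.exp 2 * Ψ ^ 2 + C * Ψ ^ (3/2:ℝ) * 12 := by
        gcongr
        exact sum_exp_mul_sqrt_le M
    _ ≤ _ := by
        have h1 : 0 ≤ Ψ ^ (3/2:ℝ) := by positivity
        have h2 : 0 ≤ Ψ ^ 2 := by positivity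
        nlinarith [mul_nonneg (Real.exp_pos 2).le h1, mul_nonneg hC.le h2]

theorem sq_sum_measureReal_le {X ι : Type*} [MeasurableSpace X] (μ : Measure X) [IsFiniteMeasure μ]
    (s : Finset ι) (E : ι → Set X) (hE : ∀ i, MeasurableSet (E i)) :
    (∑ i ∈ s, μ.real (E i)) ^ 2 ≤
      μ.real (⋃ i ∈ s, E i) * ∑ i ∈ s, ∑ j ∈ s, μ.real (E i ∩ E j) := by
  classical
  set U := ⋃ i ∈ s, E i with hU
  have hUm : MeasurableSet U := Finset.measurableSet_biUnion s fun i _ => hE i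
  have hindInt : ∀ A : Set X, MeasurableSet A → Integrable (A.indicator (1 : X → ℝ)) μ := fun A hA =>
    (integrable_const (1:ℝ)).indicator hA
  have key : ∀ t : ℝ, 0 ≤ (∑ i ∈ s, ∑ j ∈ s, μ.real (E i ∩ E j)) * (t * t) +
      (-2 * ∑ i ∈ s, μ.real (E i)) * t + μ.real U := by
    intro t
    have hpt : ∀ x, (t * ∑ i ∈ s, (E i).indicator (1 : X → ℝ) x - U.indicator (1 : X → ℝ) x) ^ 2 =
        t * t * (∑ i ∈ s, ∑ j ∈ s, (E i ∩ E j).indicator (1 : X → ℝ) x) +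
        (-2 * t) * (∑ i ∈ s, (E i).indicator (1 : X → ℝ) x) + U.indicator (1 : X → ℝ) x := by
      intro x
      have h1 : ∑ i ∈ s, ∑ j ∈ s, (E i ∩ E j).indicator (1 : X → ℝ) x =
          (∑ i ∈ s, (E i).indicator (1 : X → ℝ) x) ^ 2 := by
        rw [pow_two, Finset.sum_mul_sum]
        refine Finset.sum_congr rfl fun i _ => Finset.sum_congr rfl fun j _ => ?_
        rw [Set.inter_indicator_one]; rfl
      rw [h1]
      by_cases hx : x ∈ U
      · rw [Set.indicator_of_mem hx, Pi.one_apply]; ring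
      · rw [Set.indicator_of_notMem hx, Finset.sum_eq_zero]
        · ring
        · intro i hi
          exact Set.indicator_of_notMem (fun h => hx (Set.mem_biUnion (t := E) hi h)) _
    have h0 : 0 ≤ ∫ x, (t * ∑ i ∈ s, (E i).indicator (1 : X → ℝ) x -
        U.indicator (1 : X → ℝ) x) ^ 2 ∂μ := integral_nonneg fun x => sq_nonneg _
    simp_rw [hpt] at h0
    have hi1 : Integrable (fun x => ∑ i ∈ s, ∑ j ∈ s, (E i ∩ E j).indicator (1 : X → ℝ) x) μ :=
      integrable_finsetSum _ fun i _ => integrable_finsetSum _ fun j _ =>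
        hindInt _ ((hE i).inter (hE j))
    have hi2 : Integrable (fun x => ∑ i ∈ s, (E i).indicator (1 : X → ℝ) x) μ :=
      integrable_finsetSum _ fun i _ => hindInt _ (hE i)
    have hi12 : Integrable (fun x =>
        t * t * (∑ i ∈ s, ∑ j ∈ s, (E i ∩ E j).indicator (1 : X → ℝ) x) +
        (-2 * t) * (∑ i ∈ s, (E i).indicator (1 : X → ℝ) x)) μ :=
      (hi1.const_mul _).add (hi2.const_mul _)
    rw [integral_add hi12 (hindInt _ hUm),
      integral_add (hi1.const_mul _) (hi2.const_mul _), integral_const_mul, integral_const_mul,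
      integral_finsetSum _ (fun i _ => hindInt _ (hE i)), integral_indicator_one hUm,
      integral_finsetSum _ (fun i _ => integrable_finsetSum _ fun j _ =>
        hindInt _ ((hE i).inter (hE j)))] at h0
    have e1 : ∀ i, ∫ x, ∑ j ∈ s, (E i ∩ E j).indicator (1 : X → ℝ) x ∂μ =
        ∑ j ∈ s, μ.real (E i ∩ E j) := fun i => by
      rw [integral_finsetSum _ (fun j _ => hindInt _ ((hE i).inter (hE j)))]
      exact Finset.sum_congr rfl fun j _ => integral_indicator_one ((hE i).inter (hE j))
    simp_rw [e1, fun i => integral_indicator_one (μ := μ) (hE i)] at h0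
    linarith
  have := discrim_le_zero key
  rw [discrim] at this
  linarith

theorem volume_real_ball_le (y : UnitAddCircle) {r : ℝ} (hr : 0 ≤ r) :
    volume.real (Metric.ball y r) ≤ 2 * r := by
  have h := (measure_mono (μ := volume) (Metric.ball_subset_closedBall (x := y) (ε := r))).trans_eq
    (AddCircle.volume_closedBall (T := (1:ℝ)) r)
  rw [Measure.real]
  refine (ENNReal.toReal_mono ENNReal.ofReal_ne_top h).trans ?_
  rw [ENNReal.toReal_ofReal (by positivity)]
  exact min_le_right _ _

theorem le_volume_real_ball (y : UnitAddCircle) {r : ℝ} (hr2 : r ≤ 1 / 2) :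
    2 * r ≤ volume.real (Metric.ball y r) := by
  refine le_of_forall_lt_imp_le_of_dense fun b hb => ?_
  rcases le_or_gt b 0 with hb0 | hb0
  · exact hb0.trans measureReal_nonneg
  have hsub : Metric.closedBall y (b / 2) ⊆ Metric.ball y r :=
    Metric.closedBall_subset_ball (by linarith)
  have h := measureReal_mono (μ := volume) hsub
  rw [Measure.real, AddCircle.volume_closedBall, ENNReal.toReal_ofReal
    (le_min zero_le_one (by linarith)), min_eq_right (by linarith)] at h
  linarith

theorem exists_volume_iUnion_ge {c₀ : ℝ} (hc₀ : 0 < c₀) : ∃ c : ℝ, 0 < c ∧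
    ∀ (Q : Finset ℕ) (δ : ℕ → ℝ), (∀ q ∈ Q, 0 < q) → (∀ q, 0 ≤ δ q) → (∀ q ∈ Q, δ q ≤ 1 / 2) →
    c₀ ≤ ∑ q ∈ Q, q.totient * δ q →
    c ≤ volume.real (⋃ q ∈ Q, ⋃ y ∈ orderPoints q, Metric.ball y (δ q)) := by
  classical
  obtain ⟨C₁, hC₁, hclose⟩ := exists_card_close_le
  obtain ⟨C₂, hC₂, hloss⟩ := exists_sum_overlapLoss_le
  set D : ℝ := 2 / c₀ + 4 * C₁ * C₂ * (1 + c₀ ^ (-(1/2):ℝ)) with hD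
  have hD0 : 0 < D := by positivity
  refine ⟨4 / D, by positivity, fun Q δ hQ hδ hδ2 hΨ => ?_⟩
  set Ψ := ∑ q ∈ Q, (q.totient:ℝ) * δ q with hΨdef
  have hΨ0 : 0 < Ψ := hc₀.trans_le hΨ
  set s : Finset (Σ _ : ℕ, UnitAddCircle) := Q.sigma orderPoints with hs
  set E : (Σ _ : ℕ, UnitAddCircle) → Set UnitAddCircle := fun i => Metric.ball i.2 (δ i.1) with hE
  have hU : (⋃ q ∈ Q, ⋃ y ∈ orderPoints q, Metric.ball y (δ q)) = ⋃ i ∈ s, E i := by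
    ext x
    simp only [Set.mem_iUnion, hs, Finset.mem_sigma, hE, Sigma.exists, exists_prop]
    constructor
    · rintro ⟨q, hq, y, hy, h⟩; exact ⟨q, y, ⟨hq, hy⟩, h⟩
    · rintro ⟨q, y, ⟨hq, hy⟩, h⟩; exact ⟨q, hq, y, hy, h⟩
  have hCS := sq_sum_measureReal_le (volume : Measure UnitAddCircle) s E
    fun i => Metric.isOpen_ball.measurableSet
  have hfirst : 2 * Ψ ≤ ∑ i ∈ s, volume.real (E i) := by
    rw [hs, Finset.sum_sigma, hΨdef, Finset.mul_sum]
    refine Finset.sum_le_sum fun q hq => ?_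
    calc 2 * ((q.totient:ℝ) * δ q) = ∑ y ∈ orderPoints q, 2 * δ q := by
          rw [Finset.sum_const, card_orderPoints (hQ q hq), nsmul_eq_mul]; ring
      _ ≤ _ := Finset.sum_le_sum fun y _ => le_volume_real_ball y (hδ2 q hq)
  have hpair : ∀ v ∈ Q, ∀ w ∈ Q, ∑ x ∈ orderPoints v, ∑ y ∈ orderPoints w,
      volume.real (Metric.ball x (δ v) ∩ Metric.ball y (δ w)) ≤
      (if v = w then 2 * (v.totient * δ v) else 0) +
      4 * C₁ * ((v.totient * δ v) * (w.totient * δ w) * overlapLoss v w (δ v + δ w)) := by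
    intro v hv w hw
    set μ := min (δ v) (δ w) with hμ
    have hμ0 : 0 ≤ μ := le_min (hδ v) (hδ w)
    have hcl := hclose v w (hQ v hv) (hQ w hw) (δ v + δ w) (add_nonneg (hδ v) (hδ w))
    have hpt : ∀ x ∈ orderPoints v, ∀ y ∈ orderPoints w,
        volume.real (Metric.ball x (δ v) ∩ Metric.ball y (δ w)) ≤
        (if x = y then 2 * δ v else 0) +
        (if x ≠ y ∧ ‖x - y‖ < δ v + δ w then 2 * μ else 0) := by
      intro x _ y _
      by_cases hxy : x = y
      · rw [if_pos hxy, if_neg (fun h => h.1 hxy), add_zero]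
        exact (measureReal_mono Set.inter_subset_left).trans (volume_real_ball_le x (hδ v))
      rw [if_neg hxy, zero_add]
      split_ifs with h
      · rcases min_choice (δ v) (δ w) with h' | h'
        · rw [hμ, h']
          exact (measureReal_mono Set.inter_subset_left).trans (volume_real_ball_le x (hδ v))
        · rw [hμ, h']
          exact (measureReal_mono Set.inter_subset_right).trans (volume_real_ball_le y (hδ w))
      · have : Metric.ball x (δ v) ∩ Metric.ball y (δ w) = ∅ := by
          refine (Metric.ball_disjoint_ball ?_).inter_eq
          rw [dist_eq_norm]
          by_contra hlt
          exact h ⟨hxy, not_le.1 hlt⟩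
        rw [this, measureReal_empty]
    have hsumeq : ∑ x ∈ orderPoints v, ∑ y ∈ orderPoints w, (if x = y then 2 * δ v else 0) ≤
        if v = w then 2 * (v.totient * δ v) else 0 := by
      split_ifs with hvw
      · subst hvw
        calc _ = ∑ x ∈ orderPoints v, 2 * δ v := Finset.sum_congr rfl fun x hx => by
              rw [Finset.sum_ite_eq, if_pos hx]
          _ ≤ _ := by
              rw [Finset.sum_const, card_orderPoints (hQ v hv), nsmul_eq_mul]
              exact (by ring : _ = _).le
      · refine (Finset.sum_eq_zero fun x hx => Finset.sum_eq_zero fun y hy => ?_).le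
        rw [if_neg]
        rintro rfl
        exact hvw (((mem_orderPoints (hQ v hv) x).1 hx).symm.trans
          ((mem_orderPoints (hQ w hw) x).1 hy))
    have hsumne : ∑ x ∈ orderPoints v, ∑ y ∈ orderPoints w,
        (if x ≠ y ∧ ‖x - y‖ < δ v + δ w then 2 * μ else 0) ≤
        4 * C₁ * ((v.totient * δ v) * (w.totient * δ w) * overlapLoss v w (δ v + δ w)) := by
      have hL : 0 ≤ overlapLoss v w (δ v + δ w) := by
        rw [overlapLoss]
        split_ifs
        · exact le_rfl
        · exact Finset.prod_nonneg fun p hp => (inv_pos.2 (one_sub_inv_pos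
            (Nat.prime_of_mem_primeFactors (Finset.mem_filter.1 hp).1))).le
      have hmin : μ * (δ v + δ w) ≤ 2 * (δ v * δ w) := by
        rcases le_total (δ v) (δ w) with h | h
        · rw [hμ, min_eq_left h]; nlinarith [hδ v]
        · rw [hμ, min_eq_right h]; nlinarith [hδ w]
      rw [← Finset.sum_product', ← Finset.sum_filter, Finset.sum_const, nsmul_eq_mul]
      calc _ ≤ C₁ * (δ v + δ w) * (v.totient * w.totient) * overlapLoss v w (δ v + δ w) *
            (2 * μ) := by
            refine mul_le_mul_of_nonneg_right (le_trans (le_of_eq ?_) hcl) (by positivity)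
            congr
        _ = (μ * (δ v + δ w)) * (2 * C₁ * (v.totient * w.totient) *
            overlapLoss v w (δ v + δ w)) := by ring
        _ ≤ 2 * (δ v * δ w) * (2 * C₁ * (v.totient * w.totient) *
            overlapLoss v w (δ v + δ w)) :=
            mul_le_mul_of_nonneg_right hmin (by positivity)
        _ = _ := by ring
    calc _ ≤ ∑ x ∈ orderPoints v, ∑ y ∈ orderPoints w, ((if x = y then 2 * δ v else 0) +
        (if x ≠ y ∧ ‖x - y‖ < δ v + δ w then 2 * μ else 0)) :=
          Finset.sum_le_sum fun x hx => Finset.sum_le_sum fun y hy => hpt x hx y hy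
      _ ≤ _ := by
          simp_rw [Finset.sum_add_distrib]
          exact add_le_add hsumeq hsumne
  have hsecond : ∑ i ∈ s, ∑ j ∈ s, volume.real (E i ∩ E j) ≤ D * Ψ ^ 2 := by
    calc _ = ∑ v ∈ Q, ∑ w ∈ Q, ∑ x ∈ orderPoints v, ∑ y ∈ orderPoints w,
          volume.real (Metric.ball x (δ v) ∩ Metric.ball y (δ w)) := by
          rw [hs, Finset.sum_sigma]
          refine Finset.sum_congr rfl fun v _ => ?_
          simp_rw [Finset.sum_sigma]
          rw [Finset.sum_comm (s := orderPoints v)]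
      _ ≤ ∑ v ∈ Q, ∑ w ∈ Q, ((if v = w then 2 * (v.totient * δ v) else 0) +
          4 * C₁ * ((v.totient * δ v) * (w.totient * δ w) * overlapLoss v w (δ v + δ w))) :=
          Finset.sum_le_sum fun v hv => Finset.sum_le_sum fun w hw => hpair v hv w hw
      _ = 2 * Ψ + 4 * C₁ * ∑ v ∈ Q, ∑ w ∈ Q,
          ((v.totient * δ v) * (w.totient * δ w) * overlapLoss v w (δ v + δ w)) := by
          simp_rw [hΨdef, Finset.sum_add_distrib, Finset.mul_sum]
          congr 1
          refine Finset.sum_congr rfl fun v hv => ?_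
          rw [Finset.sum_ite_eq, if_pos hv]
      _ ≤ 2 * Ψ + 4 * C₁ * (C₂ * (Ψ ^ 2 + Ψ ^ (3/2:ℝ))) :=
          add_le_add le_rfl (mul_le_mul_of_nonneg_left (hloss Q δ hQ hδ) (by positivity))
      _ ≤ D * Ψ ^ 2 := by
          have h1 : Ψ ≤ Ψ ^ 2 / c₀ := by
            rw [le_div_iff₀ hc₀, pow_two]
            exact mul_le_mul_of_nonneg_left hΨ hΨ0.le
          have h2 : Ψ ^ (3/2:ℝ) ≤ c₀ ^ (-(1/2):ℝ) * Ψ ^ 2 := by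
            have : Ψ ^ (3/2:ℝ) = Ψ ^ (-(1/2):ℝ) * Ψ ^ 2 := by
              rw [← Real.rpow_natCast, ← Real.rpow_add hΨ0]; norm_num
            rw [this]
            exact mul_le_mul_of_nonneg_right
              (Real.rpow_le_rpow_of_nonpos hc₀ hΨ (by norm_num)) (by positivity)
          have h3 : D * Ψ ^ 2 = 2 * (Ψ ^ 2 / c₀) +
              4 * C₁ * (C₂ * (Ψ ^ 2 + c₀ ^ (-(1/2):ℝ) * Ψ ^ 2)) := by
            rw [hD]; ring
          rw [h3]
          gcongr
  rw [hU, div_le_iff₀ hD0]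
  have hVol : 0 ≤ volume.real (⋃ i ∈ s, E i) := measureReal_nonneg
  have h5 : (2 * Ψ) ^ 2 ≤ volume.real (⋃ i ∈ s, E i) * (D * Ψ ^ 2) :=
    (pow_le_pow_left₀ (by positivity) hfirst 2).trans
      (hCS.trans (mul_le_mul_of_nonneg_left hsecond hVol))
  have h6 : 4 * Ψ ^ 2 ≤ (volume.real (⋃ i ∈ s, E i) * D) * Ψ ^ 2 := by linarith
  exact le_of_mul_le_mul_right h6 (by positivity)

theorem exists_prod_one_sub_inv_ge : ∃ C : ℝ, 0 < C ∧ ∀ (n : ℕ) (T : Finset ℕ),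
    (∀ p ∈ T, p.Prime) → T.card < n →
    1 / (C * Real.log (2 * n)) ≤ ∏ p ∈ T, (1 - (1:ℝ) / p) := by
  obtain ⟨C, hC, hM⟩ := exists_mertens
  refine ⟨2 * C, by positivity, fun n T hT hcard => ?_⟩
  have hn : 1 ≤ n := by omega
  have hM' := hM (2 * n) (by omega)
  have hpos : ∀ p : ℕ, p.Prime → 0 < 1 - (1:ℝ) / p := fun p hp => one_sub_inv_pos hp
  have hmem : ∀ p ∈ Nat.primesLE (2 * n), p.Prime := fun p hp => (Nat.mem_primesLE.1 hp).2
  rw [← Finset.prod_filter_mul_prod_filter_not T (· ≤ 2 * n)]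
  have h1 : 1 / (C * Real.log (2 * n)) ≤ ∏ p ∈ T with p ≤ 2 * n, (1 - (1:ℝ) / p) := by
    calc 1 / (C * Real.log (2 * n)) ≤ ∏ p ∈ Nat.primesLE (2 * n), (1 - (1:ℝ) / p) := by
          rw [Finset.prod_inv_distrib] at hM'
          have hP : 0 < ∏ p ∈ Nat.primesLE (2 * n), (1 - (1:ℝ) / p) :=
            Finset.prod_pos fun p hp => hpos p (hmem p hp)
          push_cast at hM'
          rw [one_div]
          exact inv_le_of_inv_le₀ hP hM'
      _ ≤ _ := by
          refine Finset.prod_le_prod_of_subset_of_le_one ?_ (fun p hp => (hpos p (hmem p hp)).le)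
            fun p _ _ => one_sub_inv_le p
          intro p hp
          rw [Finset.mem_filter] at hp
          exact Nat.mem_primesLE.2 ⟨hp.2, hT p hp.1⟩
  have h2 : (1:ℝ) / 2 ≤ ∏ p ∈ T with ¬ p ≤ 2 * n, (1 - (1:ℝ) / p) := by
    have hn0 : (0:ℝ) < n := by exact_mod_cast hn
    have hx : (1:ℝ) / (2 * n) ≤ 1 / 2 := by
      have : (1:ℝ) ≤ n := by exact_mod_cast hn
      gcongr
      linarith
    calc (1:ℝ) / 2 = 1 + n * (-(1 / (2 * n))) := by field_simp; ring
      _ ≤ (1 + -(1 / (2 * (n:ℝ)))) ^ n := one_add_mul_le_pow (by linarith) n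
      _ ≤ (1 - 1 / (2 * (n:ℝ))) ^ (T.filter fun p => ¬ p ≤ 2 * n).card := by
          rw [← sub_eq_add_neg]
          refine pow_le_pow_of_le_one (by linarith) ?_ ((Finset.card_filter_le _ _).trans hcard.le)
          have : (0:ℝ) ≤ 1 / (2 * n) := by positivity
          linarith
      _ = ∏ p ∈ T with ¬ p ≤ 2 * n, (1 - 1 / (2 * (n:ℝ))) := by rw [Finset.prod_const]
      _ ≤ _ := by
          refine Finset.prod_le_prod (fun p _ => by linarith) fun p hp => ?_
          have : (2 * (n:ℝ)) ≤ p := by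
            exact_mod_cast (not_le.1 (Finset.mem_filter.1 hp).2).le
          gcongr
  calc 1 / (2 * C * Real.log (2 * n)) = 1 / (C * Real.log (2 * n)) * (1 / 2) := by
        rw [div_mul_div_comm]; ring_nf
    _ ≤ _ := mul_le_mul h1 h2 (by norm_num)
        (Finset.prod_nonneg fun p hp => (hpos p (hT p (Finset.mem_filter.1 hp).1)).le)

theorem mul_prod_le_sum_totient {k : ℕ} (hk : 0 < k) {T : Finset ℕ} (hT : T ⊆ k.primeFactors) :
    (k:ℝ) * ∏ p ∈ T, (1 - (1:ℝ) / p) ≤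
      ∑ q ∈ k.divisors with ∀ p ∈ T, p ^ k.factorization p ∣ q, (q.totient : ℝ) := by
  classical
  set A := ∏ p ∈ T, p ^ k.factorization p with hA
  set B := ∏ p ∈ k.primeFactors \ T, p ^ k.factorization p with hB
  have hprime : ∀ p ∈ k.primeFactors, p.Prime := fun p hp => Nat.prime_of_mem_primeFactors hp
  have hAB : A * B = k := by
    rw [hA, hB, mul_comm, Finset.prod_sdiff hT]
    exact Nat.prod_factorization_pow_eq_self hk.ne'
  have hcop : A.Coprime B := by
    refine Nat.Coprime.prod_left fun p hp => Nat.Coprime.prod_right fun r hr => ?_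
    refine Nat.Coprime.pow _ _ ((Nat.coprime_primes (hprime p (hT hp))
      (hprime r (Finset.mem_sdiff.1 hr).1)).2 ?_)
    rintro rfl
    exact (Finset.mem_sdiff.1 hr).2 hp
  have hA0 : 0 < A := Nat.pos_of_mul_pos_right (hAB ▸ hk)
  have hB0 : 0 < B := Nat.pos_of_mul_pos_left (hAB ▸ hk)
  have hphi : (A:ℝ) * ∏ p ∈ T, (1 - (1:ℝ) / p) ≤ A.totient := by
    rw [totient_eq_prod_real]
    refine mul_le_mul_of_nonneg_left ?_ (Nat.cast_nonneg _)
    refine Finset.prod_le_prod_of_subset_of_le_one ?_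
      (fun p hp => (one_sub_inv_pos (hprime p (hT hp))).le) fun p _ _ => one_sub_inv_le p
    intro p hp
    have hpp := Nat.prime_of_mem_primeFactors hp
    obtain ⟨r, hr, hpr⟩ := (Prime.dvd_finsetProd_iff hpp.prime _).1
      (Nat.dvd_of_mem_primeFactors hp)
    rwa [(Nat.prime_dvd_prime_iff_eq hpp (hprime r (hT hr))).1 (hpp.dvd_of_dvd_pow hpr)]
  calc (k:ℝ) * ∏ p ∈ T, (1 - (1:ℝ) / p) = (A * ∏ p ∈ T, (1 - (1:ℝ) / p)) * B := by
        rw [← hAB]; push_cast; ring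
    _ ≤ A.totient * B := mul_le_mul_of_nonneg_right hphi (Nat.cast_nonneg _)
    _ = ∑ d ∈ B.divisors, ((A * d).totient : ℝ) := by
        conv_lhs => rw [← Nat.sum_totient B]
        push_cast
        rw [Finset.mul_sum]
        refine Finset.sum_congr rfl fun d hd => ?_
        rw [Nat.totient_mul (hcop.coprime_dvd_right (Nat.dvd_of_mem_divisors hd))]
        push_cast; rfl
    _ = ∑ q ∈ B.divisors.image (A * ·), (q.totient : ℝ) := by
        rw [Finset.sum_image]
        intro x _ y _ h
        exact Nat.eq_of_mul_eq_mul_left hA0 h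
    _ ≤ _ := by
        refine Finset.sum_le_sum_of_subset_of_nonneg ?_ fun _ _ _ => Nat.cast_nonneg _
        intro q hq
        obtain ⟨d, hd, rfl⟩ := Finset.mem_image.1 hq
        refine Finset.mem_filter.2 ⟨Nat.mem_divisors.2 ⟨?_, hk.ne'⟩, fun p hp => ?_⟩
        · conv_rhs => rw [← hAB]
          exact mul_dvd_mul_left _ (Nat.dvd_of_mem_divisors hd)
        · exact (Finset.dvd_prod_of_mem (fun p => p ^ k.factorization p) hp).trans
            (Dvd.intro _ rfl)

theorem exists_sum_totient_new_ge : ∃ C : ℝ, 0 < C ∧ ∀ (n k : ℕ) (K : Finset ℕ),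
    (∀ j ∈ K, 0 < j ∧ j < k) → K.card < n →
    k / (C * Real.log (2 * n)) ≤
      ∑ q ∈ k.divisors with ∀ j ∈ K, ¬ q ∣ j, (q.totient : ℝ) := by
  classical
  obtain ⟨C, hC, h⟩ := exists_prod_one_sub_inv_ge
  refine ⟨C, hC, fun n k K hK hcard => ?_⟩
  rcases Nat.eq_zero_or_pos k with rfl | hk
  · simp
  have hex : ∀ j, ∃ p, j ∈ K → p ∈ k.primeFactors ∧ j.factorization p < k.factorization p := by
    intro j
    by_cases hj : j ∈ K
    · have hnd : ¬ k.factorization ≤ j.factorization := fun hle =>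
        absurd (Nat.le_of_dvd (hK j hj).1
          ((Nat.factorization_le_iff_dvd hk.ne' (hK j hj).1.ne').1 hle)) (not_le.2 (hK j hj).2)
      rw [Finsupp.le_def] at hnd
      push Not at hnd
      obtain ⟨p, hp⟩ := hnd
      refine ⟨p, fun _ => ⟨?_, hp⟩⟩
      rw [← Nat.support_factorization, Finsupp.mem_support_iff]
      omega
    · exact ⟨0, fun h => absurd h hj⟩
  choose f hf using hex
  set T := K.image f with hT
  have hTk : T ⊆ k.primeFactors := by
    intro p hp
    obtain ⟨j, hj, rfl⟩ := Finset.mem_image.1 hp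
    exact (hf j hj).1
  have h1 := h n T (fun p hp => Nat.prime_of_mem_primeFactors (hTk hp))
    (Finset.card_image_le.trans_lt hcard)
  calc k / (C * Real.log (2 * n)) = k * (1 / (C * Real.log (2 * n))) := by ring
    _ ≤ k * ∏ p ∈ T, (1 - (1:ℝ) / p) := mul_le_mul_of_nonneg_left h1 (Nat.cast_nonneg _)
    _ ≤ _ := mul_prod_le_sum_totient hk hTk
    _ ≤ _ := by
        refine Finset.sum_le_sum_of_subset_of_nonneg ?_ fun _ _ _ => Nat.cast_nonneg _
        intro q hq
        rw [Finset.mem_filter] at hq ⊢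
        refine ⟨hq.1, fun j hj hqj => ?_⟩
        have hfj := hf j hj
        have hd := (hq.2 (f j) (Finset.mem_image_of_mem f hj)).trans hqj
        have := ((Nat.prime_of_mem_primeFactors hfj.1).pow_dvd_iff_le_factorization
          (hK j hj).1.ne').1 hd
        omega

theorem exists_sum_totient_mul_ge : ∃ C : ℝ, 0 < C ∧ ∀ (K : Finset ℕ) (ρ δ : ℕ → ℝ),
    (∀ k ∈ K, 0 < k) → (∀ k, 0 ≤ ρ k) → (∀ q, 0 ≤ δ q) → (∀ q, ∀ k ∈ K, q ∣ k → ρ k ≤ δ q) →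
    (∑ k ∈ K, k * ρ k) / (C * Real.log (2 * K.card)) ≤
      ∑ q ∈ K.biUnion Nat.divisors, q.totient * δ q := by
  classical
  obtain ⟨C, hC, h⟩ := exists_sum_totient_new_ge
  refine ⟨C, hC, fun K ρ δ hK hρ hδ0 hδ => ?_⟩
  set G : ℕ → Finset ℕ := fun k => k.divisors.filter fun q => ∀ j ∈ K.filter (· < k), ¬ q ∣ j with hG
  have hdisj : (K : Set ℕ).PairwiseDisjoint G := by
    have aux : ∀ k ∈ K, ∀ j ∈ K, k < j → Disjoint (G k) (G j) := by
      intro k hk j _ hkj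
      rw [Finset.disjoint_left]
      intro q hqk hqj
      simp only [hG, Finset.mem_filter] at hqk hqj
      exact hqj.2 k ⟨hk, hkj⟩ (Nat.dvd_of_mem_divisors hqk.1)
    intro k hk j hj hkj
    rcases lt_or_gt_of_ne hkj with hlt | hlt
    · exact aux k hk j hj hlt
    · exact (aux j hj k hk hlt).symm
  calc (∑ k ∈ K, k * ρ k) / (C * Real.log (2 * K.card))
      = ∑ k ∈ K, k / (C * Real.log (2 * K.card)) * ρ k := by
        rw [Finset.sum_div]
        exact Finset.sum_congr rfl fun k _ => by ring
    _ ≤ ∑ k ∈ K, ∑ q ∈ G k, q.totient * δ q := by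
        refine Finset.sum_le_sum fun k hk => ?_
        have hcard : (K.filter (· < k)).card < K.card := by
          refine Finset.card_lt_card (Finset.ssubset_iff_subset_ne.2 ⟨Finset.filter_subset _ _, ?_⟩)
          intro he
          have := he ▸ hk
          exact lt_irrefl _ (Finset.mem_filter.1 this).2
        have h1 := h K.card k (K.filter (· < k)) (fun j hj =>
          ⟨hK j (Finset.mem_filter.1 hj).1, (Finset.mem_filter.1 hj).2⟩) hcard
        refine (mul_le_mul_of_nonneg_right h1 (hρ k)).trans ?_
        rw [Finset.sum_mul]
        refine Finset.sum_le_sum fun q hq => mul_le_mul_of_nonneg_left ?_ (Nat.cast_nonneg _)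
        exact hδ q k hk (Nat.dvd_of_mem_divisors (Finset.mem_filter.1 hq).1)
    _ = ∑ q ∈ K.biUnion G, q.totient * δ q := (Finset.sum_biUnion hdisj).symm
    _ ≤ _ := Finset.sum_le_sum_of_subset_of_nonneg
        (Finset.biUnion_mono fun k _ => Finset.filter_subset _ _)
        fun q _ _ => mul_nonneg (Nat.cast_nonneg _) (hδ0 q)

theorem UnitAddCircle.exists_nsmul_eq_zero_norm_sub_le (x : UnitAddCircle) {k : ℕ} (hk : 0 < k) :
    ∃ y : UnitAddCircle, k • y = 0 ∧ ‖x - y‖ ≤ ‖k • x‖ / k := by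
  induction x using QuotientAddGroup.induction_on with
  | H r =>
  have hk0 : (0:ℝ) < k := by exact_mod_cast hk
  refine ⟨(((round (k * r) : ℤ) / k : ℝ) : UnitAddCircle), ?_, ?_⟩
  · rw [← AddCircle.coe_nsmul, nsmul_eq_mul, mul_div_cancel₀ _ hk0.ne']
    exact (AddCircle.coe_eq_zero_iff 1).2 ⟨round (k * r), by simp⟩
  · have e1 : ‖k • (r : UnitAddCircle)‖ = |k * r - round (k * r)| := by
      rw [← AddCircle.coe_nsmul, nsmul_eq_mul, UnitAddCircle.norm_eq]
    change ‖(r : UnitAddCircle) - _‖ ≤ ‖k • (r : UnitAddCircle)‖ / k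
    rw [e1, ← AddCircle.coe_sub, UnitAddCircle.norm_eq]
    refine (round_le _ 0).trans ?_
    rw [Int.cast_zero, sub_zero, ← abs_of_pos hk0, ← abs_div, abs_of_pos hk0]
    refine (congrArg abs ?_).le
    field_simp

theorem countable_setOf_isOfFinAddOrder :
    {x : UnitAddCircle | IsOfFinAddOrder x}.Countable := by
  have : {x : UnitAddCircle | IsOfFinAddOrder x} ⊆
      ⋃ n : ℕ, ((orderPoints (n + 1) : Finset UnitAddCircle) : Set UnitAddCircle) := by
    intro x hx
    have hx' : 0 < addOrderOf x := addOrderOf_pos_iff.2 hx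
    refine Set.mem_iUnion.2 ⟨addOrderOf x - 1, ?_⟩
    rw [Finset.mem_coe, mem_orderPoints (by omega)]
    omega
  exact (Set.countable_iUnion fun n => Finset.countable_toSet _).mono this

theorem exists_addOrderOf_gt_of_frequently {ψ : ℕ → ℝ} (hψ : ∀ k, ψ k ≤ 1) {x : UnitAddCircle}
    (hx : ¬ IsOfFinAddOrder x) (h : ∃ᶠ k in atTop, ‖k • x‖ < ψ k) (B : ℕ) :
    ∃ k y, 0 < k ∧ k • y = 0 ∧ B < addOrderOf y ∧ ‖x - y‖ < ψ k / k := by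
  classical
  set Y := (Finset.range B).biUnion fun n => orderPoints (n + 1) with hY
  obtain ⟨ε, hε, hYε⟩ : ∃ ε > 0, ∀ y ∈ Y, ε ≤ ‖x - y‖ := by
    rcases Y.eq_empty_or_nonempty with h0 | hne
    · exact ⟨1, one_pos, by simp [h0]⟩
    obtain ⟨y₀, hy₀, hmin⟩ := Finset.exists_min_image Y (fun y => ‖x - y‖) hne
    refine ⟨‖x - y₀‖, ?_, hmin⟩
    refine norm_pos_iff.2 (sub_ne_zero.2 ?_)
    rintro rfl
    obtain ⟨n, -, hn⟩ := Finset.mem_biUnion.1 hy₀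
    rw [mem_orderPoints n.succ_pos] at hn
    exact hx (addOrderOf_pos_iff.1 (by omega))
  obtain ⟨n, hn⟩ := exists_nat_gt (1 / ε)
  obtain ⟨k, hk, hkx⟩ := (frequently_atTop.1 h) (n + 1)
  have hk0 : 0 < k := by omega
  have hkr : (0:ℝ) < k := by exact_mod_cast hk0
  obtain ⟨y, hy0, hy⟩ := UnitAddCircle.exists_nsmul_eq_zero_norm_sub_le x hk0
  have hlt : ‖x - y‖ < ψ k / k := hy.trans_lt (div_lt_div_of_pos_right hkx hkr)
  refine ⟨k, y, hk0, hy0, ?_, hlt⟩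
  by_contra! hB
  have hpos : 0 < addOrderOf y :=
    addOrderOf_pos_iff.2 (isOfFinAddOrder_iff_nsmul_eq_zero.2 ⟨k, hk0, hy0⟩)
  have hyY : y ∈ Y := by
    refine Finset.mem_biUnion.2 ⟨addOrderOf y - 1, Finset.mem_range.2 (by omega), ?_⟩
    rw [mem_orderPoints (by omega)]
    omega
  have h1 : ε ≤ 1 / k := (hYε y hyY).trans (hlt.le.trans (by gcongr; exact hψ k))
  have h2 : (n:ℝ) + 1 ≤ k := by exact_mod_cast hk
  rw [le_div_iff₀ hkr] at h1
  rw [div_lt_iff₀ hε] at hn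
  nlinarith

theorem norm_nsmul_lt_of_norm_sub_lt {x y : UnitAddCircle} {k : ℕ} (hk : 0 < k) (hy : k • y = 0)
    {r : ℝ} (h : ‖x - y‖ < r / k) : ‖k • x‖ < r := by
  have hkr : (0:ℝ) < k := by exact_mod_cast hk
  have e : k • x = k • (x - y) := by rw [nsmul_sub, hy, sub_zero]
  rw [e]
  calc ‖k • (x - y)‖ ≤ k * ‖x - y‖ := norm_nsmul_le
    _ < k * (r / k) := mul_lt_mul_of_pos_left h hkr
    _ = r := mul_div_cancel₀ _ hkr.ne'

theorem UnitAddCircle.mem_addWellApproximable_iff_infinite (δ : ℕ → ℝ) (x : UnitAddCircle) :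
    x ∈ addWellApproximable UnitAddCircle δ ↔
      {q : ℕ | 0 < q ∧ ∃ y : UnitAddCircle, addOrderOf y = q ∧ ‖x - y‖ < δ q}.Infinite := by
  simp only [mem_add_wellApproximable_iff, ← Nat.cofinite_eq_atTop, cofinite.blimsup_set_eq,
    Set.mem_ofPred_eq]
  refine iff_of_eq (congrArg Set.Infinite (Set.ext fun q => and_congr_right fun _ => ?_))
  rw [mem_approx_add_orderOf_iff]
  exact exists_congr fun y => by rw [Metric.mem_ball, dist_eq_norm]

theorem ae_frequently_norm_nsmul_lt_or_null {ψ : ℕ → ℝ} (hψ0 : ∀ k, 0 ≤ ψ k) (hψ1 : ∀ k, ψ k ≤ 1) :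
    volume {x : UnitAddCircle | ∃ᶠ k in atTop, ‖k • x‖ < ψ k} = 0 ∨
    ∀ᵐ x : UnitAddCircle, ∃ᶠ k in atTop, ‖k • x‖ < ψ k := by
  set D : ℕ → Set ℝ := fun q => {d | ∃ k : ℕ, 0 < k ∧ q ∣ k ∧ d = ψ k / k} with hD
  set δ : ℕ → ℝ := fun q => sSup (D q) with hδ
  have hbound : ∀ q, ∀ d ∈ D q, d ≤ 1 / q := by
    rintro q d ⟨k, hk, hqk, rfl⟩
    have hq : 0 < q := Nat.pos_of_dvd_of_pos hqk hk
    have h1 : (q:ℝ) ≤ k := by exact_mod_cast Nat.le_of_dvd hk hqk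
    have h2 : (0:ℝ) < q := by exact_mod_cast hq
    exact div_le_div₀ zero_le_one (hψ1 k) h2 h1
  have hδ0 : ∀ q, 0 ≤ δ q := fun q => Real.sSup_nonneg fun d ⟨k, _, _, h⟩ =>
    h ▸ div_nonneg (hψ0 k) (Nat.cast_nonneg _)
  have hδ1 : ∀ q, δ q ≤ 1 / q := fun q =>
    Real.sSup_le (hbound q) (by positivity)
  have hδt : Tendsto δ atTop (nhds 0) :=
    squeeze_zero hδ0 hδ1 tendsto_one_div_atTop_nhds_zero_nat
  rcases AddCircle.addWellApproximable_ae_empty_or_univ (T := (1:ℝ)) δ hδt with h | h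
  · left
    have hfin : ∀ᵐ x : UnitAddCircle, ¬ IsOfFinAddOrder x := by
      rw [ae_iff]
      simp only [not_not]
      rw [← Set.biUnion_of_singleton {x : UnitAddCircle | IsOfFinAddOrder x},
        measure_biUnion_null_iff countable_setOf_isOfFinAddOrder]
      intro x _
      rw [← Metric.closedBall_zero, AddCircle.volume_closedBall]
      simp
    refine measure_mono_null ?_ (ae_iff.1 (h.and hfin))
    intro x hx hx'
    refine hx'.1 ?_
    rw [UnitAddCircle.mem_addWellApproximable_iff_infinite, Set.infinite_iff_exists_gt]
    intro B
    obtain ⟨k, y, hk, hy, hB, hxy⟩ := exists_addOrderOf_gt_of_frequently hψ1 hx'.2 hx B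
    refine ⟨addOrderOf y, ⟨by omega, y, rfl, hxy.trans_le ?_⟩, hB⟩
    exact le_csSup ⟨_, hbound _⟩ ⟨k, hk, addOrderOf_dvd_iff_nsmul_eq_zero.2 hy, rfl⟩
  · right
    filter_upwards [h] with x hx
    rw [UnitAddCircle.mem_addWellApproximable_iff_infinite, Set.infinite_iff_exists_gt] at hx
    refine frequently_atTop.2 fun B => ?_
    obtain ⟨q, ⟨hq, y, hyq, hxy⟩, hB⟩ := hx B
    have hne : (D q).Nonempty := ⟨_, q, hq, dvd_rfl, rfl⟩
    obtain ⟨_, ⟨k, hk, hqk, rfl⟩, hlt⟩ := exists_lt_of_lt_csSup hne hxy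
    refine ⟨k, hB.le.trans (Nat.le_of_dvd hk hqk), norm_nsmul_lt_of_norm_sub_lt hk ?_ hlt⟩
    exact addOrderOf_dvd_iff_nsmul_eq_zero.1 (hyq ▸ hqk)

theorem exists_volume_setOf_norm_nsmul_lt_ge {c₀ : ℝ} (hc₀ : 0 < c₀) : ∃ c : ℝ, 0 < c ∧
    ∀ (K : Finset ℕ) (ψ : ℕ → ℝ), K.Nonempty → (∀ k ∈ K, 2 ≤ k) → (∀ k, 0 ≤ ψ k) →
    (∀ k, ψ k ≤ 1) → c₀ * Real.log (2 * K.card) ≤ ∑ k ∈ K, ψ k →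
    c ≤ volume.real {x : UnitAddCircle | ∃ k ∈ K, ‖k • x‖ < ψ k} := by
  classical
  obtain ⟨C, hC, hΨ⟩ := exists_sum_totient_mul_ge
  obtain ⟨c, hc, hvol⟩ := exists_volume_iUnion_ge (div_pos hc₀ hC)
  refine ⟨c, hc, fun K ψ hne hK hψ0 hψ1 hsum => ?_⟩
  have hex : ∀ q : ℕ, ∃ d : ℝ, 0 ≤ d ∧ (∀ k ∈ K, q ∣ k → ψ k / k ≤ d) ∧
      (q ∈ K.biUnion Nat.divisors → ∃ k ∈ K, q ∣ k ∧ d = ψ k / k) := by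
    intro q
    rcases (K.filter (q ∣ ·)).eq_empty_or_nonempty with h0 | h0
    · have hn : ∀ k ∈ K, ¬ q ∣ k := fun k hk hq =>
        Finset.notMem_empty k (h0 ▸ Finset.mem_filter.2 ⟨hk, hq⟩)
      refine ⟨0, le_rfl, fun k hk hq => absurd hq (hn k hk), fun hq => ?_⟩
      obtain ⟨k, hk, hqk⟩ := Finset.mem_biUnion.1 hq
      exact absurd (Nat.dvd_of_mem_divisors hqk) (hn k hk)
    · obtain ⟨k, hk, hmax⟩ := Finset.exists_max_image _ (fun k => ψ k / k) h0
      rw [Finset.mem_filter] at hk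
      exact ⟨ψ k / k, div_nonneg (hψ0 k) (Nat.cast_nonneg _),
        fun j hj hq => hmax j (Finset.mem_filter.2 ⟨hj, hq⟩), fun _ => ⟨k, hk.1, hk.2, rfl⟩⟩
  choose δ hδ0 hδle hδex using hex
  have hQpos : ∀ q ∈ K.biUnion Nat.divisors, 0 < q := fun q hq => by
    obtain ⟨k, _, hqk⟩ := Finset.mem_biUnion.1 hq
    exact Nat.pos_of_mem_divisors hqk
  have hhalf : ∀ q ∈ K.biUnion Nat.divisors, δ q ≤ 1 / 2 := fun q hq => by
    obtain ⟨k, hk, _, h⟩ := hδex q hq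
    have : (2:ℝ) ≤ k := by exact_mod_cast hK k hk
    rw [h]
    exact div_le_div₀ zero_le_one (hψ1 k) two_pos this
  have hcard : (1:ℝ) ≤ K.card := by exact_mod_cast Finset.card_pos.2 hne
  have hlog : 0 < Real.log (2 * K.card) := Real.log_pos (by linarith)
  have h1 := hΨ K (fun k => ψ k / k) δ (fun k hk => by have := hK k hk; omega)
    (fun k => div_nonneg (hψ0 k) (Nat.cast_nonneg _)) hδ0 (fun q k hk hqk => hδle q k hk hqk)
  have h2 : c₀ / C ≤ ∑ q ∈ K.biUnion Nat.divisors, q.totient * δ q := by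
    refine le_trans ?_ h1
    rw [← div_div, div_right_comm]
    refine div_le_div_of_nonneg_right ?_ hC.le
    rw [le_div_iff₀ hlog]
    refine hsum.trans (Finset.sum_le_sum fun k hk => ?_)
    have : (0:ℝ) < k := by exact_mod_cast (by have := hK k hk; omega : 0 < k)
    exact (mul_div_cancel₀ _ this.ne').ge
  refine (hvol _ δ hQpos hδ0 hhalf h2).trans (measureReal_mono ?_)
  intro x hx
  simp only [Set.mem_iUnion, exists_prop] at hx
  obtain ⟨q, hq, y, hy, hxy⟩ := hx
  obtain ⟨k, hk, hqk, hd⟩ := hδex q hq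
  rw [mem_orderPoints (hQpos q hq)] at hy
  refine ⟨k, hk, norm_nsmul_lt_of_norm_sub_lt (y := y) (by have := hK k hk; omega) ?_ ?_⟩
  · exact addOrderOf_dvd_iff_nsmul_eq_zero.1 (hy ▸ hqk)
  · rw [← hd, ← dist_eq_norm]; exact hxy

theorem ae_frequently_norm_nsmul_lt {ψ : ℕ → ℝ} (hψ0 : ∀ k, 0 ≤ ψ k) (hψ1 : ∀ k, ψ k ≤ 1)
    {c₀ : ℝ} (hc₀ : 0 < c₀) (hK : ∀ n, ∃ K : Finset ℕ, K.Nonempty ∧ (∀ k ∈ K, n ≤ k) ∧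
      c₀ * Real.log (2 * K.card) ≤ ∑ k ∈ K, ψ k) :
    ∀ᵐ x : UnitAddCircle, ∃ᶠ k in atTop, ‖k • x‖ < ψ k := by
  refine (ae_frequently_norm_nsmul_lt_or_null hψ0 hψ1).resolve_left fun hnull => ?_
  obtain ⟨c, hc, hvol⟩ := exists_volume_setOf_norm_nsmul_lt_ge hc₀
  set W : ℕ → Set UnitAddCircle := fun n => {x | ∃ k, n ≤ k ∧ ‖k • x‖ < ψ k} with hW
  have hWopen : ∀ n, IsOpen (W n) := by
    intro n
    have : W n = ⋃ k : ℕ, ⋃ _ : n ≤ k, {x : UnitAddCircle | ‖k • x‖ < ψ k} := by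
      ext x; simp [hW]
    rw [this]
    exact isOpen_iUnion fun k => isOpen_iUnion fun _ =>
      isOpen_lt (continuous_nsmul k).norm continuous_const
  have hanti : Antitone W := fun m n hmn x ⟨k, hk, h⟩ => ⟨k, hmn.trans hk, h⟩
  have hInter : ⋂ n, W n = {x : UnitAddCircle | ∃ᶠ k in atTop, ‖k • x‖ < ψ k} := by
    ext x
    simp only [hW, Set.mem_iInter, Set.mem_ofPred_eq, frequently_atTop]
  have ht := tendsto_measure_iInter_atTop (μ := (volume : Measure UnitAddCircle))
    (fun n => (hWopen n).measurableSet.nullMeasurableSet) hanti ⟨0, measure_ne_top _ _⟩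
  rw [hInter, hnull] at ht
  have hge : ∀ n, ENNReal.ofReal c ≤ (volume ∘ W) n := by
    intro n
    obtain ⟨K, hne, hKn, hsum⟩ := hK (max n 2)
    have h1 := hvol K ψ hne (fun k hk => (le_max_right n 2).trans (hKn k hk)) hψ0 hψ1 hsum
    refine ENNReal.ofReal_le_of_le_toReal (h1.trans (measureReal_mono ?_))
    rintro x ⟨k, hk, h⟩
    exact ⟨k, (le_max_left n 2).trans (hKn k hk), h⟩
  exact absurd (ge_of_tendsto' ht hge) (by simpa using hc)

/-- The reciprocal of the size of the first set of the family `D` containing `k`, or `0` if there is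
no such set. -/
noncomputable def firstCardInv (D : ℕ → Finset ℕ) (k : ℕ) : ℝ :=
  open Classical in if ∃ N, k ∈ D N then 1 / ((D (sInf {N | k ∈ D N})).card : ℝ) else 0

theorem firstCardInv_nonneg (D : ℕ → Finset ℕ) (k : ℕ) : 0 ≤ firstCardInv D k := by
  rw [firstCardInv]
  split_ifs <;> positivity

theorem firstCardInv_le_one (D : ℕ → Finset ℕ) (k : ℕ) : firstCardInv D k ≤ 1 := by
  rw [firstCardInv]
  split_ifs with h
  · have hmem : k ∈ D (sInf {N | k ∈ D N}) := Nat.sInf_mem h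
    have : (1:ℝ) ≤ (D (sInf {N | k ∈ D N})).card := by
      exact_mod_cast Finset.card_pos.2 ⟨k, hmem⟩
    exact (div_le_one (by linarith)).2 this
  · exact zero_le_one

theorem firstCardInv_of_mem_of_notMem {D : ℕ → Finset ℕ} (hD : Monotone D) {k N : ℕ}
    (h : k ∈ D (N + 1)) (h' : k ∉ D N) : firstCardInv D k = 1 / ((D (N + 1)).card : ℝ) := by
  have hN : sInf {N | k ∈ D N} = N + 1 := by
    refine le_antisymm (Nat.sInf_le h) ?_
    by_contra! hlt
    have hmem : k ∈ D (sInf {N | k ∈ D N}) := Nat.sInf_mem (s := {N | k ∈ D N}) ⟨_, h⟩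
    exact h' (hD (Nat.lt_succ_iff.1 hlt) hmem)
  rw [firstCardInv, if_pos ⟨_, h⟩, hN]

theorem log_sub_log_le_sum_firstCardInv {D : ℕ → Finset ℕ} (hD : Monotone D) {N₀ : ℕ}
    (hpos : 0 < (D N₀).card) (hstep : ∀ N, N₀ ≤ N → (D (N + 1)).card ≤ 3 * (D N).card)
    {N₁ : ℕ} (hN : N₀ ≤ N₁) :
    (1 / 3) * (Real.log (D N₁).card - Real.log (D N₀).card) ≤
      ∑ k ∈ D N₁ \ D N₀, firstCardInv D k := by
  induction N₁, hN using Nat.le_induction with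
  | base => simp
  | succ N hN ih =>
    have hsplit : D (N + 1) \ D N₀ = (D N \ D N₀) ∪ (D (N + 1) \ D N) := by
      ext k
      have h1 : k ∈ D N₀ → k ∈ D N := fun h => hD hN h
      have h2 : k ∈ D N → k ∈ D (N + 1) := fun h => hD N.le_succ h
      simp only [Finset.mem_union, Finset.mem_sdiff]
      tauto
    have hdisj : Disjoint (D N \ D N₀) (D (N + 1) \ D N) := by
      rw [Finset.disjoint_left]
      intro k h1 h2
      exact (Finset.mem_sdiff.1 h2).2 (Finset.mem_sdiff.1 h1).1
    rw [hsplit, Finset.sum_union hdisj]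
    have hc : 0 < (D N).card := hpos.trans_le (Finset.card_le_card (hD hN))
    have hc' : (D N).card ≤ (D (N + 1)).card := Finset.card_le_card (hD N.le_succ)
    have h0 : (0:ℝ) < (D N).card := by exact_mod_cast hc
    have h1 : ((D N).card:ℝ) ≤ (D (N + 1)).card := by exact_mod_cast hc'
    have h3 : ((D (N + 1)).card:ℝ) ≤ 3 * (D N).card := by exact_mod_cast hstep N hN
    have hsum : ∑ k ∈ D (N + 1) \ D N, firstCardInv D k =
        (((D (N + 1)).card:ℝ) - (D N).card) / (D (N + 1)).card := by
      rw [Finset.sum_congr rfl fun k hk => firstCardInv_of_mem_of_notMem hD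
        (Finset.mem_sdiff.1 hk).1 (Finset.mem_sdiff.1 hk).2, Finset.sum_const,
        Finset.card_sdiff_of_subset (hD N.le_succ), nsmul_eq_mul, Nat.cast_sub hc']
      ring
    have hlog : Real.log (D (N + 1)).card - Real.log (D N).card ≤
        (((D (N + 1)).card:ℝ) - (D N).card) / (D N).card := by
      rw [← Real.log_div (by linarith) h0.ne', sub_div, div_self h0.ne']
      exact Real.log_le_sub_one_of_pos (div_pos (by linarith) h0)
    have hcmp : (1 / 3) * ((((D (N + 1)).card:ℝ) - (D N).card) / (D N).card) ≤
        (((D (N + 1)).card:ℝ) - (D N).card) / (D (N + 1)).card := by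
      rw [div_mul_div_comm, one_mul]
      exact div_le_div_of_nonneg_left (by linarith) (by linarith) h3
    rw [hsum]
    linarith

theorem ae_frequently_norm_nsmul_lt_firstCardInv {D : ℕ → Finset ℕ} (hD : Monotone D)
    (hcard : ∀ N, N ≤ (D (N + 1)).card) (hstep : ∀ N, (D (N + 1)).card ≤ (D N).card + N) :
    ∀ᵐ x : UnitAddCircle, ∃ᶠ k in atTop, ‖k • x‖ < firstCardInv D k := by
  refine ae_frequently_norm_nsmul_lt (firstCardInv_nonneg D) (firstCardInv_le_one D)
    (c₀ := 1 / 6) (by norm_num) fun n => ?_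
  set N₀ := max 2 ((Finset.range n).sup fun k => sInf {N | k ∈ D N}) with hN₀
  have hpos : 0 < (D N₀).card :=
    lt_of_lt_of_le (Nat.zero_lt_one.trans_le (hcard 1)) (Finset.card_le_card (hD (le_max_left _ _)))
  have hstep' : ∀ N, N₀ ≤ N → (D (N + 1)).card ≤ 3 * (D N).card := by
    intro N hN
    have h2 : 2 ≤ N := (le_max_left _ _).trans hN
    have h3 := hcard (N - 1)
    rw [Nat.sub_add_cancel (by omega)] at h3
    have := hstep N
    omega
  set N₁ := N₀ + 4 * (D N₀).card ^ 2 + 1 with hN₁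
  have hN : N₀ ≤ N₁ := by omega
  have hbig : 4 * (D N₀).card ^ 2 ≤ (D N₁).card := le_trans (by omega) (hcard (N₀ + 4 * (D N₀).card ^ 2))
  have hlog := log_sub_log_le_sum_firstCardInv hD hpos hstep' hN
  have h0 : (1:ℝ) ≤ (D N₀).card := by exact_mod_cast hpos
  have hbig' : 4 * ((D N₀).card:ℝ) ^ 2 ≤ (D N₁).card := by exact_mod_cast hbig
  have hlt : (D N₀).card < (D N₁).card := by nlinarith
  have hne : (D N₁ \ D N₀).Nonempty := by
    rw [← Finset.card_pos]
    have := Finset.le_card_sdiff (D N₀) (D N₁)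
    omega
  refine ⟨D N₁ \ D N₀, hne, fun k hk => ?_, ?_⟩
  · by_contra! hkn
    rw [Finset.mem_sdiff] at hk
    have hmem : k ∈ D (sInf {N | k ∈ D N}) := Nat.sInf_mem (s := {N | k ∈ D N}) ⟨_, hk.1⟩
    exact hk.2 (hD ((Finset.le_sup (f := fun k => sInf {N | k ∈ D N})
      (Finset.mem_range.2 hkn)).trans (le_max_right _ _)) hmem)
  · have hK : ((D N₁ \ D N₀).card:ℝ) ≤ (D N₁).card := by
      exact_mod_cast Finset.card_le_card Finset.sdiff_subset
    have hK0 : (0:ℝ) < (D N₁ \ D N₀).card := by exact_mod_cast Finset.card_pos.2 hne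
    have h1 : Real.log (2 * (D N₁ \ D N₀).card) ≤ Real.log 2 + Real.log (D N₁).card := by
      rw [← Real.log_mul (by norm_num) (by linarith)]
      exact Real.log_le_log (by linarith) (by linarith)
    have h2 : Real.log 2 + Real.log 2 + 2 * Real.log (D N₀).card ≤ Real.log (D N₁).card := by
      refine le_trans (le_of_eq ?_) (Real.log_le_log (by positivity) hbig')
      rw [Real.log_mul (by norm_num) (by positivity), Real.log_pow,
        show (4:ℝ) = 2 * 2 by norm_num, Real.log_mul (by norm_num) (by norm_num)]
      push_cast
      ring
    have h3 : 0 ≤ Real.log 2 := Real.log_nonneg one_le_two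
    refine le_trans ?_ hlog
    linarith

/-- The floored differences between the first `N` terms of a real sequence. -/
noncomputable def flooredDiffs (a : ℕ → ℝ) (N : ℕ) : Finset ℕ :=
  (((Finset.Icc 1 N) ×ˢ (Finset.Icc 1 N)).filter fun x => x.1 ≠ x.2).image
    fun x => ⌊|a x.1 - a x.2|⌋₊

theorem mem_flooredDiffs {a : ℕ → ℝ} {N k : ℕ} : k ∈ flooredDiffs a N ↔
    ∃ m n, 1 ≤ m ∧ m ≤ N ∧ 1 ≤ n ∧ n ≤ N ∧ m ≠ n ∧ ⌊|a m - a n|⌋₊ = k := by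
  simp only [flooredDiffs, Finset.mem_image, Finset.mem_filter, Finset.mem_product,
    Finset.mem_Icc, Prod.exists]
  exact exists_congr fun m => exists_congr fun n => by tauto

theorem monotone_flooredDiffs (a : ℕ → ℝ) : Monotone (flooredDiffs a) := by
  intro M N hMN k hk
  obtain ⟨m, n, h1, h2, h3, h4, h5, h6⟩ := mem_flooredDiffs.1 hk
  exact mem_flooredDiffs.2 ⟨m, n, h1, h2.trans hMN, h3, h4.trans hMN, h5, h6⟩

theorem card_flooredDiffs_succ_le (a : ℕ → ℝ) (N : ℕ) :
    (flooredDiffs a (N + 1)).card ≤ (flooredDiffs a N).card + N := by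
  have hsub : flooredDiffs a (N + 1) ⊆
      flooredDiffs a N ∪ (Finset.Icc 1 N).image fun m => ⌊|a m - a (N + 1)|⌋₊ := by
    intro k hk
    obtain ⟨m, n, h1, h2, h3, h4, h5, rfl⟩ := mem_flooredDiffs.1 hk
    rw [Finset.mem_union]
    by_cases hm : m = N + 1
    · subst hm
      exact Or.inr (Finset.mem_image.2 ⟨n, Finset.mem_Icc.2 ⟨h3, by omega⟩, by rw [abs_sub_comm]⟩)
    by_cases hn : n = N + 1
    · subst hn
      exact Or.inr (Finset.mem_image.2 ⟨m, Finset.mem_Icc.2 ⟨h1, by omega⟩, rfl⟩)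
    · exact Or.inl (mem_flooredDiffs.2 ⟨m, n, h1, by omega, h3, by omega, h5, rfl⟩)
  refine (Finset.card_le_card hsub).trans ((Finset.card_union_le _ _).trans ?_)
  have := Finset.card_image_le (s := Finset.Icc 1 N) (f := fun m => ⌊|a m - a (N + 1)|⌋₊)
  rw [Nat.card_Icc] at this
  omega

theorem le_card_flooredDiffs_succ {a : ℕ → ℝ}
    (hsep : ∀ m n, 1 ≤ m → 1 ≤ n → m ≠ n → 1 ≤ |a m - a n|) (N : ℕ) :
    N ≤ (flooredDiffs a (N + 1)).card := by
  obtain ⟨i, hi, hmin⟩ := Finset.exists_min_image (Finset.Icc 1 (N + 1)) a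
    ⟨1, Finset.mem_Icc.2 ⟨le_rfl, by omega⟩⟩
  set s := (Finset.Icc 1 (N + 1)).erase i with hs
  have hcard : s.card = N := by
    rw [Finset.card_erase_of_mem hi, Nat.card_Icc]; omega
  have habs : ∀ m ∈ s, |a m - a i| = a m - a i := fun m hm =>
    abs_of_nonneg (sub_nonneg.2 (hmin m (Finset.mem_of_mem_erase hm)))
  have hlt : ∀ m ∈ s, ∀ n ∈ s, a m ≤ a n → m ≠ n → ⌊|a m - a i|⌋₊ < ⌊|a n - a i|⌋₊ := by
    intro m hm n hn hle hmn
    have h1 := hsep m n (Finset.mem_Icc.1 (Finset.mem_of_mem_erase hm)).1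
      (Finset.mem_Icc.1 (Finset.mem_of_mem_erase hn)).1 hmn
    rw [abs_of_nonpos (by linarith)] at h1
    rw [habs m hm, habs n hn]
    have h0 : 0 ≤ a m - a i := sub_nonneg.2 (hmin m (Finset.mem_of_mem_erase hm))
    refine Nat.succ_le_iff.1 ?_
    rw [Nat.succ_eq_add_one, ← Nat.floor_add_one h0]
    exact Nat.floor_le_floor (by linarith)
  have hinj : Set.InjOn (fun m => ⌊|a m - a i|⌋₊) s := by
    intro m hm n hn h
    by_contra hmn
    rcases le_total (a m) (a n) with hle | hle
    · exact (hlt m hm n hn hle hmn).ne h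
    · exact (hlt n hn m hm hle (Ne.symm hmn)).ne' h
  refine (hcard.symm.trans (Finset.card_image_of_injOn hinj).symm).trans_le
    (Finset.card_le_card fun k hk => ?_)
  obtain ⟨m, hm, rfl⟩ := Finset.mem_image.1 hk
  have hm' := Finset.mem_Icc.1 (Finset.mem_of_mem_erase hm)
  have hi' := Finset.mem_Icc.1 hi
  exact mem_flooredDiffs.2 ⟨m, i, hm'.1, hm'.2, hi'.1, hi'.2, Finset.ne_of_mem_erase hm, rfl⟩

theorem Hcard_eq_card_flooredDiffs (a : ℕ → ℝ) (N : ℕ) : Hcard a N = (flooredDiffs a N).card := by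
  have : {k : ℤ | ∃ m n : ℕ, 1 ≤ m ∧ m ≤ N ∧ 1 ≤ n ∧ n ≤ N ∧ m ≠ n ∧ k = ⌊|a m - a n|⌋} =
      (fun k : ℕ => (k : ℤ)) '' (flooredDiffs a N : Set ℕ) := by
    ext k
    simp only [Set.mem_ofPred_eq, Set.mem_image, Finset.mem_coe, mem_flooredDiffs]
    constructor
    · rintro ⟨m, n, h1, h2, h3, h4, h5, rfl⟩
      exact ⟨_, ⟨m, n, h1, h2, h3, h4, h5, rfl⟩, Int.natCast_floor_eq_floor (abs_nonneg _)⟩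
    · rintro ⟨_, ⟨m, n, h1, h2, h3, h4, h5, rfl⟩, rfl⟩
      exact ⟨m, n, h1, h2, h3, h4, h5, Int.natCast_floor_eq_floor (abs_nonneg _)⟩
  rw [Hcard, this, Set.ncard_image_of_injective _ Nat.cast_injective, Set.ncard_coe_finset]

theorem floorDeltaMin_le_norm {a : ℕ → ℝ} {N k : ℕ} (hk : k ∈ flooredDiffs a N) (α : ℝ) :
    floorDeltaMin a α N ≤ ‖k • (α : UnitAddCircle)‖ := by
  obtain ⟨m, n, h1, h2, h3, h4, h5, rfl⟩ := mem_flooredDiffs.1 hk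
  have hbdd : BddBelow {d : ℝ | ∃ m n : ℕ, 1 ≤ m ∧ m ≤ N ∧ 1 ≤ n ∧ n ≤ N ∧ m ≠ n ∧
      d = nint (α * (⌊|a m - a n|⌋ : ℝ))} :=
    ⟨0, fun d ⟨_, _, _, _, _, _, _, h⟩ => h ▸ abs_nonneg _⟩
  refine csInf_le hbdd ⟨m, n, h1, h2, h3, h4, h5, ?_⟩
  rw [← AddCircle.coe_nsmul, nsmul_eq_mul, UnitAddCircle.norm_eq, nint,
    ← Int.natCast_floor_eq_floor (abs_nonneg (a m - a n)), Int.cast_natCast, mul_comm α]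

theorem frequently_floorDeltaMin_le {a : ℕ → ℝ} {α : ℝ}
    (h : ∃ᶠ k in atTop, ‖k • (α : UnitAddCircle)‖ < firstCardInv (flooredDiffs a) k) :
    ∃ᶠ N in atTop, floorDeltaMin a α N ≤ 1 / (Hcard a N : ℝ) := by
  refine frequently_atTop.2 fun B => ?_
  obtain ⟨k, hk, hlt⟩ := frequently_atTop.1 h ((flooredDiffs a B).sup id + 1)
  have hpos : 0 < firstCardInv (flooredDiffs a) k := (norm_nonneg _).trans_lt hlt
  by_cases hex : ∃ N, k ∈ flooredDiffs a N
  · rw [firstCardInv, if_pos hex] at hlt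
    have hmem : k ∈ flooredDiffs a (sInf {N | k ∈ flooredDiffs a N}) :=
      Nat.sInf_mem (s := {N | k ∈ flooredDiffs a N}) hex
    refine ⟨_, ?_, (floorDeltaMin_le_norm hmem α).trans ?_⟩
    · by_contra! hB
      have := Finset.le_sup (f := id) (monotone_flooredDiffs a hB.le hmem)
      simp only [id_eq] at this
      omega
    · rw [Hcard_eq_card_flooredDiffs]
      exact hlt.le
  · rw [firstCardInv, if_neg hex] at hpos
    exact absurd hpos (lt_irrefl _)

theorem stmt5 (a : ℕ → ℝ)
    (hpos : ∀ n, 1 ≤ n → 0 < a n)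
    (hdist : ∀ m n, 1 ≤ m → 1 ≤ n → m ≠ n → a m ≠ a n)
    (hsep : ∀ m n, 1 ≤ m → 1 ≤ n → m ≠ n → 1 ≤ |a m - a n|) :
    ∀ᵐ α ∂(volume.restrict (Set.Icc (0:ℝ) 1)),
      ∃ᶠ N in atTop, floorDeltaMin a α N ≤ 1 / (Hcard a N : ℝ) := by
  have h := ae_frequently_norm_nsmul_lt_firstCardInv (monotone_flooredDiffs a)
    (le_card_flooredDiffs_succ hsep) (card_flooredDiffs_succ_le a)
  have h' := (UnitAddCircle.measurePreserving_mk 0).quasiMeasurePreserving.ae h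
  rw [zero_add, restrict_Ioc_eq_restrict_Icc] at h'
  filter_upwards [h'] with α hα
  exact frequently_floorDeltaMin_le hα
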